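/- Let p ∈ [2,∞), T ∈ (0,∞), κ > 0, and f ∈ L_p((0,T); L_p(ℝ^d)). Assume ∫_0^T |a(t)| dt < ∞ and the uniform ellipticity Σ_{i,j} a^{ij}(t) ξ^i ξ^j ≥ κ |ξ|^2 for all t ∈ (0,T] and ξ ∈ ℝ^d (no upper bound on the a^{ij} is assumed). Let u : [0,T] → L_p(ℝ^d) be a weak solution of ∂_t u = a^{ij}(t) u_{x^i x^j} + f with u(0) = 0, continuous from [0,T] into L_p(ℝ^d). Then for a.e. t ∈ (0,T) the distributional second derivatives of u(t,·) are represented by functions u_{x^i x^j}(t,·) ∈ L_p(ℝ^d), and ( ∫_0^T Σ_{i,j} ‖u_{x^i x^j}(t,·)‖_{L_p}^p dt )^{1/p} ≤ N κ^{-1} ( ∫_0^T ‖f(t,·)‖_{L_p}^p dt )^{1/p}, where N depends only on d and p (and is independent of κ, T, and the coefficients). -/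

import Mathlib

open MeasureTheory Set ENNReal

noncomputable section

/-- The partial derivative `∂_{x^i} φ` of a function on `ℝ^d`. -/
def pd {d : ℕ} (i : Fin d) (φ : (Fin d → ℝ) → ℝ) : (Fin d → ℝ) → ℝ :=
  fun x => fderiv ℝ φ x (Pi.single i 1)

/-- `|a(t)| = max_{i,j} |a^{ij}(t)|`. -/
def aMax {d : ℕ} (a : ℝ → Fin d → Fin d → ℝ) (t : ℝ) : ℝ :=
  ⨆ i, ⨆ j, |a t i j|

/-- `u` is a weak solution of `∂_t u = a^{ij}(t) u_{x^i x^j} + f`, `u(0) = u₀`, on `[0,T]`. -/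
def IsWeakSolution {d : ℕ} (p : ℝ≥0∞) (T : ℝ) (a : ℝ → Fin d → Fin d → ℝ)
    (u0 : Lp ℝ p (volume : Measure (Fin d → ℝ)))
    (f u : ℝ → Lp ℝ p (volume : Measure (Fin d → ℝ))) : Prop :=
  ∀ φ : (Fin d → ℝ) → ℝ, ContDiff ℝ (⊤ : ℕ∞) φ → HasCompactSupport φ →
    ∀ t ∈ Icc (0:ℝ) T,
      (∫ x, u t x * φ x) =
        (∫ x, u0 x * φ x) +
        ∫ s in Ioc (0:ℝ) t,
          ((∑ i, ∑ j, a s i j * ∫ x, u s x * pd i (pd j φ) x)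
            + ∫ x, f s x * φ x)

/-! Part 1 -/

/-- lazy random walk -/
def rwW : ℕ → ℤ → ℝ
  | 0, m => if m = 0 then 1 else 0
  | n+1, m => (rwW n (m-1) + 2 * rwW n m + rwW n (m+1)) / 4

lemma rwW_succ (n : ℕ) (m : ℤ) :
    rwW (n+1) m = (rwW n (m-1) + 2 * rwW n m + rwW n (m+1)) / 4 := rfl

lemma rwW_nonneg (n : ℕ) : ∀ m, 0 ≤ rwW n m := by
  induction n with
  | zero => intro m; simp only [rwW]; split_ifs <;> norm_num
  | succ n ih => intro m; rw [rwW_succ]; have := ih (m-1); have := ih m; have := ih (m+1); positivity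

lemma rwW_zero (n : ℕ) : ∀ m : ℤ, (n:ℤ) < |m| → rwW n m = 0 := by
  induction n with
  | zero => intro m hm; simp only [rwW]; rw [if_neg]; rintro rfl; simp at hm
  | succ n ih =>
    intro m hm
    rw [rwW_succ, ih (m-1), ih m, ih (m+1)]
    · norm_num
    all_goals (push_cast at hm; rcases abs_cases m with h | h <;> rcases abs_cases (m+1) with h' | h' <;> rcases abs_cases (m-1) with h'' | h'' <;> lia)

lemma rwW_rec (n : ℕ) : ∀ m : ℤ, ((n:ℝ)+1+m) * rwW n (m+1) = (n-m) * rwW n m := by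
  induction n with
  | zero =>
    intro m; simp only [rwW]
    by_cases h : m = 0
    · subst h; simp
    · by_cases h' : m + 1 = 0
      · have : (m:ℝ) = -1 := by exact_mod_cast (by lia : m = -1)
        simp [h, h', this]
      · simp [h, h']
  | succ n ih =>
    intro m
    have h1 := ih (m-1); have h2 := ih m; have h3 := ih (m+1)
    have e1 : m - 1 + 1 = m := by ring
    have e2 : m + 1 - 1 = m := by ring
    rw [e1] at h1
    rw [rwW_succ, rwW_succ, e2]
    push_cast at *
    linear_combination (1/4) * h3 + (1/4) * h1 + (1/2) * h2

lemma rwW_id (n : ℕ) (m : ℤ) :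
    ((n:ℝ)+1) * (2*n+1) * rwW n m = 2 * (((n:ℝ)+1)^2 - m^2) * rwW (n+1) m := by
  have h1 := rwW_rec n (m-1); have h2 := rwW_rec n m
  have e1 : m - 1 + 1 = m := by ring
  rw [e1] at h1
  rw [rwW_succ]
  push_cast at *
  linear_combination (-(1/2)) * ((n:ℝ)+1-m) * h2 + (1/2) * ((n:ℝ)+1+m) * h1

lemma rwW_fin (n : ℕ) : (Function.support (rwW n)).Finite := by
  apply (Set.finite_Icc (-(n:ℤ)) n).subset
  intro m hm
  by_contra h
  apply hm
  apply rwW_zero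
  rw [Set.mem_Icc, ← abs_le] at h
  exact not_le.mp h

lemma rwW_summable (n : ℕ) (F : ℤ → ℝ) : Summable (fun m => F m * rwW n m) := by
  apply summable_of_hasFiniteSupport
  apply (rwW_fin n).subset
  intro m hm h
  apply hm
  simp [h]

/-- expectation under the walk -/
def rwE (n : ℕ) (F : ℤ → ℝ) : ℝ := ∑' m, F m * rwW n m

lemma rwE_zero (F : ℤ → ℝ) : rwE 0 F = F 0 := by
  rw [rwE, tsum_eq_single 0]
  · simp [rwW]
  · intro m hm; simp [rwW, hm]

lemma rwE_add (n : ℕ) (F G : ℤ → ℝ) : rwE n (fun m => F m + G m) = rwE n F + rwE n G := by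
  simp only [rwE, add_mul]
  exact (rwW_summable n F).tsum_add (rwW_summable n G)

lemma rwE_mul (n : ℕ) (c : ℝ) (F : ℤ → ℝ) : rwE n (fun m => c * F m) = c * rwE n F := by
  simp only [rwE, mul_assoc]
  exact tsum_mul_left

lemma rwE_mono (n : ℕ) {F G : ℤ → ℝ} (h : ∀ m, F m ≤ G m) : rwE n F ≤ rwE n G :=
  (rwW_summable n F).tsum_le_tsum (fun m => mul_le_mul_of_nonneg_right (h m) (rwW_nonneg n m))
    (rwW_summable n G)

lemma rwE_succ (n : ℕ) (F : ℤ → ℝ) :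
    rwE (n+1) F = rwE n (fun m => (1/4) * F (m+1) + ((1/2) * F m + (1/4) * F (m-1))) := by
  rw [rwE_add, rwE_add, rwE_mul, rwE_mul, rwE_mul]
  have a1 : Summable (fun m => F m * rwW n (m-1)) := by
    have := (rwW_summable n (fun m => F (m+1)))
    have := (Equiv.subRight (1:ℤ)).summable_iff.mpr this
    refine this.congr ?_
    intro m; simp [Function.comp]
  have a2 := (rwW_summable n F)
  have a3 : Summable (fun m => F m * rwW n (m+1)) := by
    have := (rwW_summable n (fun m => F (m-1)))
    have := (Equiv.addRight (1:ℤ)).summable_iff.mpr this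
    refine this.congr ?_
    intro m; simp [Function.comp]
  have b1 : rwE n (fun m => F (m+1)) = ∑' m, F m * rwW n (m-1) := by
    rw [rwE, ← (Equiv.subRight (1:ℤ)).tsum_eq]; simp
  have b3 : rwE n (fun m => F (m-1)) = ∑' m, F m * rwW n (m+1) := by
    rw [rwE, ← (Equiv.addRight (1:ℤ)).tsum_eq]; simp
  rw [b1, b3]
  have : ∀ m, F m * rwW (n+1) m = (1/4) * (F m * rwW n (m-1)) + ((1/2) * (F m * rwW n m) + (1/4) * (F m * rwW n (m+1))) := by
    intro m; rw [rwW_succ]; ring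
  rw [rwE, tsum_congr this, Summable.tsum_add, Summable.tsum_add, tsum_mul_left, tsum_mul_left, tsum_mul_left, rwE]
  · exact a2.mul_left _
  · exact a3.mul_left _
  · exact a1.mul_left _
  · exact (a2.mul_left _).add (a3.mul_left _)

lemma rwE_one (n : ℕ) : rwE n (fun _ => 1) = 1 := by
  induction n with
  | zero => rw [rwE_zero]
  | succ n ih => rw [rwE_succ]; norm_num; exact ih

lemma rwE_sq (n : ℕ) : rwE n (fun m => (m:ℝ)^2) = n/2 := by
  induction n with
  | zero => rw [rwE_zero]; simp
  | succ n ih =>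
    rw [rwE_succ]
    have : (fun m : ℤ => (1/4:ℝ) * (((m+1:ℤ)):ℝ)^2 + ((1/2) * (m:ℝ)^2 + (1/4) * (((m-1:ℤ)):ℝ)^2)) = fun m : ℤ => (m:ℝ)^2 + (1/2) * 1 := by
      ext m; push_cast; ring
    rw [this, rwE_add, rwE_mul, rwE_one, ih]; push_cast; ring

lemma rwE_four (n : ℕ) : rwE n (fun m => (m:ℝ)^4) = (3*n^2-n)/4 := by
  induction n with
  | zero => rw [rwE_zero]; simp
  | succ n ih =>
    rw [rwE_succ]
    have : (fun m : ℤ => (1/4:ℝ) * (((m+1:ℤ)):ℝ)^4 + ((1/2) * (m:ℝ)^4 + (1/4) * (((m-1:ℤ)):ℝ)^4)) = fun m : ℤ => (m:ℝ)^4 + (3 * (m:ℝ)^2 + (1/2) * 1) := by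
      ext m; push_cast; ring
    rw [this, rwE_add, rwE_add, rwE_mul, rwE_mul, rwE_one, rwE_sq, ih]; push_cast; ring

/-- expectation of even quartic polynomials -/
lemma rwE_poly (n : ℕ) (a b c : ℝ) :
    rwE n (fun m => a + (b * (m:ℝ)^2 + c * (m:ℝ)^4)) = a + (b * (n/2) + c * ((3*n^2-n)/4)) := by
  have := rwE_mul n a (fun _ => 1)
  simp only [mul_one, rwE_one] at this
  rw [rwE_add, rwE_add, rwE_mul, rwE_mul, rwE_sq, rwE_four, this]

/-- the kernel -/
def rwK (n : ℕ) (m : ℤ) : ℝ := rwW n m - rwW (n+1) m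

lemma rwK_id (n : ℕ) (m : ℤ) :
    rwK n m * (((n:ℝ)+1) * (2*n+1)) = rwW (n+1) m * (n + 1 - 2 * m^2) := by
  rw [rwK]; linear_combination rwW_id n m

lemma tsum_enorm_le_rwE {n : ℕ} {f : ℤ → ℝ} {F : ℤ → ℝ} (h : ∀ m, |f m| ≤ F m * rwW n m) :
    ∑' m, ‖f m‖ₑ ≤ ENNReal.ofReal (rwE n F) := by
  rw [rwE, ENNReal.ofReal_tsum_of_nonneg (fun m => (abs_nonneg _).trans (h m)) (rwW_summable n F)]
  refine ENNReal.tsum_le_tsum fun m => ?_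
  rw [Real.enorm_eq_ofReal_abs]
  exact ENNReal.ofReal_le_ofReal (h m)

lemma rwK_abs (n : ℕ) (m : ℤ) :
    |rwK n m| ≤ (n + 1 + 2 * (m:ℝ)^2) / (((n:ℝ)+1) * (2*n+1)) * rwW (n+1) m := by
  have h := rwK_id n m
  have hp : (0:ℝ) < ((n:ℝ)+1) * (2*n+1) := by positivity
  have : rwK n m = rwW (n+1) m * (n + 1 - 2 * m^2) / (((n:ℝ)+1) * (2*n+1)) := by
    rw [_root_.eq_div_iff hp.ne', h]
  rw [this, abs_div, abs_of_pos hp, abs_mul, abs_of_nonneg (rwW_nonneg _ _), div_mul_eq_mul_div, mul_comm]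
  gcongr
  · exact rwW_nonneg _ _
  · rw [abs_le]; constructor <;> nlinarith [sq_nonneg (m:ℝ)]

lemma rwK_L1w (n : ℕ) : ∑' m : ℤ, ‖(m:ℝ)^2 * rwK n m‖ₑ ≤ ENNReal.ofReal 4 := by
  refine (tsum_enorm_le_rwE (n := n+1) (F := fun m => (0:ℝ) + ((n+1) / (((n:ℝ)+1) * (2*n+1)) * (m:ℝ)^2 + 2 / (((n:ℝ)+1) * (2*n+1)) * (m:ℝ)^4)) ?_).trans ?_
  · intro m
    rw [abs_mul, abs_of_nonneg (sq_nonneg _)]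
    refine (mul_le_mul_of_nonneg_left (rwK_abs n m) (sq_nonneg _)).trans (le_of_eq ?_)
    field_simp; ring
  · apply ENNReal.ofReal_le_ofReal
    rw [rwE_poly]
    push_cast
    rw [div_mul_eq_mul_div, div_mul_eq_mul_div, ← add_div, zero_add, div_le_iff₀ (by positivity)]
    nlinarith [(Nat.cast_nonneg n : (0:ℝ) ≤ n)]

lemma rwK_L1t (n : ℕ) : ∑' m : ℤ, ‖rwK n m - rwK (n+1) m‖ₑ ≤ ENNReal.ofReal (30 / ((n:ℝ)+1)^2) := by
  have hn : (0:ℝ) ≤ n := Nat.cast_nonneg n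
  have hp : (0:ℝ) < (n+1)*(2*n+1)*((n+2)*(2*n+3)) := by positivity
  refine (tsum_enorm_le_rwE (n := n+2) (F := fun m => (3*(n+1)*(n+2) / ((n+1)*(2*n+1)*((n+2)*(2*n+3))) : ℝ) + ((12*n+16) / ((n+1)*(2*n+1)*((n+2)*(2*n+3))) * (m:ℝ)^2 + 4 / ((n+1)*(2*n+1)*((n+2)*(2*n+3))) * (m:ℝ)^4)) ?_).trans ?_
  · intro m
    have h0 := rwK_id n m
    have h1 := rwK_id (n+1) m
    have h2 := rwW_id (n+1) m
    push_cast at h0 h1 h2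
    have e : (rwK n m - rwK (n+1) m) * ((n+1)*(2*n+1)*((n+2)*(2*n+3))) = rwW (n+2) m * (4*(m:ℝ)^4 - (12*n+16)*m^2 + 3*(n+1)*(n+2)) := by
      have e2 : n + 1 + 1 = n + 2 := rfl
      rw [e2] at h1 h2
      linear_combination (n+2) * (2*n+3) * h0 - (n+1) * (2*n+1) * h1 + (n+1-2*(m:ℝ)^2) * h2
    have : rwK n m - rwK (n+1) m = rwW (n+2) m * (4*(m:ℝ)^4 - (12*n+16)*m^2 + 3*(n+1)*(n+2)) / ((n+1)*(2*n+1)*((n+2)*(2*n+3))) := by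
      rw [_root_.eq_div_iff hp.ne', e]
    rw [this, abs_div, abs_of_pos hp, abs_mul, abs_of_nonneg (rwW_nonneg _ _), div_mul_eq_mul_div, div_mul_eq_mul_div, ← add_div, ← add_div, div_mul_eq_mul_div, mul_comm]
    gcongr
    · exact rwW_nonneg _ _
    · rw [abs_le]
      constructor <;> nlinarith [sq_nonneg (m:ℝ), sq_nonneg ((m:ℝ)^2), mul_nonneg hn (sq_nonneg (m:ℝ))]
  · apply ENNReal.ofReal_le_ofReal
    rw [rwE_poly]
    push_cast
    rw [div_mul_eq_mul_div, div_mul_eq_mul_div, ← add_div, ← add_div, div_le_div_iff₀ hp (by positivity)]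
    nlinarith [pow_nonneg hn 2, pow_nonneg hn 3, pow_nonneg hn 4]

lemma rwW_diff (n : ℕ) (m : ℤ) :
    (2*(n:ℝ)+1) * (rwW n m - rwW n (m+1)) = (2*m+1) * (rwW n m + rwW n (m+1)) := by
  linear_combination (-2) * rwW_rec n m

lemma rwK_gradpt (n : ℕ) (m M : ℤ) (hM : M = m ∨ M = m + 1) (s : ℝ) (hs : 0 < s) (hs2 : s^2 = n+1) :
   (((n:ℝ)+1+2*m^2) * |2*(m:ℝ)+1| / (2*n+3) + 2*|2*(m:ℝ)+1|) ≤ ((M:ℝ)^2+2*(n+1)) * (9*(n+1)+4*M^2) / (2*(n+1)*s) := by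
  have hn : (0:ℝ) ≤ n := Nat.cast_nonneg n
  have hs1 : 1 ≤ s := by nlinarith
  have h1 : |2*(m:ℝ)+1| ≤ ((M:ℝ)^2+2*(n+1))/s := by
    rw [le_div_iff₀ hs, ← hs2]
    have : |2*(m:ℝ)+1| ≤ 2*|(M:ℝ)| + 1 := by
      rcases hM with h | h
      · subst h; refine (abs_add_le _ _).trans ?_; rw [abs_mul]; norm_num
      · have : (m:ℝ) = M - 1 := by rw [h]; push_cast; ring
        rw [this]
        have : 2*((M:ℝ)-1)+1 = 2*M + (-1) := by ring
        rw [this]; refine (abs_add_le _ _).trans ?_; rw [abs_mul]; norm_num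
    rw [← sq_abs (M:ℝ)]
    nlinarith [sq_nonneg (|(M:ℝ)| - s), abs_nonneg (M:ℝ), mul_le_mul_of_nonneg_right this hs.le]
  have h2 : (m:ℝ)^2 ≤ 2*M^2+2 := by
    rcases hM with h | h
    · subst h; nlinarith [sq_nonneg (M:ℝ)]
    · have : (m:ℝ) = M - 1 := by rw [h]; push_cast; ring
      rw [this]; nlinarith [sq_nonneg ((M:ℝ)+1)]
  have h3 : ((n:ℝ)+1+2*m^2) / (2*n+3) + 2 ≤ (9*(n+1)+4*M^2) / (2*(n+1)) := by
    have : ((n:ℝ)+1+2*m^2) / (2*n+3) ≤ (n+1+2*(2*M^2+2)) / (2*(n+1)) := by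
      gcongr; linarith
    refine (add_le_add_left this 2).trans ?_
    rw [div_add' _ _ _ (by positivity)]
    exact div_le_div_of_nonneg_right (by nlinarith) (by positivity)
  calc _ = (((n:ℝ)+1+2*m^2) / (2*n+3) + 2) * |2*(m:ℝ)+1| := by ring
    _ ≤ ((9*(n+1)+4*M^2) / (2*(n+1))) * (((M:ℝ)^2+2*(n+1))/s) := by gcongr
    _ = _ := by field_simp

lemma rwK_L1x (n : ℕ) : ∑' m : ℤ, ‖rwK n m - rwK n (m+1)‖ₑ ≤ ENNReal.ofReal (60 / (((n:ℝ)+1) * Real.sqrt (n+1))) := by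
  have hn : (0:ℝ) ≤ n := Nat.cast_nonneg n
  obtain ⟨s, hs, hs2, hse⟩ : ∃ s : ℝ, 0 < s ∧ s^2 = n+1 ∧ s = Real.sqrt (n+1) :=
    ⟨_, Real.sqrt_pos.mpr (by positivity), Real.sq_sqrt (by positivity), rfl⟩
  rw [← hse]
  set c : ℝ := ((n:ℝ)+1) * (2*n+1) with hc
  have hcp : 0 < c := by positivity
  set G : ℤ → ℝ := fun M => ((M:ℝ)^2+2*(n+1)) * (9*(n+1)+4*M^2) / (2*(n+1)*s) / c with hG
  have key : ∀ m, |rwK n m - rwK n (m+1)| ≤ G m * rwW (n+1) m + G (m+1) * rwW (n+1) (m+1) := by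
    intro m
    have h0 := rwK_id n m
    have h1 := rwK_id n (m+1)
    have h2 := rwW_diff (n+1) m
    push_cast at h0 h1 h2
    have e : (rwK n m - rwK n (m+1)) * c = (n+1-2*m^2) * (rwW (n+1) m - rwW (n+1) (m+1)) + (4*m+2) * rwW (n+1) (m+1) := by
      linear_combination h0 - h1
    have e' : rwW (n+1) m - rwW (n+1) (m+1) = (2*m+1) * (rwW (n+1) m + rwW (n+1) (m+1)) / (2*n+3) := by
      rw [_root_.eq_div_iff (by positivity)]; linear_combination h2
    have : rwK n m - rwK n (m+1) = ((n+1-2*m^2) * ((2*m+1) * (rwW (n+1) m + rwW (n+1) (m+1)) / (2*n+3)) + (4*m+2) * rwW (n+1) (m+1)) / c := by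
      rw [_root_.eq_div_iff hcp.ne', e, e']
    have p0 := rwW_nonneg (n+1) m
    have p1 := rwW_nonneg (n+1) (m+1)
    rw [this, abs_div, abs_of_pos hcp]
    have g0 := rwK_gradpt n m m (Or.inl rfl) s hs hs2
    have g1 := rwK_gradpt n m (m+1) (Or.inr rfl) s hs hs2
    have : G m * rwW (n+1) m + G (m+1) * rwW (n+1) (m+1) = (((m:ℝ)^2+2*(n+1)) * (9*(n+1)+4*m^2) / (2*(n+1)*s) * rwW (n+1) m + ((((m+1:ℤ):ℝ))^2+2*(n+1)) * (9*(n+1)+4*(((m+1:ℤ):ℝ))^2) / (2*(n+1)*s) * rwW (n+1) (m+1))/c := by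
      simp only [hG]; ring
    rw [this]
    gcongr
    refine (abs_add_le _ _).trans ?_
    have a1 : |(n+1-2*(m:ℝ)^2) * ((2*m+1) * (rwW (n+1) m + rwW (n+1) (m+1)) / (2*n+3))| ≤ (((n:ℝ)+1+2*m^2) * |2*(m:ℝ)+1| / (2*n+3)) * (rwW (n+1) m + rwW (n+1) (m+1)) := by
      rw [abs_mul, abs_div, abs_mul, abs_of_nonneg (add_nonneg p0 p1), abs_of_pos (by positivity : (0:ℝ) < 2*n+3)]
      have : |(n:ℝ)+1-2*(m:ℝ)^2| ≤ (n:ℝ)+1+2*m^2 := by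
        rw [abs_le]; constructor <;> nlinarith [sq_nonneg (m:ℝ)]
      calc _ ≤ ((n:ℝ)+1+2*m^2) * (|2*(m:ℝ)+1| * (rwW (n+1) m + rwW (n+1) (m+1)) / (2*n+3)) := by gcongr
        _ = _ := by ring
    have a2 : |(4*(m:ℝ)+2) * rwW (n+1) (m+1)| ≤ 2*|2*(m:ℝ)+1| * (rwW (n+1) m + rwW (n+1) (m+1)) := by
      have : 4*(m:ℝ)+2 = 2 * (2*m+1) := by ring
      rw [this, abs_mul, abs_mul, abs_of_nonneg p1, abs_two]
      gcongr; linarith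
    nlinarith [mul_le_mul_of_nonneg_right g0 p0, mul_le_mul_of_nonneg_right g1 p1]
  have hG0 : ∀ m, 0 ≤ G m := fun m => by simp only [hG]; positivity
  have e1 : ∑' m : ℤ, ‖G m * rwW (n+1) m‖ₑ ≤ ENNReal.ofReal (30 / (((n:ℝ)+1) * s)) := by
    refine (tsum_enorm_le_rwE (n := n+1) (F := G) ?_).trans ?_
    · intro m; rw [abs_of_nonneg (mul_nonneg (hG0 m) (rwW_nonneg _ _))]
    · apply ENNReal.ofReal_le_ofReal
      have : G = fun m : ℤ => 18*((n:ℝ)+1)^2 / (2*(n+1)*s) / c + (17*(n+1) / (2*(n+1)*s) / c * (m:ℝ)^2 + 4 / (2*(n+1)*s) / c * (m:ℝ)^4) := by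
        ext m; simp only [hG]; ring
      rw [this, rwE_poly, hc]
      push_cast
      rw [div_div, div_div, div_div, div_mul_eq_mul_div, div_mul_eq_mul_div, ← add_div, ← add_div, div_le_div_iff₀ (by positivity) (by positivity)]
      have : 18*((n:ℝ)+1)^2 + (17*(n+1) * ((n+1)/2) + 4 * ((3*(n+1)^2 - (n+1))/4)) ≤ 30 * (2*(n+1)) * (2*n+1) := by nlinarith
      calc _ ≤ (30 * (2*((n:ℝ)+1)) * (2*n+1)) * ((n+1)*s) := by gcongr
        _ = _ := by ring
  have e2 : ∑' m : ℤ, ‖G (m+1) * rwW (n+1) (m+1)‖ₑ = ∑' m : ℤ, ‖G m * rwW (n+1) m‖ₑ :=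
    (Equiv.addRight (1:ℤ)).tsum_eq (fun m => ‖G m * rwW (n+1) m‖ₑ)
  calc _ ≤ ∑' m : ℤ, (‖G m * rwW (n+1) m‖ₑ + ‖G (m+1) * rwW (n+1) (m+1)‖ₑ) := by
        refine ENNReal.tsum_le_tsum fun m => ?_
        have q0 := mul_nonneg (hG0 m) (rwW_nonneg (n+1) m)
        have q1 := mul_nonneg (hG0 (m+1)) (rwW_nonneg (n+1) (m+1))
        rw [Real.enorm_eq_ofReal_abs, Real.enorm_of_nonneg q0, Real.enorm_of_nonneg q1, ← ENNReal.ofReal_add q0 q1]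
        exact ENNReal.ofReal_le_ofReal (key m)
    _ = _ := ENNReal.tsum_add
    _ ≤ ENNReal.ofReal (30 / (((n:ℝ)+1) * s)) + ENNReal.ofReal (30 / (((n:ℝ)+1) * s)) := by rw [e2]; gcongr
    _ = _ := by rw [← ENNReal.ofReal_add (by positivity) (by positivity)]; congr 1; ring

/-! Part 2 -/

/-- space-time kernel on `ℤ × ℤ` -/
def kk (t m : ℤ) : ℝ := if 0 < t then rwK (t-1).toNat m else 0

lemma kk_nonpos {t : ℤ} (h : t ≤ 0) (m : ℤ) : kk t m = 0 := if_neg (not_lt.mpr h)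

lemma kk_w (t : ℤ) : ∑' m : ℤ, ‖(m:ℝ)^2 * kk t m‖ₑ ≤ ENNReal.ofReal 4 := by
  by_cases h : 0 < t
  · simp only [kk, if_pos h]; exact rwK_L1w _
  · simp [kk, if_neg h]

lemma tsum_enorm_tri {a b c : ℤ → ℝ} :
    ∑' m, ‖a m - c m‖ₑ ≤ ∑' m, ‖a m - b m‖ₑ + ∑' m, ‖b m - c m‖ₑ := by
  rw [← ENNReal.tsum_add]
  refine ENNReal.tsum_le_tsum fun m => ?_
  have : a m - c m = (a m - b m) + (b m - c m) := by ring
  rw [this]; exact enorm_add_le _ _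

lemma tsum_enorm_comm {a b : ℤ → ℝ} :
    ∑' m, ‖a m - b m‖ₑ = ∑' m, ‖b m - a m‖ₑ := by
  congr 1; ext m; rw [← enorm_neg, neg_sub]

lemma rwK_t (n j : ℕ) : ∑' m : ℤ, ‖rwK n m - rwK (n+j) m‖ₑ ≤ ENNReal.ofReal (j * (30 / ((n:ℝ)+1)^2)) := by
  induction j with
  | zero => simp
  | succ j ih =>
    refine (tsum_enorm_tri (b := fun m => rwK (n+j) m)).trans ?_
    refine (add_le_add ih (rwK_L1t (n+j))).trans ?_
    rw [← ENNReal.ofReal_add (by positivity) (by positivity)]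
    apply ENNReal.ofReal_le_ofReal
    have : 30 / (((n+j:ℕ):ℝ)+1)^2 ≤ 30 / ((n:ℝ)+1)^2 := by
      gcongr; linarith
    push_cast at *
    linarith

lemma rwK_x (n j : ℕ) : ∑' m : ℤ, ‖rwK n m - rwK n (m+j)‖ₑ ≤
    ENNReal.ofReal (j * (60 / (((n:ℝ)+1) * Real.sqrt (n+1)))) := by
  induction j with
  | zero => simp
  | succ j ih =>
    refine (tsum_enorm_tri (b := fun m => rwK n (m+j))).trans ?_
    have h : ∑' m : ℤ, ‖rwK n (m+j) - rwK n (m+(j+1:ℕ))‖ₑ ≤ ENNReal.ofReal (60 / (((n:ℝ)+1) * Real.sqrt (n+1))) := by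
      have := (Equiv.addRight (j:ℤ)).tsum_eq (fun m => ‖rwK n m - rwK n (m+1)‖ₑ)
      simp only [Equiv.coe_addRight] at this
      push_cast
      simp only [← add_assoc]
      rw [this]; exact rwK_L1x n
    refine (add_le_add ih h).trans ?_
    rw [← ENNReal.ofReal_add (by positivity) (by positivity)]
    apply ENNReal.ofReal_le_ofReal
    push_cast
    linarith

/-- far-time estimate -/
lemma kk_far (L r t1 t2 m1 m2 : ℤ) (hL : 1 ≤ L) (hr : L^2 ≤ r) (h1 : r ≤ t1) (h2 : r ≤ t2)
    (h12 : |t1 - t2| ≤ L^2) (hm : |m1 - m2| ≤ L) :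
    ∑' m : ℤ, ‖kk t1 (m - m1) - kk t2 (m - m2)‖ₑ ≤
      ENNReal.ofReal (90 * L * (1 / (r * Real.sqrt r))) := by
  wlog hle : t1 ≤ t2 generalizing t1 t2 m1 m2
  · rw [tsum_enorm_comm]
    exact this t2 t1 m2 m1 h2 h1 (by rw [abs_sub_comm]; exact h12) (by rw [abs_sub_comm]; exact hm) (by lia)
  have hr1 : 1 ≤ r := by nlinarith
  obtain ⟨n, rfl⟩ : ∃ n : ℕ, t1 = n + 1 := ⟨(t1-1).toNat, by lia⟩
  obtain ⟨j, rfl⟩ : ∃ j : ℕ, t2 = n + j + 1 := ⟨(t2-n-1).toNat, by lia⟩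
  have k1 : ∀ m, kk (n+1) m = rwK n m := by intro m; rw [kk, if_pos (by lia)]; congr; lia
  have k2 : ∀ m, kk (n+j+1) m = rwK (n+j) m := by intro m; rw [kk, if_pos (by lia)]; congr; lia
  simp only [k1, k2]
  refine (tsum_enorm_tri (b := fun m => rwK n (m-m2))).trans ?_
  have hrr : (1:ℝ) ≤ r := by exact_mod_cast hr1
  have hLL : (1:ℝ) ≤ L := by exact_mod_cast hL
  have hrn : (r:ℝ) ≤ n + 1 := by exact_mod_cast h1
  have hLr : (L:ℝ) ≤ Real.sqrt r := Real.le_sqrt_of_sq_le (by exact_mod_cast hr)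
  have hs : Real.sqrt r * Real.sqrt r = r := Real.mul_self_sqrt (by linarith)
  have hs0 : 0 < Real.sqrt r := by linarith
  have B : ∑' m : ℤ, ‖rwK n (m-m2) - rwK (n+j) (m-m2)‖ₑ ≤ ENNReal.ofReal (30 * L * (1 / (r * Real.sqrt r))) := by
    have := (Equiv.subRight m2).tsum_eq (fun m => ‖rwK n m - rwK (n+j) m‖ₑ)
    simp only [Equiv.subRight_apply] at this
    rw [this]
    refine (rwK_t n j).trans (ENNReal.ofReal_le_ofReal ?_)
    have hj : (j:ℝ) ≤ L^2 := by
      have : (n+1 : ℤ) - (n + j + 1) = -(j:ℤ) := by ring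
      rw [this, abs_neg, abs_of_nonneg (by positivity)] at h12
      exact_mod_cast h12
    calc _ ≤ (L:ℝ)^2 * (30 / (r:ℝ)^2) := by gcongr
      _ = 30 * L * (L / (r * r)) := by field_simp
      _ ≤ 30 * L * (Real.sqrt r / (r * r)) := by gcongr
      _ = 30 * L * (1 / (r * Real.sqrt r)) := by
        congr 1
        rw [div_eq_div_iff (by positivity) (by positivity)]
        calc _ = r * (Real.sqrt r * Real.sqrt r) := by ring
          _ = _ := by rw [hs]; ring
  have A : ∑' m : ℤ, ‖rwK n (m-m1) - rwK n (m-m2)‖ₑ ≤ ENNReal.ofReal (60 * L * (1 / (r * Real.sqrt r))) := by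
    have key : ∀ m1 m2 : ℤ, m2 ≤ m1 → |m1 - m2| ≤ L → ∑' m : ℤ, ‖rwK n (m-m1) - rwK n (m-m2)‖ₑ ≤ ENNReal.ofReal (60 * L * (1 / (r * Real.sqrt r))) := by
      intro m1 m2 h hm
      obtain ⟨i, rfl⟩ : ∃ i : ℕ, m1 = m2 + i := ⟨(m1-m2).toNat, by lia⟩
      have := (Equiv.subRight (m2+i:ℤ)).tsum_eq (fun m => ‖rwK n m - rwK n (m+i)‖ₑ)
      simp only [Equiv.subRight_apply] at this
      have e : ∀ m : ℤ, m - (m2 + i) + i = m - m2 := by intro m; ring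
      simp only [e] at this
      rw [this]
      refine (rwK_x n i).trans (ENNReal.ofReal_le_ofReal ?_)
      have hj : (i:ℝ) ≤ L := by
        have : m2 + i - m2 = (i:ℤ) := by ring
        rw [this, abs_of_nonneg (by positivity)] at hm
        exact_mod_cast hm
      calc _ ≤ (L:ℝ) * (60 / (r * Real.sqrt r)) := by gcongr
        _ = _ := by ring
    rcases le_total m2 m1 with h | h
    · exact key m1 m2 h hm
    · rw [tsum_enorm_comm]; exact key m2 m1 h (by rw [abs_sub_comm]; exact hm)
  refine (add_le_add A B).trans ?_
  rw [← ENNReal.ofReal_add (by positivity) (by positivity)]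
  apply ENNReal.ofReal_le_ofReal
  apply le_of_eq; ring

/-- near-time estimate -/
lemma kk_near (L t m1 : ℤ) (hL : 1 ≤ L) (S : Set ℤ) (hS : ∀ m ∈ S, L ≤ |m - m1|) :
    ∑' m : ℤ, S.indicator (fun m => ‖kk t (m - m1)‖ₑ) m ≤ ENNReal.ofReal (4 / (L:ℝ)^2) := by
  have hLL : (1:ℝ) ≤ L := by exact_mod_cast hL
  have h := kk_w t
  have := (Equiv.subRight m1).tsum_eq (fun m : ℤ => ‖(m:ℝ)^2 * kk t m‖ₑ)
  simp only [Equiv.subRight_apply] at this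
  rw [← this] at h
  have e : ENNReal.ofReal (4 / (L:ℝ)^2) = ENNReal.ofReal (1 / (L:ℝ)^2) * ENNReal.ofReal 4 := by
    rw [← ENNReal.ofReal_mul (by positivity)]; congr 1; ring
  rw [e]
  refine le_trans ?_ (mul_le_mul_right h _)
  rw [← ENNReal.tsum_mul_left]
  refine ENNReal.tsum_le_tsum fun m => ?_
  by_cases hm : m ∈ S
  · rw [indicator_of_mem hm, Real.enorm_eq_ofReal_abs, Real.enorm_eq_ofReal_abs, ← ENNReal.ofReal_mul (by positivity)]
    apply ENNReal.ofReal_le_ofReal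
    rw [abs_mul ((((m-m1:ℤ)):ℝ)^2), abs_of_nonneg (sq_nonneg (((m-m1:ℤ)):ℝ))]
    have h1 : (L:ℝ) ≤ |((m-m1:ℤ):ℝ)| := by rw [← Int.cast_abs]; exact_mod_cast hS m hm
    have h2 : (L:ℝ)^2 ≤ ((m-m1:ℤ):ℝ)^2 := by rw [← sq_abs ((m-m1:ℤ):ℝ)]; gcongr
    calc |kk t (m-m1)| = 1 / (L:ℝ)^2 * (L^2 * |kk t (m-m1)|) := by field_simp
      _ ≤ _ := by gcongr
  · rw [indicator_of_notMem hm]; exact zero_le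

lemma tail_sum (M : ℝ) (hM : 1 ≤ M) :
    ∑' j : ℕ, ENNReal.ofReal (1 / ((M+1+j) * Real.sqrt (M+1+j))) ≤ ENNReal.ofReal (2 / Real.sqrt M) := by
  apply ENNReal.tsum_le_of_sum_range_le
  intro n
  rw [← ENNReal.ofReal_sum_of_nonneg (fun j _ => by positivity)]
  apply ENNReal.ofReal_le_ofReal
  have : ∑ j ∈ Finset.range n, 1 / ((M+1+j) * Real.sqrt (M+1+j)) ≤ 2 / Real.sqrt M - 2 / Real.sqrt (M+n) := by
    induction n with
    | zero => simp
    | succ n ih =>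
      rw [Finset.sum_range_succ]
      have : 1 / ((M+1+n) * Real.sqrt (M+1+n)) ≤ 2 / Real.sqrt (M+n) - 2 / Real.sqrt (M+(n+1:ℕ)) := by
        have hp : (0:ℝ) < M + n := by positivity
        have e : M+1+n = M+(n+1:ℕ) := by push_cast; ring
        rw [e]
        set x := Real.sqrt (M+n)
        set y := Real.sqrt (M+(n+1:ℕ))
        have hx : 0 < x := Real.sqrt_pos.mpr hp
        have hx2 : x^2 = M+n := Real.sq_sqrt hp.le
        have hy2 : y^2 = M+(n+1:ℕ) := Real.sq_sqrt (by positivity)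
        have hy : 0 < y := Real.sqrt_pos.mpr (by positivity)
        have hxy : x ≤ y := Real.sqrt_le_sqrt (by push_cast; linarith)
        have h1 : (y - x) * (y + x) = 1 := by push_cast at hy2; nlinarith
        rw [← hy2, div_sub_div _ _ hx.ne' hy.ne', div_le_div_iff₀ (by positivity) (by positivity)]
        have : x ≤ 2 * (y - x) * y ^ 2 := by
          have hd : 1 ≤ 2 * (y - x) * y := by nlinarith
          nlinarith
        nlinarith
      linarith
  have : 0 ≤ 2 / Real.sqrt (M+n) := by positivity
  linarith

/-- Hörmander condition -/
lemma kk_hormander (L a b n1 m1 n2 m2 : ℤ) (hL : 1 ≤ L)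
    (hn1 : a * L^2 ≤ n1 ∧ n1 < (a+1) * L^2) (hm1 : b * L ≤ m1 ∧ m1 < (b+1) * L)
    (hn2 : a * L^2 ≤ n2 ∧ n2 < (a+1) * L^2) (hm2 : b * L ≤ m2 ∧ m2 < (b+1) * L) :
    ∑' z : ℤ × ℤ, ({z : ℤ × ℤ | a * L^2 ≤ z.1 ∧ z.1 < (a+3) * L^2 ∧ (b-1) * L ≤ z.2 ∧ z.2 < (b+2) * L}ᶜ).indicator
      (fun z => ‖kk (z.1 - n1) (z.2 - m1) - kk (z.1 - n2) (z.2 - m2)‖ₑ) z ≤ ENNReal.ofReal 224 := by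
  have hLL : (1:ℝ) ≤ L := by exact_mod_cast hL
  have hL2 : 1 ≤ L^2 := by nlinarith
  rw [ENNReal.tsum_prod']
  set A : ℤ → ℝ≥0∞ := (Finset.Ico (a*L^2) ((a+3)*L^2) : Set ℤ).indicator (fun _ => ENNReal.ofReal (8 / (L:ℝ)^2)) with hA
  set B : ℤ → ℝ≥0∞ := fun n => if (a+3)*L^2 ≤ n then ENNReal.ofReal (90 * L * (1 / (((n - (a+1)*L^2 + 1 : ℤ):ℝ) * Real.sqrt ((n - (a+1)*L^2 + 1 : ℤ):ℝ)))) else 0 with hB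
  have key : ∀ n : ℤ, ∑' m : ℤ, ({z : ℤ × ℤ | a * L^2 ≤ z.1 ∧ z.1 < (a+3) * L^2 ∧ (b-1) * L ≤ z.2 ∧ z.2 < (b+2) * L}ᶜ).indicator
      (fun z => ‖kk (z.1 - n1) (z.2 - m1) - kk (z.1 - n2) (z.2 - m2)‖ₑ) (n, m) ≤ A n + B n := by
    intro n
    by_cases h1 : n < a * L^2
    · have : ∀ m : ℤ, ({z : ℤ × ℤ | a * L^2 ≤ z.1 ∧ z.1 < (a+3) * L^2 ∧ (b-1) * L ≤ z.2 ∧ z.2 < (b+2) * L}ᶜ).indicator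
        (fun z => ‖kk (z.1 - n1) (z.2 - m1) - kk (z.1 - n2) (z.2 - m2)‖ₑ) (n, m) = 0 := by
        intro m
        apply indicator_apply_eq_zero.mpr
        intro _
        simp only
        rw [kk_nonpos (by lia), kk_nonpos (by lia)]; simp
      simp only [this, tsum_zero]; exact zero_le
    · by_cases h2 : n < (a+3)*L^2
      · have e1 : A n = ENNReal.ofReal (8 / (L:ℝ)^2) := by
          rw [hA, indicator_of_mem]; simp; lia
        refine le_trans ?_ le_self_add
        rw [e1]
        set S : Set ℤ := {m | ¬ ((b-1) * L ≤ m ∧ m < (b+2) * L)} with hS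
        have s1 : ∀ m0 : ℤ, b * L ≤ m0 ∧ m0 < (b+1) * L → ∀ m ∈ S, L ≤ |m - m0| := by
          intro m0 hm0 m hm
          rw [le_abs]
          simp only [hS, mem_ofPred_eq, not_and_or, not_le, not_lt] at hm
          rcases hm with hm | hm
          · right; nlinarith
          · left; nlinarith
        calc _ ≤ ∑' m : ℤ, (S.indicator (fun m => ‖kk (n-n1) (m - m1)‖ₑ) m + S.indicator (fun m => ‖kk (n-n2) (m - m2)‖ₑ) m) := by
              refine ENNReal.tsum_le_tsum fun m => ?_
              by_cases hm : m ∈ S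
              · rw [indicator_of_mem hm, indicator_of_mem hm]
                refine (indicator_le_self _ _ _).trans ?_
                simp only
                exact enorm_sub_le
              · rw [indicator_of_notMem]
                · exact zero_le
                · simp only [mem_compl_iff, mem_ofPred_eq, not_not]
                  simp only [hS, mem_ofPred_eq, not_not] at hm
                  exact ⟨by lia, h2, hm⟩
          _ ≤ ENNReal.ofReal (4 / (L:ℝ)^2) + ENNReal.ofReal (4 / (L:ℝ)^2) := by
              rw [ENNReal.tsum_add]
              exact add_le_add (kk_near L _ _ hL S (s1 m1 hm1)) (kk_near L _ _ hL S (s1 m2 hm2))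
          _ = _ := by rw [← ENNReal.ofReal_add (by positivity) (by positivity)]; congr 1; ring
      · refine le_trans ?_ le_add_self
        simp only [hB, if_pos (not_lt.mp h2)]
        refine le_trans (ENNReal.tsum_le_tsum fun m => indicator_le_self _ _ _) ?_
        simp only
        refine kk_far L _ (n-n1) (n-n2) m1 m2 hL ?_ ?_ ?_ ?_ ?_
        · nlinarith
        · nlinarith
        · nlinarith
        · rw [abs_le]; constructor <;> nlinarith
        · rw [abs_le]; constructor <;> nlinarith
  refine (ENNReal.tsum_le_tsum key).trans ?_
  rw [ENNReal.tsum_add]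
  have sA : ∑' n, A n ≤ ENNReal.ofReal 24 := by
    rw [hA, ← tsum_subtype, Finset.tsum_subtype' (Finset.Ico (a*L^2) ((a+3)*L^2)) (fun _ => ENNReal.ofReal (8 / (L:ℝ)^2)), Finset.sum_const, Int.card_Ico]
    have : ((a+3)*L^2 - a*L^2).toNat = 3 * (L^2).toNat := by
      rw [show (a+3)*L^2 - a*L^2 = 3 * L^2 by ring]; lia
    rw [this, ← ENNReal.ofReal_nsmul]
    apply ENNReal.ofReal_le_ofReal
    have : ((L^2).toNat : ℝ) = L^2 := by
      have : (((L^2).toNat : ℤ) : ℝ) = ((L^2 : ℤ) : ℝ) := by rw [Int.toNat_of_nonneg (by positivity)]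
      push_cast at this; exact_mod_cast this
    rw [nsmul_eq_mul]; push_cast; rw [this]
    apply le_of_eq; field_simp; norm_num
  have sB : ∑' n, B n ≤ ENNReal.ofReal 200 := by
    have : ∑' n, B n = ∑' j : ℕ, ENNReal.ofReal (90 * L * (1 / ((2*(L:ℝ)^2+1+j) * Real.sqrt (2*(L:ℝ)^2+1+j)))) := by
      let ι : ℕ → ℤ := fun j => (a+3)*L^2 + j
      have hι : Function.Injective ι := fun i j h => by simp only [ι] at h; lia
      rw [← hι.tsum_eq]
      · congr 1; ext j
        simp only [hB, ι]
        rw [if_pos (by lia)]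
        have : ((((a+3)*L^2 + j - (a+1)*L^2 + 1 : ℤ)):ℝ) = 2*(L:ℝ)^2+1+j := by push_cast; ring
        rw [this]
      · intro n hn
        simp only [hB, Function.mem_support, ne_eq, ite_eq_right_iff, Classical.not_imp] at hn
        exact ⟨(n - (a+3)*L^2).toNat, by simp only [ι]; lia⟩
    rw [this]
    simp only [ENNReal.ofReal_mul (by positivity : (0:ℝ) ≤ 90 * L)]
    rw [ENNReal.tsum_mul_left]
    refine (mul_le_mul_right (tail_sum (2*(L:ℝ)^2) (by nlinarith)) _).trans ?_
    rw [← ENNReal.ofReal_mul (by positivity)]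
    apply ENNReal.ofReal_le_ofReal
    have : L ≤ Real.sqrt (2*(L:ℝ)^2) := Real.le_sqrt_of_sq_le (by nlinarith)
    calc _ ≤ 90 * (L:ℝ) * (2 / L) := by gcongr
      _ = 180 := by field_simp; norm_num
      _ ≤ _ := by norm_num
  refine (add_le_add sA sB).trans ?_
  rw [← ENNReal.ofReal_add (by positivity) (by positivity)]
  norm_num

/-! Part 3 -/

/-- discrete singular integral operator -/
def TT : ((ℤ × ℤ) →₀ ℝ) →ₗ[ℝ] ((ℤ × ℤ) → ℝ) :=
  Finsupp.linearCombination ℝ (fun w z => kk (z.1 - w.1) (z.2 - w.2))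

def l1 (g : (ℤ × ℤ) →₀ ℝ) : ℝ≥0∞ := ∑' z, ‖g z‖ₑ

def czIx (k : ℕ) (z : ℤ × ℤ) : ℤ × ℤ := (z.1 / (2^k)^2, z.2 / 2^k)

def czQ (k : ℕ) (c : ℤ × ℤ) : Finset (ℤ × ℤ) :=
  Finset.Ico (c.1 * (2^k)^2) ((c.1+1) * (2^k)^2) ×ˢ Finset.Ico (c.2 * 2^k) ((c.2+1) * 2^k)

def czQs (k : ℕ) (c : ℤ × ℤ) : Finset (ℤ × ℤ) :=
  Finset.Ico (c.1 * (2^k)^2) ((c.1+3) * (2^k)^2) ×ˢ Finset.Ico ((c.2-1) * 2^k) ((c.2+2) * 2^k)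

lemma ediv_eq_iff' {a b c : ℤ} (hb : 0 < b) : a / b = c ↔ c * b ≤ a ∧ a < (c+1) * b := by
  rw [← Int.le_ediv_iff_mul_le hb, ← Int.ediv_lt_iff_lt_mul hb]; lia

lemma mem_czQ {k : ℕ} {c z : ℤ × ℤ} : z ∈ czQ k c ↔ czIx k z = c := by
  simp only [czQ, czIx, Finset.mem_product, Finset.mem_Ico, Prod.ext_iff]
  rw [ediv_eq_iff' (by positivity), ediv_eq_iff' (by positivity)]

lemma card_czQ (k : ℕ) (c : ℤ × ℤ) : (czQ k c).card = 8^k := by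
  rw [czQ, Finset.card_product, Int.card_Ico, Int.card_Ico]
  have h1 : (c.1+1) * (2^k:ℤ)^2 - c.1 * (2^k)^2 = ((2^k)^2 : ℕ) := by push_cast; ring
  have h2 : (c.2+1) * (2^k:ℤ) - c.2 * (2^k) = ((2^k) : ℕ) := by push_cast; ring
  rw [h1, h2, Int.toNat_natCast, Int.toNat_natCast, ← pow_mul, mul_comm k 2, pow_mul, ← mul_pow]; norm_num

lemma card_czQs (k : ℕ) (c : ℤ × ℤ) : (czQs k c).card = 9 * 8^k := by
  rw [czQs, Finset.card_product, Int.card_Ico, Int.card_Ico]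
  have h1 : (c.1+3) * (2^k:ℤ)^2 - c.1 * (2^k)^2 = (3*(2^k)^2 : ℕ) := by push_cast; ring
  have h2 : (c.2+2) * (2^k:ℤ) - (c.2-1) * (2^k) = (3*(2^k) : ℕ) := by push_cast; ring
  rw [h1, h2, Int.toNat_natCast, Int.toNat_natCast, ← pow_mul, mul_comm k 2, pow_mul, mul_mul_mul_comm, ← mul_pow]; norm_num

lemma czIx_succ {k : ℕ} {z z' : ℤ × ℤ} (h : czIx k z = czIx k z') : czIx (k+1) z = czIx (k+1) z' := by
  simp only [czIx, Prod.mk.injEq] at *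
  have e1 : ((2:ℤ)^(k+1))^2 = (2^k)^2 * 4 := by ring
  have e2 : ((2:ℤ)^(k+1)) = (2^k) * 2 := by ring
  rw [e1, e2, ← Int.ediv_ediv_of_nonneg (by positivity), ← Int.ediv_ediv_of_nonneg (by positivity),
    ← Int.ediv_ediv_of_nonneg (by positivity), ← Int.ediv_ediv_of_nonneg (by positivity), h.1, h.2]
  exact ⟨rfl, rfl⟩

/-- average over a cube -/
def czAv (k : ℕ) (g : (ℤ × ℤ) →₀ ℝ) (c : ℤ × ℤ) : ℝ := (∑ z ∈ czQ k c, g z) / 8^k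

def czM (k : ℕ) (g : (ℤ × ℤ) →₀ ℝ) (c : ℤ × ℤ) : ℝ≥0∞ := ∑ z ∈ czQ k c, ‖g z‖ₑ

def czB (k : ℕ) (g : (ℤ × ℤ) →₀ ℝ) (c : ℤ × ℤ) : (ℤ × ℤ) →₀ ℝ :=
  ∑ z ∈ czQ k c, Finsupp.single z (g z - czAv k g c)

lemma czAv_le (k : ℕ) (g : (ℤ × ℤ) →₀ ℝ) (c : ℤ × ℤ) : 8^k * ‖czAv k g c‖ₑ ≤ czM k g c := by
  have : (8:ℝ≥0∞)^k = ‖(8:ℝ)^k‖ₑ := by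
    rw [enorm_pow]; congr 1; rw [Real.enorm_of_nonneg (by norm_num)]; norm_num
  rw [this, ← enorm_mul, czAv, mul_div_cancel₀ _ (by positivity)]
  exact enorm_sum_le _ _

lemma czB_apply (k : ℕ) (g : (ℤ × ℤ) →₀ ℝ) (c z : ℤ × ℤ) :
    czB k g c z = if czIx k z = c then g z - czAv k g c else 0 := by
  classical
  rw [czB, Finsupp.finsetSum_apply]
  simp only [Finsupp.single_apply]
  rw [Finset.sum_ite_eq']
  simp only [mem_czQ]

lemma TT_czB (k : ℕ) (g : (ℤ × ℤ) →₀ ℝ) (c z : ℤ × ℤ) :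
    TT (czB k g c) z = ∑ w ∈ czQ k c, (g w - czAv k g c) * kk (z.1 - w.1) (z.2 - w.2) := by
  rw [czB, map_sum, Finset.sum_apply]
  simp [TT, sub_mul]

lemma TT_czB_bound (k : ℕ) (g : (ℤ × ℤ) →₀ ℝ) (c : ℤ × ℤ) :
    ∑' z, ((czQs k c : Set (ℤ × ℤ))ᶜ).indicator (fun z => ‖TT (czB k g c) z‖ₑ) z ≤ 448 * czM k g c := by
  set w0 : ℤ × ℤ := (c.1 * (2^k)^2, c.2 * 2^k)
  have hw0 : w0 ∈ czQ k c := by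
    rw [mem_czQ]; simp [w0, czIx]
  have hs : ∑ w ∈ czQ k c, (g w - czAv k g c) = 0 := by
    rw [Finset.sum_sub_distrib, Finset.sum_const, card_czQ, czAv, nsmul_eq_mul]
    push_cast; field_simp; ring
  have e : ∀ z, TT (czB k g c) z = ∑ w ∈ czQ k c, (g w - czAv k g c) * (kk (z.1 - w.1) (z.2 - w.2) - kk (z.1 - w0.1) (z.2 - w0.2)) := by
    intro z
    simp only [mul_sub]
    rw [TT_czB, Finset.sum_sub_distrib, ← Finset.sum_mul, hs]; simp
  have hset : (czQs k c : Set (ℤ × ℤ)) = {z : ℤ × ℤ | c.1 * (2^k)^2 ≤ z.1 ∧ z.1 < (c.1+3) * (2^k)^2 ∧ (c.2-1) * (2^k) ≤ z.2 ∧ z.2 < (c.2+2) * (2^k)} := by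
    ext z; simp [czQs]; tauto
  calc _ ≤ ∑' z, ∑ w ∈ czQ k c, ‖g w - czAv k g c‖ₑ * ((czQs k c : Set (ℤ × ℤ))ᶜ).indicator (fun z => ‖kk (z.1 - w.1) (z.2 - w.2) - kk (z.1 - w0.1) (z.2 - w0.2)‖ₑ) z := by
        refine ENNReal.tsum_le_tsum fun z => ?_
        by_cases hz : z ∈ ((czQs k c : Set (ℤ × ℤ))ᶜ)
        · simp only [indicator_of_mem hz]
          rw [e]
          refine (enorm_sum_le _ _).trans (le_of_eq ?_)
          simp only [enorm_mul]
        · rw [indicator_of_notMem hz]; exact zero_le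
    _ = ∑ w ∈ czQ k c, ‖g w - czAv k g c‖ₑ * ∑' z, ((czQs k c : Set (ℤ × ℤ))ᶜ).indicator (fun z => ‖kk (z.1 - w.1) (z.2 - w.2) - kk (z.1 - w0.1) (z.2 - w0.2)‖ₑ) z := by
        rw [Summable.tsum_finsetSum (fun _ _ => ENNReal.summable)]
        simp only [ENNReal.tsum_mul_left]
    _ ≤ ∑ w ∈ czQ k c, ‖g w - czAv k g c‖ₑ * 224 := by
        refine Finset.sum_le_sum fun w hw => ?_
        gcongr
        rw [hset]
        have h1 := hw
        simp only [czQ, Finset.mem_product, Finset.mem_Ico] at h1 hw0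
        refine (kk_hormander (2^k) c.1 c.2 w.1 w.2 w0.1 w0.2 (one_le_pow₀ (by norm_num)) h1.1 h1.2 hw0.1 hw0.2).trans ?_
        simp
    _ ≤ (∑ w ∈ czQ k c, (‖g w‖ₑ + ‖czAv k g c‖ₑ)) * 224 := by
        rw [Finset.sum_mul]; gcongr; exact enorm_sub_le
    _ ≤ (czM k g c + czM k g c) * 224 := by
        gcongr
        rw [Finset.sum_add_distrib, Finset.sum_const, card_czQ, nsmul_eq_mul]
        push_cast
        exact add_le_add le_rfl (czAv_le k g c)
    _ = _ := by rw [← two_mul, mul_right_comm]; norm_num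

open Classical in
lemma cz_decomp (l : ℝ≥0∞) (k : ℕ) : ∀ g : (ℤ × ℤ) →₀ ℝ, (∀ c, czM k g c ≤ l * 8^k) →
    ∃ gd : (ℤ × ℤ) →₀ ℝ, ∃ Ω : Finset (ℤ × ℤ), (∀ z, ‖gd z‖ₑ ≤ 8 * l) ∧ l1 gd ≤ l1 g ∧
      (∀ c, czM k g c = 0 → ∀ z, czIx k z = c → gd z = 0) ∧
      l * Ω.card ≤ 9 * l1 g ∧ ∑' z, ((Ω : Set (ℤ × ℤ))ᶜ).indicator (fun z => ‖TT (g - gd) z‖ₑ) z ≤ 448 * l1 g := by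
  induction k with
  | zero =>
    intro g hg
    have hm : ∀ z, ‖g z‖ₑ ≤ czM 0 g (czIx 0 z) := fun z =>
      Finset.single_le_sum (f := fun z => ‖g z‖ₑ) (fun _ _ => zero_le) (mem_czQ.mpr rfl)
    refine ⟨g, ∅, fun z => ?_, le_rfl, ?_, by simp, by simp⟩
    · refine ((hm z).trans (hg _)).trans ?_
      rw [pow_zero, mul_one]; exact le_mul_of_one_le_left zero_le (by norm_num)
    · intro c hc z hz
      have := hm z
      rw [hz, hc] at this
      simpa using this
  | succ k ih =>
    intro g hg
    set B : Finset (ℤ × ℤ) := (g.support.image (czIx k)).filter (fun c => l * 8^k < czM k g c) with hB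
    set g1 : (ℤ × ℤ) →₀ ℝ := g.filter (fun z => czIx k z ∉ B) with hg1
    have hmB : ∀ c, c ∈ B ↔ l * 8^k < czM k g c := by
      intro c
      rw [hB, Finset.mem_filter, and_iff_right_iff_imp]
      intro h
      have h0 : czM k g c ≠ 0 := ne_bot_of_gt h
      obtain ⟨z, hz, hz'⟩ := Finset.exists_ne_zero_of_sum_ne_zero h0
      rw [Finset.mem_image]
      exact ⟨z, by simpa using hz', mem_czQ.mp hz⟩
    have g1a : ∀ z, g1 z = if czIx k z ∈ B then 0 else g z := by
      intro z; rw [hg1, Finsupp.filter_apply]; split_ifs <;> simp_all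
    have m1 : ∀ c, czM k g1 c = if c ∈ B then 0 else czM k g c := by
      intro c
      split_ifs with h
      · apply Finset.sum_eq_zero
        intro z hz
        rw [g1a, mem_czQ.mp hz, if_pos h]; simp
      · apply Finset.sum_congr rfl
        intro z hz
        rw [g1a, mem_czQ.mp hz, if_neg h]
    obtain ⟨d1, Ω1, hd1, hd2, hd3, hd4, hd5⟩ := ih g1 (by
      intro c; rw [m1]; split_ifs with h
      · exact zero_le
      · rw [hmB] at h; exact not_lt.mp h)
    set gd : (ℤ × ℤ) →₀ ℝ := d1 + (g - g1) - ∑ c ∈ B, czB k g c with hgd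
    have sB : ∀ z, (∑ c ∈ B, czB k g c) z = if czIx k z ∈ B then g z - czAv k g (czIx k z) else 0 := by
      intro z
      rw [Finsupp.finsetSum_apply]
      simp only [czB_apply]
      rw [Finset.sum_ite_eq]
    have gda : ∀ z, gd z = if czIx k z ∈ B then czAv k g (czIx k z) else d1 z := by
      intro z
      rw [hgd, Finsupp.sub_apply, Finsupp.add_apply, Finsupp.sub_apply, sB, g1a]
      split_ifs with h
      · rw [hd3 (czIx k z) (by rw [m1, if_pos h]) z rfl]; ring
      · ring
    have hmono : ∀ z, czM k g (czIx k z) ≤ czM (k+1) g (czIx (k+1) z) := by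
      intro z
      apply Finset.sum_le_sum_of_subset
      intro w hw
      rw [mem_czQ] at hw ⊢
      exact czIx_succ hw
    have havz : ∀ z, ‖czAv k g (czIx k z)‖ₑ ≤ 8 * l := by
      intro z
      have h1 := (czAv_le k g (czIx k z)).trans ((hmono z).trans (hg _))
      rw [pow_succ, ← mul_assoc, mul_comm] at h1
      have h8 : (8:ℝ≥0∞)^k ≠ 0 := by simp
      have h8' : (8:ℝ≥0∞)^k ≠ ⊤ := by simp
      rw [mul_right_comm, mul_comm _ ((8:ℝ≥0∞)^k), mul_comm _ ((8:ℝ≥0∞)^k), ENNReal.mul_le_mul_iff_right h8 h8', mul_comm l] at h1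
      exact h1
    have hsumB : ∀ F : ℤ × ℤ → ℝ≥0∞, ∑' z, (if czIx k z ∈ B then F z else 0) = ∑ c ∈ B, ∑ z ∈ czQ k c, F z := by
      intro F
      have : ∀ z, (if czIx k z ∈ B then F z else 0) = ∑ c ∈ B, if z ∈ czQ k c then F z else 0 := by
        intro z; simp only [mem_czQ]; rw [Finset.sum_ite_eq]
      rw [tsum_congr this, Summable.tsum_finsetSum (fun _ _ => ENNReal.summable)]
      refine Finset.sum_congr rfl fun c _ => ?_
      rw [tsum_eq_sum (s := czQ k c) (fun z hz => if_neg hz)]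
      exact Finset.sum_congr rfl fun z hz => if_pos hz
    have hl1 : l1 g = l1 g1 + ∑ c ∈ B, czM k g c := by
      simp only [czM]
      rw [← hsumB, l1, l1, ← ENNReal.tsum_add]
      refine tsum_congr fun z => ?_
      rw [g1a]; split_ifs <;> simp
    refine ⟨gd, Ω1 ∪ B.biUnion (czQs k), ?_, ?_, ?_, ?_, ?_⟩
    · intro z
      rw [gda]; split_ifs
      · exact havz z
      · exact hd1 z
    · rw [hl1]
      have : l1 gd ≤ l1 d1 + ∑' z, (if czIx k z ∈ B then ‖czAv k g (czIx k z)‖ₑ else 0) := by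
        rw [l1, l1, ← ENNReal.tsum_add]
        refine ENNReal.tsum_le_tsum fun z => ?_
        rw [gda]; split_ifs <;> simp
      refine this.trans (add_le_add hd2 ?_)
      rw [hsumB]
      refine Finset.sum_le_sum fun c _ => ?_
      refine le_trans (le_of_eq ?_) (czAv_le k g c)
      have : ∀ z ∈ czQ k c, ‖czAv k g (czIx k z)‖ₑ = ‖czAv k g c‖ₑ := fun z hz => by rw [mem_czQ.mp hz]
      rw [Finset.sum_congr rfl this, Finset.sum_const, card_czQ, nsmul_eq_mul]; push_cast; rfl
    · intro c hc z hz
      have hz0 : czM k g (czIx k z) = 0 := by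
        have := hmono z; rw [hz, hc] at this; simpa using this
      have : czIx k z ∉ B := by rw [hmB, hz0]; simp
      rw [gda, if_neg this]
      exact hd3 _ (by rw [m1, if_neg this, hz0]) z rfl
    · rw [hl1]
      calc l * ((Ω1 ∪ B.biUnion (czQs k)).card : ℝ≥0∞) ≤ l * ((Ω1.card : ℝ≥0∞) + ∑ c ∈ B, ((9 * 8^k : ℕ) : ℝ≥0∞)) := by
            gcongr
            have h1 := Finset.card_union_le Ω1 (B.biUnion (czQs k))
            have h2 : (B.biUnion (czQs k)).card ≤ ∑ c ∈ B, (czQs k c).card := Finset.card_biUnion_le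
            simp only [card_czQs] at h2
            exact_mod_cast h1.trans (add_le_add le_rfl h2)
        _ = l * Ω1.card + ∑ c ∈ B, 9 * (l * 8^k) := by
            rw [mul_add, Finset.mul_sum]; congr 1
            refine Finset.sum_congr rfl fun c _ => ?_
            push_cast; ring
        _ ≤ 9 * l1 g1 + ∑ c ∈ B, 9 * czM k g c := by
            gcongr with c hc
            exact ((hmB c).mp hc).le
        _ = _ := by rw [mul_add, Finset.mul_sum]
    · rw [hl1]
      have e : g - gd = (g1 - d1) + ∑ c ∈ B, czB k g c := by rw [hgd]; abel
      calc _ ≤ ∑' z, (((Ω1 : Set (ℤ × ℤ))ᶜ).indicator (fun z => ‖TT (g1 - d1) z‖ₑ) z + ∑ c ∈ B, ((czQs k c : Set (ℤ × ℤ))ᶜ).indicator (fun z => ‖TT (czB k g c) z‖ₑ) z) := by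
            refine ENNReal.tsum_le_tsum fun z => ?_
            by_cases hz : z ∈ ((Ω1 ∪ B.biUnion (czQs k) : Finset (ℤ × ℤ)) : Set (ℤ × ℤ))ᶜ
            · rw [indicator_of_mem hz]
              simp only [mem_compl_iff, Finset.mem_coe, Finset.mem_union, Finset.mem_biUnion, not_or, not_exists, not_and] at hz
              rw [indicator_of_mem (by simpa using hz.1)]
              have : ∑ c ∈ B, ((czQs k c : Set (ℤ × ℤ))ᶜ).indicator (fun z => ‖TT (czB k g c) z‖ₑ) z = ∑ c ∈ B, ‖TT (czB k g c) z‖ₑ := by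
                refine Finset.sum_congr rfl fun c hc => ?_
                rw [indicator_of_mem (by simpa using hz.2 c hc)]
              rw [this, e, map_add, map_sum, Pi.add_apply, Finset.sum_apply]
              exact (enorm_add_le _ _).trans (add_le_add le_rfl (enorm_sum_le _ _))
            · rw [indicator_of_notMem hz]; exact zero_le
        _ ≤ 448 * l1 g1 + ∑ c ∈ B, 448 * czM k g c := by
            rw [ENNReal.tsum_add, Summable.tsum_finsetSum (fun _ _ => ENNReal.summable)]
            exact add_le_add hd5 (Finset.sum_le_sum fun c _ => TT_czB_bound k g c)
        _ = _ := by rw [mul_add, Finset.mul_sum]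

lemma l1_ne_top (g : (ℤ × ℤ) →₀ ℝ) : l1 g ≠ ⊤ := by
  rw [l1, tsum_eq_sum (s := g.support) (by intro z hz; simpa using hz)]
  exact ENNReal.sum_ne_top.mpr fun z _ => enorm_ne_top

lemma cz_top (l : ℝ≥0∞) (hl : l ≠ 0) (g : (ℤ × ℤ) →₀ ℝ) :
    ∃ gd : (ℤ × ℤ) →₀ ℝ, ∃ Ω : Finset (ℤ × ℤ), (∀ z, ‖gd z‖ₑ ≤ 8 * l) ∧ l1 gd ≤ l1 g ∧
      l * Ω.card ≤ 9 * l1 g ∧ ∑' z, ((Ω : Set (ℤ × ℤ))ᶜ).indicator (fun z => ‖TT (g - gd) z‖ₑ) z ≤ 448 * l1 g := by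
  obtain ⟨k, hk⟩ : ∃ k : ℕ, l1 g ≤ l * 8^k := by
    obtain ⟨n, hn⟩ := ENNReal.exists_nat_mul_gt hl (l1_ne_top g)
    refine ⟨n, hn.le.trans ?_⟩
    rw [mul_comm]; gcongr
    have : n ≤ 8^n := (Nat.lt_pow_self (by norm_num)).le
    exact_mod_cast this
  obtain ⟨gd, Ω, h1, h2, _, h4, h5⟩ := cz_decomp l k g (fun c => le_trans (ENNReal.sum_le_tsum _) hk)
  exact ⟨gd, Ω, h1, h2, h4, h5⟩

/-! Part 4 -/

def ww (t m : ℤ) : ℝ := if 0 < t then rwW (t-1).toNat m else 0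

lemma ww_nonpos {t : ℤ} (h : t ≤ 0) (m : ℤ) : ww t m = 0 := if_neg (not_lt.mpr h)

lemma ww_fin (t : ℤ) : (Function.support (ww t)).Finite := by
  by_cases h : 0 < t
  · have : ww t = rwW (t-1).toNat := by ext m; rw [ww, if_pos h]
    rw [this]; exact rwW_fin _
  · have : ww t = 0 := by ext m; rw [ww, if_neg h]; rfl
    rw [this]; simp

lemma ww_succ (t m : ℤ) : ww (t+1) m = (ww t (m-1) + 2 * ww t m + ww t (m+1)) / 4 +
    (if t = 0 then (if m = 0 then 1 else 0) else 0) := by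
  rcases lt_trichotomy t 0 with h | h | h
  · rw [if_neg h.ne, ww_nonpos (by lia), ww_nonpos h.le, ww_nonpos h.le, ww_nonpos h.le]; norm_num
  · subst h
    rw [ww_nonpos le_rfl, ww_nonpos le_rfl, ww_nonpos le_rfl, if_pos rfl]
    simp [ww, rwW]
  · obtain ⟨n, rfl⟩ : ∃ n : ℕ, t = n + 1 := ⟨(t-1).toNat, by lia⟩
    have e1 : ((n:ℤ)+1+1-1).toNat = n + 1 := by lia
    have e2 : ((n:ℤ)+1-1).toNat = n := by lia
    rw [if_neg (by lia)]
    simp only [ww]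
    rw [if_pos (by lia), if_pos (by lia), if_pos (by lia), if_pos (by lia), e1, e2, rwW_succ]; ring

lemma kk_ww (t m : ℤ) : kk t m = (2 * ww t m - ww t (m-1) - ww t (m+1)) / 4 := by
  by_cases h : 0 < t
  · simp only [kk, ww, if_pos h, rwK, rwW_succ]; ring
  · simp [kk, ww, if_neg h]

def VV : ((ℤ × ℤ) →₀ ℝ) →ₗ[ℝ] ((ℤ × ℤ) → ℝ) :=
  Finsupp.linearCombination ℝ (fun w z => ww (z.1 - w.1) (z.2 - w.2))

lemma VV_apply (g : (ℤ × ℤ) →₀ ℝ) (z : ℤ × ℤ) :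
    VV g z = ∑ w ∈ g.support, g w * ww (z.1 - w.1) (z.2 - w.2) := by
  rw [VV, Finsupp.linearCombination_apply, Finsupp.sum, Finset.sum_apply]; simp

lemma TT_apply (g : (ℤ × ℤ) →₀ ℝ) (z : ℤ × ℤ) :
    TT g z = ∑ w ∈ g.support, g w * kk (z.1 - w.1) (z.2 - w.2) := by
  rw [TT, Finsupp.linearCombination_apply, Finsupp.sum, Finset.sum_apply]; simp

lemma VV_succ (g : (ℤ × ℤ) →₀ ℝ) (n m : ℤ) :
    VV g (n+1, m) = (VV g (n, m-1) + 2 * VV g (n, m) + VV g (n, m+1)) / 4 + g (n, m) := by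
  have hg : g (n, m) = ∑ w ∈ g.support, g w * (if n - w.1 = 0 then (if m - w.2 = 0 then 1 else 0) else 0) := by
    rw [Finset.sum_eq_single (n, m)]
    · simp
    · intro w _ hw
      split_ifs with h1 h2
      · exact absurd (Prod.ext (by simp; lia) (by simp; lia)) hw
      · simp
      · simp
    · intro h; simp only [Finsupp.mem_support_iff, not_not] at h; simp [h]
  rw [hg]
  simp only [VV_apply]
  rw [Finset.mul_sum, ← Finset.sum_add_distrib, ← Finset.sum_add_distrib, Finset.sum_div, ← Finset.sum_add_distrib]
  refine Finset.sum_congr rfl fun w _ => ?_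
  have := ww_succ (n - w.1) (m - w.2)
  have e1 : n - w.1 + 1 = n + 1 - w.1 := by ring
  have e2 : m - w.2 + 1 = m + 1 - w.2 := by ring
  have e3 : m - w.2 - 1 = m - 1 - w.2 := by ring
  rw [e1, e2, e3] at this
  rw [this]; ring

lemma TT_VV (g : (ℤ × ℤ) →₀ ℝ) (n m : ℤ) :
    TT g (n, m) = (2 * VV g (n, m) - VV g (n, m-1) - VV g (n, m+1)) / 4 := by
  rw [TT_apply]
  simp only [VV_apply]
  rw [Finset.mul_sum, ← Finset.sum_sub_distrib, ← Finset.sum_sub_distrib, Finset.sum_div]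
  refine Finset.sum_congr rfl fun w _ => ?_
  have := kk_ww (n - w.1) (m - w.2)
  have e2 : m - w.2 + 1 = m + 1 - w.2 := by ring
  have e3 : m - w.2 - 1 = m - 1 - w.2 := by ring
  rw [e2, e3] at this
  rw [this]; ring

lemma VV_fin (g : (ℤ × ℤ) →₀ ℝ) (n : ℤ) : (Function.support (fun m => VV g (n, m))).Finite := by
  have : (⋃ w ∈ g.support, Set.image (fun m => m + w.2) (Function.support (ww (n - w.1)))).Finite :=
    g.support.finite_toSet.biUnion fun w _ => (ww_fin _).image _
  refine this.subset ?_
  intro m hm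
  simp only [Function.mem_support, VV_apply] at hm
  obtain ⟨w, hw, h⟩ := Finset.exists_ne_zero_of_sum_ne_zero hm
  simp only [mem_iUnion]
  exact ⟨w, hw, m - w.2, by simpa using (mul_ne_zero_iff.mp h).2, by simp⟩

lemma VV_zero (g : (ℤ × ℤ) →₀ ℝ) (n : ℤ) (h : ∀ w ∈ g.support, n ≤ w.1) (m : ℤ) : VV g (n, m) = 0 := by
  rw [VV_apply]
  refine Finset.sum_eq_zero fun w hw => ?_
  rw [ww_nonpos (by have := h w hw; simp; lia)]; simp

lemma VV_step (g : (ℤ × ℤ) →₀ ℝ) (n : ℤ) :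
    (∑' m, (VV g (n+1, m+1) - VV g (n+1, m))^2/4) + ∑' m, (TT g (n, m))^2 ≤
    (∑' m, (VV g (n, m+1) - VV g (n, m))^2/4) + ∑' m, (g (n, m))^2 := by
  set v : ℤ → ℝ := fun m => VV g (n, m) with hv
  set v' : ℤ → ℝ := fun m => VV g (n+1, m) with hv'
  have fv : (Function.support v).Finite := VV_fin g n
  have fv' : (Function.support v').Finite := VV_fin g (n+1)
  set U : Set ℤ := Function.support v ∪ Function.support v' with hU
  have fU : U.Finite := fv.union fv'
  have sh : ∀ s : ℤ, (Set.image (fun m => m + s) U).Finite := fun s => fU.image _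
  set U' : Set ℤ := Set.image (fun m => m + 0) U ∪ Set.image (fun m => m + 1) U ∪ Set.image (fun m => m + (-1)) U with hU'
  have fU' : U'.Finite := ((sh 0).union (sh 1)).union (sh (-1))
  have z0 : ∀ m, m ∉ U' → v m = 0 ∧ v' m = 0 ∧ v (m+1) = 0 ∧ v' (m+1) = 0 ∧ v (m-1) = 0 ∧ v' (m-1) = 0 := by
    intro m hm
    simp only [hU', mem_union, not_or] at hm
    have h0 : m ∉ U := fun h => hm.1.1 ⟨m, h, by simp⟩
    have h1 : m - 1 ∉ U := fun h => hm.1.2 ⟨m-1, h, by simp⟩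
    have h2 : m + 1 ∉ U := fun h => hm.2 ⟨m+1, h, by simp⟩
    simp only [hU, mem_union, Function.mem_support, not_or, not_not] at h0 h1 h2
    tauto
  have eg : ∀ m, g (n, m) = v' m - (v (m-1) + 2 * v m + v (m+1)) / 4 := by
    intro m; have := VV_succ g n m; simp only [hv, hv']; linarith
  have eT : ∀ m, TT g (n, m) = (2 * v m - v (m-1) - v (m+1)) / 4 := fun m => TT_VV g n m
  have summ : ∀ F : ℤ → ℝ, (∀ m, m ∉ U' → F m = 0) → Summable F := by
    intro F hF
    apply summable_of_hasFiniteSupport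
    refine fU'.subset fun m hm => ?_
    by_contra h; exact hm (hF m h)
  set X : ℤ → ℝ := fun m => (v m - v (m-1)) * (v' m - v m) / 2 + (v' m - v m)^2/2 with hX
  have sX : Summable X := summ X fun m hm => by obtain ⟨a1, a2, a3, a4, a5, a6⟩ := z0 m hm; simp [hX, a1, a2, a5]
  have sX1 : Summable (fun m => X (m+1)) := (Equiv.addRight (1:ℤ)).summable_iff.mpr sX
  have tX : ∑' m, X (m+1) = ∑' m, X m := (Equiv.addRight (1:ℤ)).tsum_eq X
  have s1 : Summable (fun m => (v' (m+1) - v' m)^2/4) := summ _ fun m hm => by obtain ⟨a1, a2, a3, a4, a5, a6⟩ := z0 m hm; simp [a2, a4]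
  have s2 : Summable (fun m => (v (m+1) - v m)^2/4) := summ _ fun m hm => by obtain ⟨a1, a2, a3, a4, a5, a6⟩ := z0 m hm; simp [a1, a3]
  have s3 : Summable (fun m => (TT g (n, m))^2) := summ _ fun m hm => by obtain ⟨a1, a2, a3, a4, a5, a6⟩ := z0 m hm; simp [eT, a1, a3, a5]
  have s4 : Summable (fun m => (g (n, m))^2) := summ _ fun m hm => by obtain ⟨a1, a2, a3, a4, a5, a6⟩ := z0 m hm; simp [eg, a1, a2, a3, a5]
  have main := (s1.add (s3.add sX)).tsum_le_tsum (g := fun m => (v (m+1) - v m)^2/4 + (g (n, m)^2 + X (m+1))) (by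
    intro m
    simp only [eg, eT, hX]
    have : m + 1 - 1 = m := by ring
    rw [this]
    nlinarith [sq_nonneg ((v' (m+1) - v (m+1)) + (v' m - v m))]) (s2.add (s4.add sX1))
  rw [s1.tsum_add (s3.add sX), s3.tsum_add sX, s2.tsum_add (s4.add sX1), s4.tsum_add sX1, tX] at main
  linarith

lemma g_row_fin (g : (ℤ × ℤ) →₀ ℝ) (n : ℤ) : (Function.support (fun m => g (n, m))).Finite := by
  refine (g.hasFiniteSupport.image Prod.snd).subset ?_
  intro m hm; exact ⟨(n, m), hm, rfl⟩

lemma TT_row_fin (g : (ℤ × ℤ) →₀ ℝ) (n : ℤ) : (Function.support (fun m => TT g (n, m))).Finite := by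
  have f := VV_fin g n
  refine ((f.union (f.image (fun m => m + 1))).union (f.image (fun m => m - 1))).subset ?_
  intro m hm
  by_contra h
  apply hm
  simp only [mem_union, not_or] at h
  have h0 : VV g (n, m) = 0 := by simpa using h.1.1
  have h1 : VV g (n, m-1) = 0 := by by_contra h'; exact h.1.2 ⟨m-1, h', by simp⟩
  have h2 : VV g (n, m+1) = 0 := by by_contra h'; exact h.2 ⟨m+1, h', by simp⟩
  simp only [TT_VV, h0, h1, h2]; norm_num

lemma tsum_sq_ofReal {F : ℤ → ℝ} (h : (Function.support F).Finite) :
    ∑' m, ‖F m‖ₑ^2 = ENNReal.ofReal (∑' m, (F m)^2) := by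
  rw [ENNReal.ofReal_tsum_of_nonneg (fun m => sq_nonneg _)]
  · refine tsum_congr fun m => ?_
    rw [Real.enorm_eq_ofReal_abs, ← ENNReal.ofReal_pow (abs_nonneg _), sq_abs]
  · apply summable_of_hasFiniteSupport
    refine h.subset fun m hm h' => hm ?_
    simp [h']

lemma TT_L2 (g : (ℤ × ℤ) →₀ ℝ) : ∑' z, ‖TT g z‖ₑ^2 ≤ ∑' z, ‖g z‖ₑ^2 := by
  obtain ⟨n0, hn0⟩ : ∃ n0 : ℤ, ∀ w ∈ g.support, n0 ≤ w.1 := by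
    obtain ⟨b, hb⟩ := (g.support.image Prod.fst).bddBelow
    exact ⟨b, fun w hw => hb (by simp only [Finset.coe_image]; exact ⟨w, hw, rfl⟩)⟩
  have TZ : ∀ n ≤ n0, ∀ m, TT g (n, m) = 0 := by
    intro n hn m
    have h : ∀ m, VV g (n, m) = 0 := VV_zero g n fun w hw => hn.trans (hn0 w hw)
    rw [TT_VV, h, h, h]; norm_num
  have part : ∀ N : ℕ, (∑' m, (VV g (n0+N, m+1) - VV g (n0+N, m))^2/4) + ∑ i ∈ Finset.range N, ∑' m, (TT g (n0+i, m))^2 ≤ ∑ i ∈ Finset.range N, ∑' m, (g (n0+i, m))^2 := by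
    intro N
    induction N with
    | zero =>
      simp only [Nat.cast_zero, add_zero, Finset.range_zero, Finset.sum_empty]
      have h : ∀ m, VV g (n0, m) = 0 := VV_zero g n0 hn0
      simp [h]
    | succ N ih =>
      rw [Finset.sum_range_succ, Finset.sum_range_succ]
      have := VV_step g (n0+N)
      push_cast
      rw [← add_assoc n0]
      linarith
  have part2 : ∀ N : ℕ, ∑ i ∈ Finset.range N, ∑' m, ‖TT g (n0+i, m)‖ₑ^2 ≤ ∑ i ∈ Finset.range N, ∑' m, ‖g (n0+i, m)‖ₑ^2 := by
    intro N
    have e1 : ∀ i : ℕ, ∑' m, ‖TT g (n0+i, m)‖ₑ^2 = ENNReal.ofReal (∑' m, (TT g (n0+i, m))^2) := fun i => tsum_sq_ofReal (TT_row_fin g _)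
    have e2 : ∀ i : ℕ, ∑' m, ‖g (n0+i, m)‖ₑ^2 = ENNReal.ofReal (∑' m, (g (n0+i, m))^2) := fun i => tsum_sq_ofReal (g_row_fin g _)
    simp only [e1, e2]
    rw [← ENNReal.ofReal_sum_of_nonneg (fun i _ => tsum_nonneg fun m => sq_nonneg _), ← ENNReal.ofReal_sum_of_nonneg (fun i _ => tsum_nonneg fun m => sq_nonneg _)]
    apply ENNReal.ofReal_le_ofReal
    have := part N
    have p : 0 ≤ (∑' m, (VV g (n0+N, m+1) - VV g (n0+N, m))^2/4) := tsum_nonneg fun m => by positivity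
    linarith
  have hι : Function.Injective (fun i : ℕ => n0 + i) := fun i j h => by simp only at h; lia
  rw [ENNReal.tsum_prod', ENNReal.tsum_prod', ← hι.tsum_eq]
  · refine le_trans ?_ (ENNReal.tsum_comp_le_tsum_of_injective hι _)
    apply ENNReal.tsum_le_of_sum_range_le
    intro N
    exact (part2 N).trans (ENNReal.sum_le_tsum _)
  · intro n hn
    by_contra h
    apply hn
    have : n ≤ n0 := by
      by_contra h'
      exact h ⟨(n-n0).toNat, by simp; lia⟩
    simp [TZ n this]

/-! Part 5 -/

lemma TT_weak (l : ℝ) (hl : 0 < l) (g : (ℤ × ℤ) →₀ ℝ) :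
    ∑' z, (if l < |TT g z| then (1:ℝ≥0∞) else 0) ≤ ENNReal.ofReal (937 / l) * l1 g := by
  obtain ⟨gd, Ω, h1, h2, h3, h4⟩ := cz_top (ENNReal.ofReal l) (by simpa using hl) g
  have pt : ∀ z, (if l < |TT g z| then (1:ℝ≥0∞) else 0) ≤ (Ω : Set (ℤ × ℤ)).indicator 1 z +
      (ENNReal.ofReal (2 / l) * ((Ω : Set (ℤ × ℤ))ᶜ).indicator (fun z => ‖TT (g - gd) z‖ₑ) z +
       ENNReal.ofReal (4 / l^2) * ‖TT gd z‖ₑ^2) := by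
    intro z
    split_ifs with h
    swap; · exact zero_le
    by_cases hz : z ∈ (Ω : Set (ℤ × ℤ))
    · rw [indicator_of_mem hz]; exact le_self_add
    · refine le_trans ?_ le_add_self
      rw [indicator_of_mem (by simpa using hz)]
      have hs : TT g z = TT (g - gd) z + TT gd z := by
        rw [← Pi.add_apply, ← map_add, sub_add_cancel]
      rw [hs] at h
      have h' := h.trans_le (abs_add_le _ _)
      by_cases hh : l / 2 ≤ |TT (g - gd) z|
      · refine le_trans ?_ le_self_add
        rw [Real.enorm_eq_ofReal_abs, ← ENNReal.ofReal_mul (by positivity)]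
        rw [← ENNReal.ofReal_one]
        apply ENNReal.ofReal_le_ofReal
        rw [div_mul_eq_mul_div, le_div_iff₀ hl]; linarith
      · refine le_trans ?_ le_add_self
        rw [Real.enorm_eq_ofReal_abs, ← ENNReal.ofReal_pow (abs_nonneg _), ← ENNReal.ofReal_mul (by positivity)]
        rw [← ENNReal.ofReal_one]
        apply ENNReal.ofReal_le_ofReal
        rw [div_mul_eq_mul_div, le_div_iff₀ (by positivity)]
        have : l / 2 ≤ |TT gd z| := by linarith
        nlinarith
  refine (ENNReal.tsum_le_tsum pt).trans ?_
  rw [ENNReal.tsum_add, ENNReal.tsum_add, ENNReal.tsum_mul_left, ENNReal.tsum_mul_left]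
  have a1 : ∑' z, (Ω : Set (ℤ × ℤ)).indicator (1 : ℤ × ℤ → ℝ≥0∞) z ≤ ENNReal.ofReal (9 / l) * l1 g := by
    rw [← tsum_subtype, Finset.tsum_subtype' Ω (1 : ℤ × ℤ → ℝ≥0∞)]
    simp only [Pi.one_apply, Finset.sum_const, nsmul_eq_mul, mul_one]
    have : (Ω.card : ℝ≥0∞) = ENNReal.ofReal (1/l) * (ENNReal.ofReal l * Ω.card) := by
      rw [← mul_assoc, ← ENNReal.ofReal_mul (by positivity)]
      have : 1 / l * l = 1 := by field_simp
      rw [this]; simp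
    rw [this]
    refine (mul_le_mul_right h3 _).trans (le_of_eq ?_)
    rw [← mul_assoc]; congr 1
    rw [show (9:ℝ≥0∞) = ENNReal.ofReal 9 by simp, ← ENNReal.ofReal_mul (by positivity)]
    congr 1; ring
  have a2 : ENNReal.ofReal (2 / l) * ∑' z, ((Ω : Set (ℤ × ℤ))ᶜ).indicator (fun z => ‖TT (g - gd) z‖ₑ) z ≤ ENNReal.ofReal (896 / l) * l1 g := by
    refine (mul_le_mul_right h4 _).trans (le_of_eq ?_)
    rw [← mul_assoc]; congr 1
    rw [show (448:ℝ≥0∞) = ENNReal.ofReal 448 by simp, ← ENNReal.ofReal_mul (by positivity)]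
    congr 1; ring
  have a3 : ENNReal.ofReal (4 / l^2) * ∑' z, ‖TT gd z‖ₑ^2 ≤ ENNReal.ofReal (32 / l) * l1 g := by
    have : ∑' z, ‖TT gd z‖ₑ^2 ≤ ENNReal.ofReal (8 * l) * l1 g := by
      refine (TT_L2 gd).trans ?_
      refine le_trans ?_ (mul_le_mul_right h2 _)
      rw [l1, ← ENNReal.tsum_mul_left]
      refine ENNReal.tsum_le_tsum fun z => ?_
      rw [sq]; gcongr
      refine (h1 z).trans (le_of_eq ?_)
      rw [ENNReal.ofReal_mul (by positivity)]; simp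
    refine (mul_le_mul_right this _).trans (le_of_eq ?_)
    rw [← mul_assoc]; congr 1
    rw [← ENNReal.ofReal_mul (by positivity)]
    congr 1; field_simp; norm_num
  refine (add_le_add a1 (add_le_add a2 a3)).trans (le_of_eq ?_)
  rw [← add_mul, ← add_mul, ← ENNReal.ofReal_add (by positivity) (by positivity), ← ENNReal.ofReal_add (by positivity) (by positivity)]
  congr 2; ring

lemma lint_low (x r : ℝ) (hx : 0 ≤ x) (hr : -1 < r) :
    ∫⁻ l in Ioi (0:ℝ), (if l < x then ENNReal.ofReal (l^r) else 0) = ENNReal.ofReal (x^(r+1)/(r+1)) := by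
  have e : ∀ l, (if l < x then ENNReal.ofReal (l^r) else 0) = (Iio x).indicator (fun l => ENNReal.ofReal (l^r)) l := fun l => by
    by_cases h : l < x <;> simp [h]
  simp only [e]
  rw [setLIntegral_indicator measurableSet_Iio, Set.inter_comm, Ioi_inter_Iio]
  have h_intg : IntegrableOn (fun l : ℝ => l^r) (Ioo 0 x) :=
    ((intervalIntegral.intervalIntegrable_rpow' hr (a := 0) (b := x)).1).mono_set Ioo_subset_Ioc_self
  rw [← ofReal_integral_eq_lintegral_ofReal h_intg]
  · rw [← integral_Ioc_eq_integral_Ioo, ← intervalIntegral.integral_of_le hx, integral_rpow (Or.inl hr),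
      Real.zero_rpow (by linarith), sub_zero]
  · filter_upwards [self_mem_ae_restrict measurableSet_Ioo] with l hl
    exact Real.rpow_nonneg hl.1.le _

lemma lint_high (x r : ℝ) (hx : 0 < x) (hr : r < -1) :
    ∫⁻ l in Ioi (0:ℝ), (if l < x then 0 else ENNReal.ofReal (l^r)) = ENNReal.ofReal (-x^(r+1)/(r+1)) := by
  have e : ∀ l, (if l < x then 0 else ENNReal.ofReal (l^r)) = (Ici x).indicator (fun l => ENNReal.ofReal (l^r)) l := fun l => by
    by_cases h : l < x <;> simp [h, not_le.mpr, not_lt.mp]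
  simp only [e]
  rw [setLIntegral_indicator measurableSet_Ici, show Ici x ∩ Ioi 0 = Ici x from inter_eq_left.mpr (Ici_subset_Ioi.mpr hx)]
  rw [← restrict_Ioi_eq_restrict_Ici]
  rw [← ofReal_integral_eq_lintegral_ofReal (integrableOn_Ioi_rpow_of_lt hr hx), integral_Ioi_rpow_of_lt hr hx]
  filter_upwards [self_mem_ae_restrict measurableSet_Ioi] with l hl
  exact Real.rpow_nonneg (hx.trans hl).le _

lemma TT_dist (l : ℝ) (hl : 0 < l) (g : (ℤ × ℤ) →₀ ℝ) :
    ∑' z, (if l < |TT g z| then (1:ℝ≥0∞) else 0) ≤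
      ∑' z, ((if l < |g z| then ENNReal.ofReal (1874 / l) * ‖g z‖ₑ else 0) +
        (if l < |g z| then 0 else ENNReal.ofReal (4 / l^2) * ‖g z‖ₑ^2)) := by
  set gb := g.filter (fun z => l < |g z|) with hgb
  set gs := g.filter (fun z => ¬ l < |g z|) with hgs
  have hs : g = gb + gs := (Finsupp.filter_add_filter_not g _).symm
  have pt : ∀ z, (if l < |TT g z| then (1:ℝ≥0∞) else 0) ≤ (if l/2 < |TT gb z| then (1:ℝ≥0∞) else 0) + ENNReal.ofReal (4 / l^2) * ‖TT gs z‖ₑ^2 := by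
    intro z
    split_ifs with h h2 h2
    · exact le_self_add
    · rw [zero_add, Real.enorm_eq_ofReal_abs, ← ENNReal.ofReal_pow (abs_nonneg _), ← ENNReal.ofReal_mul (by positivity)]
      rw [← ENNReal.ofReal_one]
      apply ENNReal.ofReal_le_ofReal
      rw [div_mul_eq_mul_div, le_div_iff₀ (by positivity)]
      have hs' : TT g z = TT gb z + TT gs z := by
        rw [← Pi.add_apply, ← map_add, ← hs]
      rw [hs'] at h
      have h' := h.trans_le (abs_add_le _ _)
      have : l / 2 ≤ |TT gs z| := by linarith
      nlinarith
    · exact zero_le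
    · exact zero_le
  refine (ENNReal.tsum_le_tsum pt).trans ?_
  rw [ENNReal.tsum_add, ENNReal.tsum_add, ENNReal.tsum_mul_left]
  apply add_le_add
  · refine (TT_weak (l/2) (by positivity) gb).trans (le_of_eq ?_)
    rw [l1, ← ENNReal.tsum_mul_left]
    refine tsum_congr fun z => ?_
    rw [hgb, Finsupp.filter_apply, show 937 / (l/2) = 1874 / l by field_simp; norm_num]
    split_ifs <;> simp
  · refine (mul_le_mul_right (TT_L2 gs) _).trans (le_of_eq ?_)
    rw [← ENNReal.tsum_mul_left]
    refine tsum_congr fun z => ?_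
    rw [hgs, Finsupp.filter_apply]
    by_cases h : l < |g z| <;> simp [h]

lemma TT_Lq (q : ℝ) (h1 : 1 < q) (h2 : q ≤ 2) : ∃ C : ℝ, 1 ≤ C ∧ ∀ g : (ℤ × ℤ) →₀ ℝ,
    ∑' z, ‖TT g z‖ₑ^q ≤ ENNReal.ofReal C * ∑' z, ‖g z‖ₑ^q := by
  rcases h2.lt_or_eq with h2 | h2
  swap
  · refine ⟨1, le_rfl, fun g => ?_⟩
    subst h2
    simpa using TT_L2 g
  refine ⟨1 + (q * (1874 / (q-1)) + q * (4 / (2-q))), ?_, fun g => ?_⟩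
  · have : 0 < q - 1 := by linarith
    have : 0 < 2 - q := by linarith
    have : 0 ≤ (q * (1874 / (q-1)) + q * (4 / (2-q))) := by positivity
    linarith
  have hq1 : 0 < q - 1 := by linarith
  have hq2 : 0 < 2 - q := by linarith
  have lay : ∀ x : ℝ, ‖x‖ₑ^q = ∫⁻ l in Ioi (0:ℝ), ENNReal.ofReal (q * l^(q-1)) * (if l < |x| then 1 else 0) := by
    intro x
    have e : ∀ l ∈ Ioi (0:ℝ), ENNReal.ofReal (q * l^(q-1)) * (if l < |x| then 1 else 0) = ENNReal.ofReal q * (if l < |x| then ENNReal.ofReal (l^(q-1)) else 0) := by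
      intro l hl
      rw [ENNReal.ofReal_mul (by linarith)]; split_ifs <;> simp
    rw [setLIntegral_congr_fun measurableSet_Ioi e, lintegral_const_mul' _ _ ENNReal.ofReal_ne_top, lint_low _ _ (abs_nonneg x) (by linarith), ← ENNReal.ofReal_mul (by linarith), Real.enorm_eq_ofReal_abs, ENNReal.ofReal_rpow_of_nonneg (abs_nonneg _) (by linarith)]
    congr 1
    rw [sub_add_cancel]; field_simp
  have mlow : ∀ x r : ℝ, Measurable (fun l : ℝ => if l < x then ENNReal.ofReal (l^r) else 0) := fun x r =>
    Measurable.ite measurableSet_Iio (by fun_prop) measurable_const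
  have mhigh : ∀ x r : ℝ, Measurable (fun l : ℝ => if l < x then 0 else ENNReal.ofReal (l^r)) := fun x r =>
    Measurable.ite measurableSet_Iio measurable_const (by fun_prop)
  calc ∑' z, ‖TT g z‖ₑ^q = ∑' z, ∫⁻ l in Ioi (0:ℝ), ENNReal.ofReal (q * l^(q-1)) * (if l < |TT g z| then 1 else 0) := tsum_congr fun z => lay _
    _ = ∫⁻ l in Ioi (0:ℝ), ∑' z, ENNReal.ofReal (q * l^(q-1)) * (if l < |TT g z| then 1 else 0) := by
        rw [lintegral_tsum]
        intro z
        apply Measurable.aemeasurable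
        apply Measurable.mul
        · fun_prop
        · exact Measurable.ite measurableSet_Iio measurable_const measurable_const
    _ ≤ ∫⁻ l in Ioi (0:ℝ), ∑' z, (ENNReal.ofReal (q * 1874) * ‖g z‖ₑ * (if l < |g z| then ENNReal.ofReal (l^(q-2)) else 0) + ENNReal.ofReal (q * 4) * ‖g z‖ₑ^2 * (if l < |g z| then 0 else ENNReal.ofReal (l^(q-3)))) := by
        refine setLIntegral_mono' measurableSet_Ioi fun l hl => ?_
        have hl : 0 < l := hl
        rw [ENNReal.tsum_mul_left]
        refine (mul_le_mul_right (TT_dist l hl g) _).trans (le_of_eq ?_)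
        rw [← ENNReal.tsum_mul_left]
        refine tsum_congr fun z => ?_
        have e1 : ENNReal.ofReal (q * l^(q-1)) * ENNReal.ofReal (1874 / l) = ENNReal.ofReal (q * 1874) * ENNReal.ofReal (l^(q-2)) := by
          rw [← ENNReal.ofReal_mul (by positivity), ← ENNReal.ofReal_mul (by positivity)]
          congr 1
          rw [show q - 1 = q - 2 + 1 by ring, Real.rpow_add_one hl.ne']; field_simp
        have e2 : ENNReal.ofReal (q * l^(q-1)) * ENNReal.ofReal (4 / l^2) = ENNReal.ofReal (q * 4) * ENNReal.ofReal (l^(q-3)) := by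
          rw [← ENNReal.ofReal_mul (by positivity), ← ENNReal.ofReal_mul (by positivity)]
          congr 1
          rw [show q - 1 = q - 3 + 1 + 1 by ring, Real.rpow_add_one hl.ne', Real.rpow_add_one hl.ne']; field_simp
        split_ifs with h
        · simp only [mul_zero, add_zero]
          rw [← mul_assoc, e1]; ring
        · simp only [mul_zero, zero_add]
          rw [← mul_assoc, e2]; ring
    _ = ∑' z, (ENNReal.ofReal (q * 1874) * ‖g z‖ₑ * ENNReal.ofReal (|g z|^(q-2+1)/(q-2+1)) + ENNReal.ofReal (q * 4) * ‖g z‖ₑ^2 * ∫⁻ l in Ioi (0:ℝ), (if l < |g z| then 0 else ENNReal.ofReal (l^(q-3)))) := by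
        rw [lintegral_tsum]
        · refine tsum_congr fun z => ?_
          rw [lintegral_add_left ((mlow _ _).const_mul _), lintegral_const_mul _ (mlow _ _), lintegral_const_mul _ (mhigh _ _), lint_low _ _ (abs_nonneg _) (by linarith)]
        · intro z
          exact (((mlow _ _).const_mul _).add ((mhigh _ _).const_mul _)).aemeasurable
    _ ≤ ∑' z, (ENNReal.ofReal (1 + (q * (1874 / (q-1)) + q * (4 / (2-q))))) * ‖g z‖ₑ^q := by
        refine ENNReal.tsum_le_tsum fun z => ?_
        by_cases h0 : g z = 0
        · simp [h0]
        have hx : 0 < |g z| := abs_pos.mpr h0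
        rw [lint_high _ _ hx (by linarith), Real.enorm_eq_ofReal_abs]
        set x := |g z|
        rw [ENNReal.ofReal_rpow_of_pos hx, ← ENNReal.ofReal_pow hx.le, ← ENNReal.ofReal_mul (by positivity), ← ENNReal.ofReal_mul (by positivity), ← ENNReal.ofReal_mul (by positivity), ← ENNReal.ofReal_mul (by positivity), ← ENNReal.ofReal_mul (by positivity), ← ENNReal.ofReal_add]
        · apply ENNReal.ofReal_le_ofReal
          have e1 : x * x^(q-2+1) = x^q := by
            rw [mul_comm, ← Real.rpow_add_one hx.ne']; congr 1; ring
          have e2 : x^2 * x^(q-3+1) = x^q := by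
            rw [mul_comm, sq, ← mul_assoc, ← Real.rpow_add_one hx.ne', ← Real.rpow_add_one hx.ne']; congr 1; ring
          have p : 0 ≤ x^q := by positivity
          calc _ = q * 1874 / (q-2+1) * (x * x^(q-2+1)) + q * 4 / (-(q-3+1)) * (x^2 * x^(q-3+1)) := by
                rw [neg_div, div_neg]; ring
            _ = (q * (1874 / (q-1)) + q * (4 / (2-q))) * x^q := by
                rw [e1, e2, show q - 2 + 1 = q - 1 by ring, show -(q-3+1) = 2 - q by ring]; ring
            _ ≤ _ := by nlinarith
        · have : 0 < q - 2 + 1 := by linarith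
          positivity
        · have : -x^(q-3+1)/(q-3+1) = x^(q-3+1) / (2-q) := by
            rw [show q-3+1 = -(2-q) by ring, neg_div_neg_eq]
          rw [this]; positivity
    _ = _ := ENNReal.tsum_mul_left

/-! Part 6 -/

lemma TT_succ (g : (ℤ × ℤ) →₀ ℝ) (n m : ℤ) :
    TT g (n+1, m) = (TT g (n, m-1) + 2 * TT g (n, m) + TT g (n, m+1)) / 4 +
      (2 * g (n, m) - g (n, m-1) - g (n, m+1)) / 4 := by
  simp only [TT_VV, VV_succ]
  ring_nf

lemma TT_init (g : (ℤ × ℤ) →₀ ℝ) (n : ℤ) (h : ∀ w ∈ g.support, n ≤ w.1) (m : ℤ) : TT g (n, m) = 0 := by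
  rw [TT_VV, VV_zero g n h, VV_zero g n h, VV_zero g n h]; norm_num

section scheme
variable {d : ℕ}

/-- translation operator -/
def shf (y : Fin d → ℝ) : ((Fin d → ℝ) → ℝ) →ₗ[ℝ] ((Fin d → ℝ) → ℝ) :=
  LinearMap.funLeft ℝ ℝ (fun x => x + y)

@[simp] lemma shf_apply (y : Fin d → ℝ) (f : (Fin d → ℝ) → ℝ) (x : Fin d → ℝ) : shf y f x = f (x + y) := rfl

def Pop (v : Fin d → ℝ) : ((Fin d → ℝ) → ℝ) →ₗ[ℝ] ((Fin d → ℝ) → ℝ) :=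
  (1/4 : ℝ) • shf (-v) + (1/2 : ℝ) • LinearMap.id + (1/4 : ℝ) • shf v

def Dop (v : Fin d → ℝ) : ((Fin d → ℝ) → ℝ) →ₗ[ℝ] ((Fin d → ℝ) → ℝ) := LinearMap.id - Pop v

lemma Pop_apply (v : Fin d → ℝ) (f : (Fin d → ℝ) → ℝ) (x : Fin d → ℝ) :
    Pop v f x = (f (x - v) + 2 * f x + f (x + v)) / 4 := by
  simp [Pop, sub_eq_add_neg]; ring

lemma Dop_apply (v : Fin d → ℝ) (f : (Fin d → ℝ) → ℝ) (x : Fin d → ℝ) :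
    Dop v f x = (2 * f x - f (x - v) - f (x + v)) / 4 := by
  simp [Dop, Pop_apply]; ring

/-- the discrete evolution scheme -/
def sch (R : ℕ → ((Fin d → ℝ) → ℝ) →ₗ[ℝ] ((Fin d → ℝ) → ℝ)) (v : Fin d → ℝ) (g : ℕ → (Fin d → ℝ) → ℝ) :
    ℕ → (Fin d → ℝ) → ℝ
  | 0 => 0
  | n+1 => R n (Pop v (sch R v g n)) + Dop v (g n)

lemma transf_pt (v x : Fin d → ℝ) (g : ℕ → (Fin d → ℝ) → ℝ) (N L : ℕ) :
    ∃ γ : (ℤ × ℤ) →₀ ℝ,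
      (∀ q : ℝ, 0 < q → ∑' z, ‖γ z‖ₑ^q = ∑ n ∈ Finset.range N, ∑ l ∈ Finset.Icc (-(L+N:ℤ)) (L+N), ‖g n (x + (l:ℝ) • v)‖ₑ^q) ∧
      ∀ n : ℕ, n ≤ N → ∀ l : ℤ, |l| ≤ L + N - n → TT γ (n, l) = sch (fun _ => LinearMap.id) v g n (x + (l:ℝ) • v) := by
  classical
  set ι : ℕ × ℤ → ℤ × ℤ := fun z => ((z.1 : ℤ), z.2) with hι
  have ι_inj : Function.Injective ι := by
    intro a b h; simp only [hι, Prod.mk.injEq, Nat.cast_inj] at h; exact Prod.ext h.1 h.2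
  set F : Finset (ℕ × ℤ) := Finset.range N ×ˢ Finset.Icc (-(L+N:ℤ)) (L+N) with hF
  let γ : (ℤ × ℤ) →₀ ℝ := Finsupp.onFinset (F.image ι)
    (fun z => if z ∈ F.image ι then g z.1.toNat (x + (z.2:ℝ) • v) else 0) (by intro a ha; by_contra h; simp [h] at ha)
  have γa : ∀ z, γ z = if z ∈ F.image ι then g z.1.toNat (x + (z.2:ℝ) • v) else 0 := fun z => rfl
  have memF : ∀ (n : ℕ) (l : ℤ), ((n:ℤ), l) ∈ F.image ι ↔ n < N ∧ |l| ≤ L + N := by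
    intro n l
    have : ((n:ℤ), l) = ι (n, l) := rfl
    rw [this, ι_inj.mem_finset_image, hF, Finset.mem_product, Finset.mem_range, Finset.mem_Icc, abs_le]
  refine ⟨γ, ?_, ?_⟩
  · intro q hq
    rw [tsum_eq_sum (s := F.image ι)]
    · rw [Finset.sum_image (fun a _ b _ h => ι_inj h), hF, Finset.sum_product]
      refine Finset.sum_congr rfl fun n hn => Finset.sum_congr rfl fun l hl => ?_
      rw [γa, if_pos]
      · simp [hι]
      · rw [hF]; exact Finset.mem_image_of_mem _ (Finset.mem_product.mpr ⟨hn, hl⟩)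
    · intro z hz
      rw [γa, if_neg hz]; simp [hq]
  · intro n
    induction n with
    | zero =>
      intro _ l _
      have : TT γ (((0:ℕ):ℤ), l) = 0 := by
        apply TT_init
        intro w hw
        have : w ∈ F.image ι := by
          by_contra h; rw [Finsupp.mem_support_iff, γa, if_neg h] at hw; exact hw rfl
        obtain ⟨z, _, rfl⟩ := Finset.mem_image.mp this
        simp [hι]
      rw [this]; rfl
    | succ n ih =>
      intro hn l hl
      push_cast at hl ⊢
      have hl' := abs_le.mp hl
      have b0 : |l| ≤ L + N - n := by lia
      have b1 : |l-1| ≤ L + N - n := by rw [abs_le]; constructor <;> lia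
      have b2 : |l+1| ≤ L + N - n := by rw [abs_le]; constructor <;> lia
      have c : ∀ l : ℤ, |l| ≤ L + N - n → γ ((n:ℤ), l) = g n (x + (l:ℝ) • v) := by
        intro l hl
        rw [γa, if_pos ((memF n l).mpr ⟨by lia, by lia⟩)]; simp
      rw [TT_succ, ih (by lia) l b0, ih (by lia) _ b1, ih (by lia) _ b2, c _ b0, c _ b1, c _ b2]
      have e1 : x + ((l-1 : ℤ):ℝ) • v = x + (l:ℝ) • v - v := by push_cast; module
      have e2 : x + ((l+1 : ℤ):ℝ) • v = x + (l:ℝ) • v + v := by push_cast; module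
      rw [e1, e2, sch]
      simp only [LinearMap.id_apply, Pi.add_apply, Pop_apply, Dop_apply]

lemma meas_Pop (v : Fin d → ℝ) {f : (Fin d → ℝ) → ℝ} (hf : Measurable f) : Measurable (Pop v f) := by
  have : Pop v f = fun x => (f (x - v) + 2 * f x + f (x + v)) / 4 := funext (Pop_apply v f)
  rw [this]; fun_prop

lemma meas_Dop (v : Fin d → ℝ) {f : (Fin d → ℝ) → ℝ} (hf : Measurable f) : Measurable (Dop v f) := by
  have : Dop v f = fun x => (2 * f x - f (x - v) - f (x + v)) / 4 := funext (Dop_apply v f)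
  rw [this]; fun_prop

lemma meas_sch {R : ℕ → ((Fin d → ℝ) → ℝ) →ₗ[ℝ] ((Fin d → ℝ) → ℝ)} {v : Fin d → ℝ} {g : ℕ → (Fin d → ℝ) → ℝ}
    (hg : ∀ n, Measurable (g n)) (hR : ∀ n f, Measurable f → Measurable (R n f)) (n : ℕ) : Measurable (sch R v g n) := by
  induction n with
  | zero => exact measurable_const
  | succ n ih => exact (hR n _ (meas_Pop v ih)).add (meas_Dop v (hg n))

/-- the `L_q` bound for schemes -/
def SchBd (q C : ℝ) (R : ℕ → ((Fin d → ℝ) → ℝ) →ₗ[ℝ] ((Fin d → ℝ) → ℝ)) (v : Fin d → ℝ) (g : ℕ → (Fin d → ℝ) → ℝ) (N : ℕ) : Prop :=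
  ∑ n ∈ Finset.range (N+1), ∫⁻ x, ‖sch R v g n x‖ₑ^q ≤ ENNReal.ofReal C * ∑ n ∈ Finset.range N, ∫⁻ x, ‖g n x‖ₑ^q

lemma transf (q C : ℝ) (hq : 1 < q) (hC : ∀ g : (ℤ × ℤ) →₀ ℝ,
    ∑' z, ‖TT g z‖ₑ^q ≤ ENNReal.ofReal C * ∑' z, ‖g z‖ₑ^q) (v : Fin d → ℝ) (g : ℕ → (Fin d → ℝ) → ℝ)
    (hg : ∀ n, Measurable (g n)) (N : ℕ) : SchBd q (2 * C) (fun _ => LinearMap.id) v g N := by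
  classical
  have hms : ∀ n, Measurable (sch (fun _ => LinearMap.id) v g n) := meas_sch hg (fun n f hf => hf)
  have pt : ∀ x : Fin d → ℝ, ∑ n ∈ Finset.range (N+1), ∑ l ∈ Finset.Icc (-(N:ℤ)) N, ‖sch (fun _ => LinearMap.id) v g n (x + (l:ℝ) • v)‖ₑ^q ≤ ENNReal.ofReal C * ∑ n ∈ Finset.range N, ∑ l ∈ Finset.Icc (-(N+N:ℤ)) (N+N), ‖g n (x + (l:ℝ) • v)‖ₑ^q := by
    intro x
    obtain ⟨γ, h1, h2⟩ := transf_pt v x g N N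
    have := hC γ
    rw [h1 q (by linarith)] at this
    refine le_trans ?_ this
    set ι : ℕ × ℤ → ℤ × ℤ := fun z => ((z.1 : ℤ), z.2) with hι
    have ι_inj : Function.Injective ι := by
      intro a b h; simp only [hι, Prod.mk.injEq, Nat.cast_inj] at h; exact Prod.ext h.1 h.2
    rw [← Finset.sum_product']
    refine le_trans (le_of_eq ?_) (ENNReal.sum_le_tsum ((Finset.range (N+1) ×ˢ Finset.Icc (-(N:ℤ)) N).image ι))
    rw [Finset.sum_image (fun a _ b _ h => ι_inj h)]
    refine Finset.sum_congr rfl fun z hz => ?_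
    rw [Finset.mem_product, Finset.mem_range, Finset.mem_Icc] at hz
    simp only [hι]
    rw [h2 z.1 (by lia) z.2 (by rw [abs_le]; constructor <;> lia)]
  have tr : ∀ (f : (Fin d → ℝ) → ℝ) (l : ℤ), ∫⁻ x, ‖f (x + (l:ℝ) • v)‖ₑ^q = ∫⁻ x, ‖f x‖ₑ^q := fun f l =>
    lintegral_add_right_eq_self (fun x => ‖f x‖ₑ^q) ((l:ℝ) • v)
  have main := lintegral_mono (μ := (volume : Measure (Fin d → ℝ))) pt
  have mm : ∀ (f : (Fin d → ℝ) → ℝ) (l : ℤ), Measurable f → Measurable (fun x => ‖f (x + (l:ℝ) • v)‖ₑ^q) := by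
    intro f l hf; fun_prop
  rw [lintegral_finsetSum _ (fun n _ => Finset.measurable_fun_sum _ fun l _ => mm _ l (hms n)),
    lintegral_const_mul _ (Finset.measurable_fun_sum _ fun n _ => Finset.measurable_fun_sum _ fun l _ => mm _ l (hg n)),
    lintegral_finsetSum _ (fun n _ => Finset.measurable_fun_sum _ fun l _ => mm _ l (hg n))] at main
  have e1 : ∀ n ∈ Finset.range (N+1), ∫⁻ x, ∑ l ∈ Finset.Icc (-(N:ℤ)) N, ‖sch (fun _ => LinearMap.id) v g n (x + (l:ℝ) • v)‖ₑ^q = ((2*N+1 : ℕ) : ℝ≥0∞) * ∫⁻ x, ‖sch (fun _ => LinearMap.id) v g n x‖ₑ^q := by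
    intro n _
    rw [lintegral_finsetSum _ (fun l _ => mm _ l (hms n))]
    simp only [tr]
    rw [Finset.sum_const, Int.card_Icc, nsmul_eq_mul]
    congr 2; lia
  have e2 : ∀ n ∈ Finset.range N, ∫⁻ x, ∑ l ∈ Finset.Icc (-(N+N:ℤ)) (N+N), ‖g n (x + (l:ℝ) • v)‖ₑ^q = ((4*N+1 : ℕ) : ℝ≥0∞) * ∫⁻ x, ‖g n x‖ₑ^q := by
    intro n _
    rw [lintegral_finsetSum _ (fun l _ => mm _ l (hg n))]
    simp only [tr]
    rw [Finset.sum_const, Int.card_Icc, nsmul_eq_mul]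
    congr 2; lia
  rw [Finset.sum_congr rfl e1, Finset.sum_congr rfl e2, ← Finset.mul_sum, ← Finset.mul_sum] at main
  have h4 : ((4*N+1 : ℕ) : ℝ≥0∞) ≤ ((2*N+1 : ℕ) : ℝ≥0∞) * 2 := by exact_mod_cast (by lia : 4*N+1 ≤ (2*N+1)*2)
  have main2 := main.trans (mul_le_mul_right (mul_le_mul_left h4 _) _)
  rw [SchBd]
  have hne : ((2*N+1 : ℕ) : ℝ≥0∞) ≠ 0 := by exact_mod_cast (by lia : 2*N+1 ≠ 0)
  rw [← ENNReal.mul_le_mul_iff_right hne (ENNReal.natCast_ne_top _)]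
  refine main2.trans (le_of_eq ?_)
  rw [ENNReal.ofReal_mul (by norm_num), ENNReal.ofReal_ofNat]; ring

def IsConvShf (A : ((Fin d → ℝ) → ℝ) →ₗ[ℝ] ((Fin d → ℝ) → ℝ)) : Prop :=
  ∃ (n : ℕ) (w : Fin n → ℝ) (y : Fin n → Fin d → ℝ), (∀ i, 0 ≤ w i) ∧ ∑ i, w i = 1 ∧ A = ∑ i, w i • shf (y i)

lemma IsConvShf.meas {A : ((Fin d → ℝ) → ℝ) →ₗ[ℝ] ((Fin d → ℝ) → ℝ)} (h : IsConvShf A)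
    {f : (Fin d → ℝ) → ℝ} (hf : Measurable f) : Measurable (A f) := by
  obtain ⟨n, w, y, _, _, rfl⟩ := h
  have : ((∑ i, w i • shf (y i) : ((Fin d → ℝ) → ℝ) →ₗ[ℝ] ((Fin d → ℝ) → ℝ)) f) = fun x => ∑ i, w i * f (x + y i) := by
    ext x; simp [LinearMap.sum_apply]
  rw [this]; fun_prop

lemma isConvShf_shf (y : Fin d → ℝ) : IsConvShf (shf y) :=
  ⟨1, fun _ => 1, fun _ => y, by simp, by simp, by simp⟩

lemma sch_congr {R R' : ℕ → ((Fin d → ℝ) → ℝ) →ₗ[ℝ] ((Fin d → ℝ) → ℝ)} {v : Fin d → ℝ} {g : ℕ → (Fin d → ℝ) → ℝ}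
    {N : ℕ} (h : ∀ n < N, R n = R' n) : ∀ n ≤ N, sch R v g n = sch R' v g n := by
  intro n
  induction n with
  | zero => intro _; rfl
  | succ n ih => intro hn; rw [sch, sch, ih (by lia), h n (by lia)]

lemma sch_pure (q C : ℝ) (hq : 1 < q) (hC : ∀ g : (ℤ × ℤ) →₀ ℝ,
    ∑' z, ‖TT g z‖ₑ^q ≤ ENNReal.ofReal C * ∑' z, ‖g z‖ₑ^q) (v : Fin d → ℝ) (g : ℕ → (Fin d → ℝ) → ℝ)
    (hg : ∀ n, Measurable (g n)) (N : ℕ) (y : ℕ → Fin d → ℝ) : SchBd q (2 * C) (fun n => shf (y n)) v g N := by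
  set Y : ℕ → Fin d → ℝ := fun n => ∑ k ∈ Finset.range n, y k with hY
  obtain ⟨g', hg'⟩ : ∃ g' : ℕ → (Fin d → ℝ) → ℝ, ∀ n x, g' n x = g n (x - Y (n+1)) := ⟨_, fun n x => rfl⟩
  have h := transf q C hq hC v g' (fun n => by
    have := hg n
    have e : g' n = fun x => g n (x - Y (n+1)) := funext (hg' n)
    rw [e]; fun_prop) N
  have key : ∀ n x, sch (fun _ => LinearMap.id) v g' n x = sch (fun n => shf (y n)) v g n (x - Y n) := by
    intro n
    induction n with
    | zero => intro x; rfl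
    | succ n ih =>
      intro x
      rw [sch, sch]
      simp only [LinearMap.id_apply, Pi.add_apply, Pop_apply, Dop_apply, shf_apply, ih]
      have eY : Y (n+1) = Y n + y n := by simp only [hY]; rw [Finset.sum_range_succ]
      have a1 : x - Y (n+1) + y n - v = x - v - Y n := by rw [eY]; abel
      have a2 : x - Y (n+1) + y n = x - Y n := by rw [eY]; abel
      have a3 : x - Y n + v = x + v - Y n := by abel
      have a4 : x - Y (n+1) - v = x - v - Y (n+1) := by abel
      have a5 : x - Y (n+1) + v = x + v - Y (n+1) := by abel
      rw [a1, a2, a3, a4, a5, hg', hg', hg']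
  have tr : ∀ (f : (Fin d → ℝ) → ℝ) (c : Fin d → ℝ), ∫⁻ x, ‖f (x - c)‖ₑ^q = ∫⁻ x, ‖f x‖ₑ^q := fun f c =>
    lintegral_sub_right_eq_self (fun x => ‖f x‖ₑ^q) c
  rw [SchBd] at h ⊢
  simp only [key] at h
  simp only [hg', tr] at h
  exact h

lemma enorm_conv_pow {n : ℕ} (q : ℝ) (hq : 1 < q) (w a : Fin n → ℝ) (hw : ∀ i, 0 ≤ w i) (hs : ∑ i, w i = 1) :
    ‖∑ i, w i * a i‖ₑ^q ≤ ∑ i, ENNReal.ofReal (w i) * ‖a i‖ₑ^q := by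
  have h1 : ‖∑ i, w i * a i‖ₑ ≤ ∑ i, ENNReal.ofReal (w i) * ‖a i‖ₑ := by
    refine (enorm_sum_le _ _).trans (le_of_eq ?_)
    refine Finset.sum_congr rfl fun i _ => ?_
    rw [enorm_mul, Real.enorm_of_nonneg (hw i)]
  refine (ENNReal.rpow_le_rpow h1 (by linarith)).trans ?_
  refine ENNReal.rpow_arith_mean_le_arith_mean_rpow _ _ _ ?_ hq.le
  rw [← ENNReal.ofReal_sum_of_nonneg (fun i _ => hw i), hs, ENNReal.ofReal_one]

lemma sch_conv (q C : ℝ) (hq : 1 < q) (hC : ∀ g : (ℤ × ℤ) →₀ ℝ,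
    ∑' z, ‖TT g z‖ₑ^q ≤ ENNReal.ofReal C * ∑' z, ‖g z‖ₑ^q) (v : Fin d → ℝ) (g : ℕ → (Fin d → ℝ) → ℝ)
    (hg : ∀ n, Measurable (g n)) (N : ℕ) (K : ℕ) :
    ∀ R : ℕ → ((Fin d → ℝ) → ℝ) →ₗ[ℝ] ((Fin d → ℝ) → ℝ), (∀ n, IsConvShf (R n)) →
      (∀ n < N, K ≤ n → ∃ y, R n = shf y) → SchBd q (2 * C) R v g N := by
  induction K with
  | zero =>
    intro R hR hp
    have : ∀ n, ∃ y, n < N → R n = shf y := by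
      intro n
      by_cases h : n < N
      · obtain ⟨y, hy⟩ := hp n h (Nat.zero_le _); exact ⟨y, fun _ => hy⟩
      · exact ⟨0, fun h' => absurd h' h⟩
    choose y hy using this
    have h := sch_pure q C hq hC v g hg N y
    rw [SchBd] at h ⊢
    refine le_trans (le_of_eq ?_) h
    refine Finset.sum_congr rfl fun n hn => ?_
    rw [sch_congr (N := N) hy n (by simpa using Nat.lt_succ_iff.mp (Finset.mem_range.mp hn))]
  | succ K ih =>
    intro R hR hp
    obtain ⟨m, w, y, hw, hs, hRK⟩ := hR K
    set R' : Fin m → ℕ → ((Fin d → ℝ) → ℝ) →ₗ[ℝ] ((Fin d → ℝ) → ℝ) := fun i => Function.update R K (shf (y i)) with hR'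
    have hc : ∀ i n, IsConvShf (R' i n) := by
      intro i n
      by_cases h : n = K
      · subst h; simp only [hR', Function.update_self]; exact isConvShf_shf _
      · simp only [hR', Function.update_of_ne h]; exact hR n
    have hi : ∀ i, SchBd q (2 * C) (R' i) v g N := by
      intro i
      apply ih _ (hc i)
      · intro n hn hKn
        by_cases h : n = K
        · subst h; exact ⟨y i, by simp [hR']⟩
        · simp only [hR', Function.update_of_ne h]; exact hp n hn (by lia)
    have low : ∀ i, ∀ n ≤ K, sch (R' i) v g n = sch R v g n := fun i =>
      sch_congr (N := K) (fun n hn => by simp only [hR', Function.update_of_ne hn.ne])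
    have aff : ∀ n, sch R v g n = ∑ i, w i • sch (R' i) v g n := by
      intro n
      induction n with
      | zero => simp [sch]
      | succ n ihn =>
        have e : ∀ i, sch (R' i) v g (n+1) = R' i n (Pop v (sch (R' i) v g n)) + Dop v (g n) := fun i => rfl
        rw [sch]
        simp only [e, smul_add, Finset.sum_add_distrib]
        rw [← Finset.sum_smul, hs, one_smul]
        congr 1
        by_cases h : n = K
        · subst h
          rw [hRK, LinearMap.sum_apply]
          refine Finset.sum_congr rfl fun i _ => ?_
          rw [low i n le_rfl]; simp [hR']
        · have : ∀ i, R' i n = R n := fun i => by simp only [hR', Function.update_of_ne h]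
          simp only [this]
          conv_lhs => rw [ihn]
          simp only [map_sum, map_smul]
    have hm : ∀ i n, Measurable (sch (R' i) v g n) := fun i => meas_sch hg (fun n f hf => (hc i n).meas hf)
    rw [SchBd]
    calc ∑ n ∈ Finset.range (N+1), ∫⁻ x, ‖sch R v g n x‖ₑ^q ≤ ∑ n ∈ Finset.range (N+1), ∑ i, ENNReal.ofReal (w i) * ∫⁻ x, ‖sch (R' i) v g n x‖ₑ^q := by
          refine Finset.sum_le_sum fun n _ => ?_
          have mi : ∀ i, Measurable (fun x => ‖sch (R' i) v g n x‖ₑ^q) := fun i => by have := hm i n; fun_prop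
          simp only [← lintegral_const_mul _ (mi _)]
          rw [← lintegral_finsetSum _ (fun i _ => (mi i).const_mul _)]
          refine lintegral_mono fun x => ?_
          rw [aff n]
          simp only [Finset.sum_apply, Pi.smul_apply, smul_eq_mul]
          exact enorm_conv_pow q hq w _ hw hs
      _ = ∑ i, ENNReal.ofReal (w i) * ∑ n ∈ Finset.range (N+1), ∫⁻ x, ‖sch (R' i) v g n x‖ₑ^q := by
          rw [Finset.sum_comm]; simp only [Finset.mul_sum]
      _ ≤ ∑ i, ENNReal.ofReal (w i) * (ENNReal.ofReal (2*C) * ∑ n ∈ Finset.range N, ∫⁻ x, ‖g n x‖ₑ^q) := by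
          gcongr with i; exact hi i
      _ = _ := by
          rw [← Finset.sum_mul, ← ENNReal.ofReal_sum_of_nonneg (fun i _ => hw i), hs, ENNReal.ofReal_one, one_mul]

/-- discrete maximal regularity -/
lemma sch_bound (q : ℝ) (h1 : 1 < q) (h2 : q ≤ 2) : ∃ C : ℝ, 1 ≤ C ∧
    ∀ (d : ℕ) (v : Fin d → ℝ) (g : ℕ → (Fin d → ℝ) → ℝ), (∀ n, Measurable (g n)) → ∀ (N : ℕ)
      (R : ℕ → ((Fin d → ℝ) → ℝ) →ₗ[ℝ] ((Fin d → ℝ) → ℝ)), (∀ n, IsConvShf (R n)) → SchBd q C R v g N := by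
  obtain ⟨C, hC1, hC⟩ := TT_Lq q h1 h2
  refine ⟨2 * C, by linarith, fun d v g hg N R hR => ?_⟩
  exact sch_conv q C h1 hC v g hg N N R hR (fun n hn hn' => absurd hn (by lia))

end scheme

/-! Part 7 -/

section tests
variable {d : ℕ}

/-- test functions -/
def Tst (φ : (Fin d → ℝ) → ℝ) : Prop := ContDiff ℝ (⊤ : ℕ∞) φ ∧ HasCompactSupport φ

lemma Tst.cont {φ : (Fin d → ℝ) → ℝ} (h : Tst φ) : Continuous φ := h.1.continuous
lemma Tst.diff {φ : (Fin d → ℝ) → ℝ} (h : Tst φ) : Differentiable ℝ φ := h.1.differentiable (by simp)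

lemma Tst.zero : Tst (0 : (Fin d → ℝ) → ℝ) := ⟨contDiff_const, HasCompactSupport.zero⟩

lemma Tst.add {φ ψ : (Fin d → ℝ) → ℝ} (h : Tst φ) (h' : Tst ψ) : Tst (φ + ψ) := ⟨h.1.add h'.1, h.2.add h'.2⟩

lemma Tst.smul {φ : (Fin d → ℝ) → ℝ} (c : ℝ) (h : Tst φ) : Tst (c • φ) :=
  ⟨contDiff_const.smul h.1, h.2.smul_left (f := fun _ => c)⟩

lemma Tst.neg {φ : (Fin d → ℝ) → ℝ} (h : Tst φ) : Tst (-φ) := by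
  have := h.smul (-1); rwa [neg_one_smul] at this

lemma Tst.sub {φ ψ : (Fin d → ℝ) → ℝ} (h : Tst φ) (h' : Tst ψ) : Tst (φ - ψ) := by
  rw [sub_eq_add_neg]; exact h.add h'.neg

lemma Tst.sum {ι : Type*} (s : Finset ι) {φ : ι → (Fin d → ℝ) → ℝ} (h : ∀ i ∈ s, Tst (φ i)) : Tst (∑ i ∈ s, φ i) :=
  Finset.sum_induction φ Tst (fun _ _ => Tst.add) Tst.zero h

lemma Tst.shf {φ : (Fin d → ℝ) → ℝ} (h : Tst φ) (y : Fin d → ℝ) : Tst (shf y φ) := by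
  refine ⟨h.1.comp (contDiff_id.add contDiff_const), ?_⟩
  exact h.2.comp_homeomorph (Homeomorph.addRight y)

lemma Tst.pd {φ : (Fin d → ℝ) → ℝ} (h : Tst φ) (i : Fin d) : Tst (pd i φ) := by
  refine ⟨?_, h.2.fderiv_apply ℝ _⟩
  exact (h.1.fderiv_right (m := ((⊤:ℕ∞) : WithTop ℕ∞)) (by exact_mod_cast le_rfl)).clm_apply contDiff_const

lemma pd_shf (i : Fin d) (y : Fin d → ℝ) (φ : (Fin d → ℝ) → ℝ) : pd i (shf y φ) = shf y (pd i φ) := by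
  ext x
  simp only [pd, shf_apply]
  have : shf y φ = fun x => φ (x + y) := rfl
  rw [this, fderiv_comp_add_right]

lemma pd_add (i : Fin d) {φ ψ : (Fin d → ℝ) → ℝ} (h : Tst φ) (h' : Tst ψ) : pd i (φ + ψ) = pd i φ + pd i ψ := by
  ext x
  simp only [pd, Pi.add_apply]
  rw [fderiv_add (h.diff x) (h'.diff x)]; rfl

lemma pd_smul (i : Fin d) (c : ℝ) {φ : (Fin d → ℝ) → ℝ} (h : Tst φ) : pd i (c • φ) = c • pd i φ := by
  ext x
  simp only [pd, Pi.smul_apply]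
  rw [fderiv_const_smul (h.diff x)]; rfl

lemma pd_zero (i : Fin d) : pd i (0 : (Fin d → ℝ) → ℝ) = 0 := by
  ext x; simp [pd]

lemma pd_sub (i : Fin d) {φ ψ : (Fin d → ℝ) → ℝ} (h : Tst φ) (h' : Tst ψ) : pd i (φ - ψ) = pd i φ - pd i ψ := by
  ext x
  simp only [pd, Pi.sub_apply]
  rw [fderiv_sub (h.diff x) (h'.diff x)]; rfl

lemma pd_sum {ι : Type*} (s : Finset ι) (i : Fin d) {φ : ι → (Fin d → ℝ) → ℝ} (h : ∀ k ∈ s, Tst (φ k)) :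
    pd i (∑ k ∈ s, φ k) = ∑ k ∈ s, pd i (φ k) := by
  classical
  induction s using Finset.induction_on with
  | empty => simp [pd_zero]
  | insert a s ha ih =>
    rw [Finset.sum_insert ha, Finset.sum_insert ha, pd_add i (h a (by simp)) (Tst.sum s fun k hk => h k (by simp [hk])),
      ih (fun k hk => h k (by simp [hk]))]

lemma pd_comm (i j : Fin d) {φ : (Fin d → ℝ) → ℝ} (h : Tst φ) : pd i (pd j φ) = pd j (pd i φ) := by
  ext x
  have hs : IsSymmSndFDerivAt ℝ φ x := (h.1.contDiffAt).isSymmSndFDerivAt (by simp only [minSmoothness_of_isRCLikeNormedField]; exact WithTop.coe_le_coe.mpr (le_top : (2:ℕ∞) ≤ ⊤))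
  have hd : Differentiable ℝ (fderiv ℝ φ) :=
    (h.1.fderiv_right (m := ((⊤:ℕ∞) : WithTop ℕ∞)) (by exact_mod_cast le_rfl)).differentiable (by simp)
  have e : ∀ a b : Fin d, pd a (pd b φ) x = fderiv ℝ (fderiv ℝ φ) x (Pi.single a 1) (Pi.single b 1) := by
    intro a b
    have : pd b φ = fun y => fderiv ℝ φ y (Pi.single b 1) := rfl
    rw [this]; simp only [pd]
    rw [fderiv_clm_apply (hd x) (differentiableAt_const _)]
    simp
  rw [e, e]; exact hs _ _

lemma fderiv_eq_pd (φ : (Fin d → ℝ) → ℝ) (x z : Fin d → ℝ) : fderiv ℝ φ x z = ∑ i, z i * pd i φ x := by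
  have : z = ∑ i, z i • (Pi.single i (1:ℝ) : Fin d → ℝ) := by
    ext k; simp [Finset.sum_apply, Pi.single_apply]
  conv_lhs => rw [this]
  rw [map_sum]; simp [pd]

lemma Tst.conv {A : ((Fin d → ℝ) → ℝ) →ₗ[ℝ] ((Fin d → ℝ) → ℝ)} (hA : IsConvShf A) {φ : (Fin d → ℝ) → ℝ} (h : Tst φ) :
    Tst (A φ) := by
  obtain ⟨n, w, y, _, _, rfl⟩ := hA
  rw [LinearMap.sum_apply]
  exact Tst.sum _ fun i _ => (h.shf _).smul _

lemma pd_conv (i : Fin d) {A : ((Fin d → ℝ) → ℝ) →ₗ[ℝ] ((Fin d → ℝ) → ℝ)} (hA : IsConvShf A) {φ : (Fin d → ℝ) → ℝ} (h : Tst φ) :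
    pd i (A φ) = A (_root_.pd i φ) := by
  obtain ⟨n, w, y, _, _, rfl⟩ := hA
  rw [LinearMap.sum_apply, LinearMap.sum_apply]
  simp only [LinearMap.smul_apply]
  rw [pd_sum _ _ fun i _ => Tst.smul (w i) (h.shf (y i))]
  refine Finset.sum_congr rfl fun k _ => ?_
  rw [pd_smul _ _ (h.shf _), pd_shf]

lemma isConvShf_of_fintype {ι : Type*} [Fintype ι] (w : ι → ℝ) (y : ι → Fin d → ℝ) (hw : ∀ i, 0 ≤ w i) (hs : ∑ i, w i = 1) :
    IsConvShf (∑ i, w i • shf (y i)) := by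
  let e := Fintype.equivFin ι
  refine ⟨Fintype.card ι, fun k => w (e.symm k), fun k => y (e.symm k), fun k => hw _, ?_, ?_⟩
  · rw [← hs]; exact Equiv.sum_comp e.symm w
  · exact (Equiv.sum_comp e.symm (fun i => w i • shf (y i))).symm

lemma isConvShf_Pop (v : Fin d → ℝ) : IsConvShf (Pop v) := by
  refine ⟨3, ![1/4, 1/2, 1/4], ![-v, 0, v], ?_, ?_, ?_⟩
  · intro i; fin_cases i <;> norm_num
  · simp [Fin.sum_univ_three]; norm_num
  · have : (shf 0 : ((Fin d → ℝ) → ℝ) →ₗ[ℝ] ((Fin d → ℝ) → ℝ)) = LinearMap.id := by ext f x; simp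
    simp [Fin.sum_univ_three, Pop, this]

lemma Tst.Dop {φ : (Fin d → ℝ) → ℝ} (h : Tst φ) (v : Fin d → ℝ) : Tst (Dop v φ) :=
  h.sub (h.conv (isConvShf_Pop v))

lemma pd_Dop (i : Fin d) (v : Fin d → ℝ) {φ : (Fin d → ℝ) → ℝ} (h : Tst φ) : pd i (Dop v φ) = Dop v (_root_.pd i φ) := by
  have : ∀ ψ, Dop v ψ = ψ - Pop v ψ := fun ψ => rfl
  rw [this, this, pd_sub i h (h.conv (isConvShf_Pop v)), pd_conv i (isConvShf_Pop v) h]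

lemma Tst.sch {R : ℕ → ((Fin d → ℝ) → ℝ) →ₗ[ℝ] ((Fin d → ℝ) → ℝ)} (hR : ∀ n, IsConvShf (R n)) (v : Fin d → ℝ)
    {g : ℕ → (Fin d → ℝ) → ℝ} (hg : ∀ n, Tst (g n)) (n : ℕ) : Tst (sch R v g n) := by
  induction n with
  | zero => exact Tst.zero
  | succ n ih => exact ((ih.conv (isConvShf_Pop v)).conv (hR n)).add ((hg n).Dop v)

lemma pd_sch {R : ℕ → ((Fin d → ℝ) → ℝ) →ₗ[ℝ] ((Fin d → ℝ) → ℝ)} (hR : ∀ n, IsConvShf (R n)) (v : Fin d → ℝ)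
    {g : ℕ → (Fin d → ℝ) → ℝ} (hg : ∀ n, Tst (g n)) (i : Fin d) (n : ℕ) :
    pd i (sch R v g n) = sch R v (fun n => pd i (g n)) n := by
  induction n with
  | zero => exact pd_zero i
  | succ n ih =>
    have h := Tst.sch hR v hg n
    rw [_root_.sch, _root_.sch, pd_add i ((h.conv (isConvShf_Pop v)).conv (hR n)) ((hg n).Dop v),
      pd_conv i (hR n) (h.conv (isConvShf_Pop v)), pd_conv i (isConvShf_Pop v) h, ih, pd_Dop i v (hg n)]

end tests

section pairing
variable {d : ℕ} {P : ℝ≥0∞} [hP : Fact (1 ≤ P)]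

def pr (v : Lp ℝ P (volume : Measure (Fin d → ℝ))) (φ : (Fin d → ℝ) → ℝ) : ℝ := ∫ x, v x * φ x

lemma pr_int (v : Lp ℝ P (volume : Measure (Fin d → ℝ))) {φ : (Fin d → ℝ) → ℝ} (h : Tst φ) :
    Integrable (fun x => v x * φ x) :=
  ((Lp.memLp v).locallyIntegrable hP.out).integrable_smul_right_of_hasCompactSupport h.cont h.2

lemma pr_add_right (v : Lp ℝ P (volume : Measure (Fin d → ℝ))) {φ ψ : (Fin d → ℝ) → ℝ} (h : Tst φ) (h' : Tst ψ) :
    pr v (φ + ψ) = pr v φ + pr v ψ := by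
  simp only [pr]
  rw [← integral_add (pr_int v h) (pr_int v h')]
  simp only [Pi.add_apply, mul_add]

lemma pr_smul_right (v : Lp ℝ P (volume : Measure (Fin d → ℝ))) (c : ℝ) (φ : (Fin d → ℝ) → ℝ) :
    pr v (c • φ) = c * pr v φ := by
  simp only [pr]
  rw [← integral_const_mul]
  simp only [Pi.smul_apply, smul_eq_mul, mul_left_comm]

lemma pr_zero_right (v : Lp ℝ P (volume : Measure (Fin d → ℝ))) : pr v 0 = 0 := by
  simp [pr]

lemma pr_sub_right (v : Lp ℝ P (volume : Measure (Fin d → ℝ))) {φ ψ : (Fin d → ℝ) → ℝ} (h : Tst φ) (h' : Tst ψ) :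
    pr v (φ - ψ) = pr v φ - pr v ψ := by
  simp only [pr]
  rw [← integral_sub (pr_int v h) (pr_int v h')]
  simp only [Pi.sub_apply, mul_sub]

lemma pr_sum_right {ι : Type*} (s : Finset ι) (v : Lp ℝ P (volume : Measure (Fin d → ℝ))) {φ : ι → (Fin d → ℝ) → ℝ}
    (h : ∀ i ∈ s, Tst (φ i)) : pr v (∑ i ∈ s, φ i) = ∑ i ∈ s, pr v (φ i) := by
  simp only [pr]
  rw [← integral_finsetSum s (fun i hi => pr_int v (h i hi))]
  simp only [Finset.sum_apply, Finset.mul_sum]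

lemma pr_add_left (v w : Lp ℝ P (volume : Measure (Fin d → ℝ))) {φ : (Fin d → ℝ) → ℝ} (h : Tst φ) :
    pr (v + w) φ = pr v φ + pr w φ := by
  simp only [pr]
  rw [← integral_add (pr_int v h) (pr_int w h)]
  refine integral_congr_ae ?_
  filter_upwards [Lp.coeFn_add v w] with x hx
  rw [hx, Pi.add_apply, add_mul]

lemma pr_smul_left (c : ℝ) (v : Lp ℝ P (volume : Measure (Fin d → ℝ))) (φ : (Fin d → ℝ) → ℝ) :
    pr (c • v) φ = c * pr v φ := by
  simp only [pr]
  rw [← integral_const_mul]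
  refine integral_congr_ae ?_
  filter_upwards [Lp.coeFn_smul c v] with x hx
  rw [hx, Pi.smul_apply, smul_eq_mul, mul_assoc]

/-- bounded pairing -/
def Bd (P : ℝ≥0∞) (φ : (Fin d → ℝ) → ℝ) (c : ℝ) : Prop := ∀ v : Lp ℝ P (volume : Measure (Fin d → ℝ)), |pr v φ| ≤ c * ‖v‖

lemma pr_shf (v : Lp ℝ P (volume : Measure (Fin d → ℝ))) (y : Fin d → ℝ) (φ : (Fin d → ℝ) → ℝ) :
    ∃ w : Lp ℝ P (volume : Measure (Fin d → ℝ)), ‖w‖ = ‖v‖ ∧ pr v (shf y φ) = pr w φ := by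
  have mp : MeasurePreserving (fun x : Fin d → ℝ => x - y) volume volume := measurePreserving_sub_right volume y
  refine ⟨Lp.compMeasurePreserving _ mp v, Lp.norm_compMeasurePreserving v mp, ?_⟩
  have : pr (Lp.compMeasurePreserving _ mp v) φ = ∫ x, v (x - y) * φ x := by
    refine integral_congr_ae ?_
    filter_upwards [Lp.coeFn_compMeasurePreserving v mp] with x hx
    rw [hx]; rfl
  rw [this, ← integral_add_right_eq_self (fun x => v (x - y) * φ x) y]
  simp [pr]

lemma Bd.shf {φ : (Fin d → ℝ) → ℝ} {c : ℝ} (h : Bd P φ c) (y : Fin d → ℝ) : Bd P (shf y φ) c := by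
  intro v
  obtain ⟨w, hw, e⟩ := pr_shf v y φ
  rw [e, ← hw]; exact h w

lemma Bd.add {φ ψ : (Fin d → ℝ) → ℝ} {c c' : ℝ} (h : Bd P φ c) (h' : Bd P ψ c') (hφ : Tst φ) (hψ : Tst ψ) : Bd P (φ + ψ) (c + c') := by
  intro v
  rw [pr_add_right v hφ hψ]
  refine (abs_add_le _ _).trans ?_
  linarith [h v, h' v]

lemma Bd.mono {φ : (Fin d → ℝ) → ℝ} {c c' : ℝ} (h : Bd P φ c) (hc : c ≤ c') : Bd P φ c' := fun v =>
  (h v).trans (mul_le_mul_of_nonneg_right hc (norm_nonneg _))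

lemma Bd.zero : Bd P (0 : (Fin d → ℝ) → ℝ) 0 := by
  intro v; simp [pr_zero_right]

lemma Bd.smul {φ : (Fin d → ℝ) → ℝ} {c : ℝ} (a : ℝ) (h : Bd P φ c) : Bd P (a • φ) (|a| * c) := by
  intro v
  rw [pr_smul_right, abs_mul, mul_assoc]
  exact mul_le_mul_of_nonneg_left (h v) (abs_nonneg _)

lemma Bd.sum {ι : Type*} (s : Finset ι) {φ : ι → (Fin d → ℝ) → ℝ} {c : ι → ℝ} (h : ∀ i ∈ s, Bd P (φ i) (c i))
    (hT : ∀ i ∈ s, Tst (φ i)) : Bd P (∑ i ∈ s, φ i) (∑ i ∈ s, c i) := by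
  intro v
  rw [pr_sum_right s v hT, Finset.sum_mul]
  exact (Finset.abs_sum_le_sum_abs _ _).trans (Finset.sum_le_sum fun i hi => h i hi v)

lemma Bd.conv {A : ((Fin d → ℝ) → ℝ) →ₗ[ℝ] ((Fin d → ℝ) → ℝ)} (hA : IsConvShf A) {φ : (Fin d → ℝ) → ℝ} {c : ℝ}
    (h : Bd P φ c) (hT : Tst φ) : Bd P (A φ) c := by
  obtain ⟨n, w, y, hw, hs, rfl⟩ := hA
  rw [LinearMap.sum_apply]
  have := Bd.sum Finset.univ (φ := fun i => w i • _root_.shf (y i) φ) (c := fun i => |w i| * c)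
    (fun i _ => (h.shf _).smul _) (fun i _ => (hT.shf _).smul _)
  refine this.mono (le_of_eq ?_)
  simp only [abs_of_nonneg (hw _)]
  rw [← Finset.sum_mul, hs, one_mul]

lemma Bd.sch {R : ℕ → ((Fin d → ℝ) → ℝ) →ₗ[ℝ] ((Fin d → ℝ) → ℝ)} (hR : ∀ n, IsConvShf (R n)) {v : Fin d → ℝ}
    {g : ℕ → (Fin d → ℝ) → ℝ} (hg : ∀ n, Tst (g n)) {c : ℝ} (hc : ∀ n, Bd P (Dop v (g n)) c) (n : ℕ) :
    Bd P (sch R v g n) (n * c) := by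
  induction n with
  | zero => simpa [_root_.sch] using Bd.zero
  | succ n ih =>
    have h := Tst.sch hR v hg n
    refine ((((ih.conv (isConvShf_Pop v) h).conv (hR n) (h.conv (isConvShf_Pop v)))).add (hc n)
      ((h.conv (isConvShf_Pop v)).conv (hR n)) ((hg n).Dop v)).mono (le_of_eq ?_)
    push_cast; ring

/-- derivative of pairing along a line -/
lemma pr_hasDerivAt (v : Lp ℝ P (volume : Measure (Fin d → ℝ))) {φ : (Fin d → ℝ) → ℝ} (h : Tst φ) (z : Fin d → ℝ) (s : ℝ) :
    HasDerivAt (fun s : ℝ => pr v (shf (s • z) φ)) (∑ i, z i * pr v (shf (s • z) (pd i φ))) s := by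
  have hc : Continuous (fun x => fderiv ℝ φ x z) := by
    simp only [fderiv_eq_pd]
    exact continuous_finsetSum _ fun i _ => continuous_const.mul (h.pd i).cont
  have hcs : HasCompactSupport (fun x => fderiv ℝ φ x z) := h.2.fderiv_apply ℝ z
  obtain ⟨M, hM⟩ := hcs.exists_bound_of_continuous hc
  have hM0 : 0 ≤ M := (norm_nonneg _).trans (hM 0)
  set K : Set (Fin d → ℝ) := Set.image (fun q : (Fin d → ℝ) × ℝ => q.1 - q.2 • z) (tsupport φ ×ˢ Icc (s-1) (s+1)) with hK
  have hKc : IsCompact K := (h.2.isCompact.prod isCompact_Icc).image (by fun_prop)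
  have hKm : MeasurableSet K := hKc.measurableSet
  have hv : LocallyIntegrable v := (Lp.memLp v).locallyIntegrable hP.out
  have main := hasDerivAt_integral_of_dominated_loc_of_deriv_le (μ := volume) (𝕜 := ℝ)
    (F := fun r x => v x * φ (x + r • z)) (F' := fun r x => v x * fderiv ℝ φ (x + r • z) z) (x₀ := s)
    (s := Metric.ball s 1) (bound := K.indicator (fun x => ‖v x‖ * M))
    (Metric.ball_mem_nhds s one_pos)
    (Filter.Eventually.of_forall fun r => (pr_int v (h.shf (r • z))).1)
    (pr_int v (h.shf (s • z)))
    ((Lp.aestronglyMeasurable v).mul (by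
      have : Continuous fun x : Fin d → ℝ => fderiv ℝ φ (x + s • z) z := hc.comp (continuous_id.add continuous_const)
      exact this.aestronglyMeasurable))
    (Filter.Eventually.of_forall fun x r hr => by
      by_cases hx : x ∈ K
      · rw [indicator_of_mem hx, norm_mul]
        exact mul_le_mul_of_nonneg_left (hM _) (norm_nonneg _)
      · have : fderiv ℝ φ (x + r • z) = 0 := by
          by_contra hne
          apply hx
          refine ⟨(x + r • z, r), ⟨?_, ?_⟩, ?_⟩
          · exact support_fderiv_subset ℝ hne
          · rw [Metric.mem_ball, Real.dist_eq, abs_lt] at hr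
            exact ⟨by linarith, by linarith⟩
          · simp
        rw [this, indicator_of_notMem hx]; simp)
    (by
      rw [integrable_indicator_iff hKm]
      exact (hv.integrableOn_isCompact hKc).norm.mul_const M)
    (Filter.Eventually.of_forall fun x r hr => by
      have h1 : HasDerivAt (fun r : ℝ => x + r • z) z r := by
        simpa using ((hasDerivAt_id r).smul_const z).const_add x
      exact ((h.diff (x + r • z)).hasFDerivAt.comp_hasDerivAt r h1).const_mul (v x))
  refine main.2.congr_deriv ?_
  have e : (fun x => v x * fderiv ℝ φ (x + s • z) z) = fun x => ∑ i, z i * (v x * shf (s • z) (pd i φ) x) := by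
    ext x; rw [fderiv_eq_pd, Finset.mul_sum]
    refine Finset.sum_congr rfl fun i _ => ?_
    rw [shf_apply]; ring
  rw [e, integral_finsetSum _ (fun i _ => (pr_int v ((h.pd i).shf _)).const_mul _)]
  simp only [integral_const_mul]; rfl

lemma taylor3 {F0 F1 F2 F3 : ℝ → ℝ} (h0 : ∀ s, HasDerivAt F0 (F1 s) s) (h1 : ∀ s, HasDerivAt F1 (F2 s) s)
    (h2 : ∀ s, HasDerivAt F2 (F3 s) s) {C : ℝ} (hC : ∀ s, |F3 s| ≤ C) :
    |F0 1 - F0 0 - F1 0 - F2 0 / 2| ≤ C := by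
  have hC0 : 0 ≤ C := (abs_nonneg _).trans (hC 0)
  have hm1 : (1:ℝ) ∈ Icc (0:ℝ) 1 := by norm_num
  have b2 : ∀ s ∈ Icc (0:ℝ) 1, ‖F2 s - F2 0‖ ≤ C * s := by
    refine image_norm_le_of_norm_deriv_right_le_deriv_boundary (f' := F3) (B := fun s => C * s) (B' := fun s => C) ?_ ?_ ?_ ?_ ?_
    · exact fun s _ => ((h2 s).sub_const _).continuousAt.continuousWithinAt
    · exact fun s _ => ((h2 s).sub_const _).hasDerivWithinAt
    · simp
    · intro s; simpa using (hasDerivAt_id s).const_mul C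
    · exact fun s _ => hC s
  have b1 : ∀ s ∈ Icc (0:ℝ) 1, ‖F1 s - F1 0 - s * F2 0‖ ≤ C * s := by
    refine image_norm_le_of_norm_deriv_right_le_deriv_boundary (f' := fun s => F2 s - F2 0) (B := fun s => C * s) (B' := fun s => C) ?_ ?_ ?_ ?_ ?_
    · exact fun s _ => (((h1 s).sub_const _).sub (hasDerivAt_mul_const _)).continuousAt.continuousWithinAt
    · exact fun s _ => (((h1 s).sub_const _).sub (hasDerivAt_mul_const _)).hasDerivWithinAt
    · simp
    · intro s; simpa using (hasDerivAt_id s).const_mul C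
    · intro s hs; exact (b2 s ⟨hs.1, hs.2.le⟩).trans (by nlinarith [hs.2])
  have b0 : ∀ s ∈ Icc (0:ℝ) 1, ‖F0 s - F0 0 - s * F1 0 - s^2/2 * F2 0‖ ≤ C * s := by
    have hd : ∀ s, HasDerivAt (fun s => F0 s - F0 0 - s * F1 0 - s^2/2 * F2 0) (F1 s - F1 0 - s * F2 0) s := by
      intro s
      have := (((h0 s).sub_const (F0 0)).sub (hasDerivAt_mul_const (x := s) (F1 0))).sub (((hasDerivAt_pow 2 s).div_const 2).mul_const (F2 0))
      refine this.congr_deriv ?_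
      norm_num
    refine image_norm_le_of_norm_deriv_right_le_deriv_boundary (f' := fun s => F1 s - F1 0 - s * F2 0) (B := fun s => C * s) (B' := fun s => C) ?_ ?_ ?_ ?_ ?_
    · exact fun s _ => (hd s).continuousAt.continuousWithinAt
    · exact fun s _ => (hd s).hasDerivWithinAt
    · simp
    · intro s; simpa using (hasDerivAt_id s).const_mul C
    · intro s hs; exact (b1 s ⟨hs.1, hs.2.le⟩).trans (by nlinarith [hs.2])
  have := b0 1 hm1
  rw [Real.norm_eq_abs] at this
  convert this using 2 <;> ring

/-- third order Taylor expansion of pairing -/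
lemma pr_taylor (v : Lp ℝ P (volume : Measure (Fin d → ℝ))) {φ : (Fin d → ℝ) → ℝ} (h : Tst φ) (z : Fin d → ℝ) {c ρ : ℝ}
    (hc : ∀ i j k, Bd P (pd i (pd j (pd k φ))) c) (hz : ∀ i, |z i| ≤ ρ) :
    |pr v (shf z φ) - pr v φ - (∑ i, z i * pr v (pd i φ)) - (∑ i, ∑ j, z i * z j * pr v (pd i (pd j φ))) / 2| ≤ d^3 * ρ^3 * c * ‖v‖ := by
  have hs0 : ∀ ψ : (Fin d → ℝ) → ℝ, shf ((0:ℝ) • z) ψ = ψ := by intro ψ; ext x; simp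
  have hs1 : ∀ ψ : (Fin d → ℝ) → ℝ, shf ((1:ℝ) • z) ψ = shf z ψ := by intro ψ; simp
  have := taylor3 (F0 := fun s => pr v (shf (s • z) φ)) (F1 := fun s => ∑ j, z j * pr v (shf (s • z) (pd j φ)))
    (F2 := fun s => ∑ j, z j * ∑ i, z i * pr v (shf (s • z) (pd i (pd j φ))))
    (F3 := fun s => ∑ j, z j * ∑ i, z i * ∑ k, z k * pr v (shf (s • z) (pd k (pd i (pd j φ)))))
    (C := d^3 * ρ^3 * c * ‖v‖)
    (fun s => pr_hasDerivAt v h z s)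
    (fun s => HasDerivAt.fun_sum fun j _ => (pr_hasDerivAt v (h.pd j) z s).const_mul _)
    (fun s => HasDerivAt.fun_sum fun j _ => (HasDerivAt.fun_sum fun i _ => (pr_hasDerivAt v ((h.pd j).pd i) z s).const_mul _).const_mul _)
    (by
      intro s
      have hsum : ∀ (b : Fin d → ℝ) (B : ℝ), (∀ i, |b i| ≤ B) → |∑ i, z i * b i| ≤ d * (ρ * B) := by
        intro b B hb
        refine (Finset.abs_sum_le_sum_abs _ _).trans ?_
        have : ∀ i ∈ (Finset.univ : Finset (Fin d)), |z i * b i| ≤ ρ * B := fun i _ => by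
          rw [abs_mul]
          exact mul_le_mul (hz i) (hb i) (abs_nonneg _) ((abs_nonneg _).trans (hz i))
        refine (Finset.sum_le_sum this).trans (le_of_eq ?_)
        simp
      refine (hsum _ _ fun j => hsum _ _ fun i => hsum _ _ fun k => ((hc k i j).shf (s • z)) v).trans (le_of_eq ?_)
      ring)
  simp only [hs0, hs1] at this
  have e : ∑ i, ∑ j, z i * z j * pr v (pd i (pd j φ)) = ∑ j, z j * ∑ i, z i * pr v (pd i (pd j φ)) := by
    rw [Finset.sum_comm]
    refine Finset.sum_congr rfl fun j _ => ?_
    rw [Finset.mul_sum]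
    exact Finset.sum_congr rfl fun i _ => by ring
  rw [e]; exact this

end pairing

/-! Part 8 -/

section moments
open scoped MatrixOrder ComplexOrder Matrix.Norms.L2Operator

lemma psd_decomp {d : ℕ} (S : Fin d → Fin d → ℝ) (hs : ∀ i j, S i j = S j i)
    (hp : ∀ ξ : Fin d → ℝ, 0 ≤ ∑ i, ∑ j, S i j * ξ i * ξ j) :
    ∃ B : Fin d → Fin d → ℝ, ∀ i j, S i j = ∑ l, B l i * B l j := by
  have h : (Matrix.of S).PosSemidef := by
    rw [Matrix.posSemidef_iff_dotProduct_mulVec]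
    refine ⟨?_, fun ξ => ?_⟩
    · ext i j; simp [hs j i]
    · refine (hp ξ).trans (le_of_eq ?_)
      simp only [dotProduct, Matrix.mulVec, Finset.mul_sum, Matrix.of_apply]
      refine Finset.sum_congr rfl fun i _ => Finset.sum_congr rfl fun j _ => ?_
      simp; ring
  obtain ⟨B, hB⟩ := CStarAlgebra.nonneg_iff_eq_star_mul_self.mp h.nonneg
  refine ⟨B, fun i j => ?_⟩
  have := congrFun (congrFun hB i) j
  simpa [Matrix.mul_apply, Matrix.star_apply] using this
end moments

section moments2
variable {d : ℕ}

/-- random walk with prescribed covariance -/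
lemma psd_walk (hd : 0 < d) (S : Fin d → Fin d → ℝ) (hs : ∀ i j, S i j = S j i)
    (hp : ∀ ξ : Fin d → ℝ, 0 ≤ ∑ i, ∑ j, S i j * ξ i * ξ j) :
    ∃ (w : Fin d × Bool → ℝ) (y : Fin d × Bool → Fin d → ℝ), (∀ i, 0 ≤ w i) ∧ ∑ i, w i = 1 ∧
      (∀ a, ∑ i, w i * y i a = 0) ∧ (∀ a b, ∑ i, w i * (y i a * y i b) = 2 * S a b) ∧
      (∀ i a, (y i a)^2 ≤ 2 * d * S a a) := by
  obtain ⟨B, hB⟩ := psd_decomp S hs hp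
  have hd' : (0:ℝ) < d := by exact_mod_cast hd
  set c : ℝ := Real.sqrt (2 * d) with hc
  have hc2 : c * c = 2 * d := Real.mul_self_sqrt (by positivity)
  refine ⟨fun _ => 1/(2*d), fun i a => (if i.2 then c else -c) * B i.1 a, fun _ => by positivity, ?_, ?_, ?_, ?_⟩
  · simp; field_simp
  · intro a
    rw [Fintype.sum_prod_type]
    simp
  · intro a b
    rw [Fintype.sum_prod_type, hB, Finset.mul_sum]
    refine Finset.sum_congr rfl fun l _ => ?_
    have : ∀ x : ℝ, c * x * (c * x) = 2 * d * (x * x) := by intro x; rw [← hc2]; ring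
    simp only [Fintype.sum_bool, if_true, Bool.false_eq_true, if_false]
    have e : 1 / (2 * (d:ℝ)) * (c * B l a * (c * B l b)) + 1 / (2 * (d:ℝ)) * (-c * B l a * (-c * B l b)) = 1/(2*(d:ℝ)) * (c * c) * (2 * (B l a * B l b)) := by ring
    rw [e, hc2]; field_simp
  · rintro ⟨l, b⟩ a
    have : ((if b then c else -c) * B l a)^2 = 2 * d * (B l a * B l a) := by
      rw [← hc2]; cases b <;> simp <;> ring
    simp only [this]
    rw [hB]
    refine mul_le_mul_of_nonneg_left ?_ (by positivity)
    exact Finset.single_le_sum (f := fun l => B l a * B l a) (fun l _ => mul_self_nonneg _) (Finset.mem_univ l)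

variable {P : ℝ≥0∞} [hP : Fact (1 ≤ P)]

/-- one step of the scheme approximates the generator -/
lemma step_taylor {ι : Type*} [Fintype ι] (w : ι → ℝ) (y : ι → Fin d → ℝ) (S : Fin d → Fin d → ℝ)
    (hw : ∀ i, 0 ≤ w i) (hw1 : ∑ i, w i = 1) (hm1 : ∀ a, ∑ i, w i * y i a = 0)
    (hm2 : ∀ a b, ∑ i, w i * (y i a * y i b) = 2 * S a b) (s : Fin d → ℝ) {ρ c : ℝ}
    (hy : ∀ i a, |y i a| ≤ ρ) (hs : ∀ a, |s a| ≤ ρ)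
    (v : Lp ℝ P (volume : Measure (Fin d → ℝ))) {φ : (Fin d → ℝ) → ℝ} (h : Tst φ) 
    (hc : ∀ i j k, Bd P (pd i (pd j (pd k φ))) c) :
    |pr v ((∑ i, w i • shf (y i) : ((Fin d → ℝ) → ℝ) →ₗ[ℝ] ((Fin d → ℝ) → ℝ)) (Pop s φ)) - pr v φ
      - ∑ a, ∑ b, (S a b + s a * s b / 4) * pr v (pd a (pd b φ))| ≤ d^3 * (2*ρ)^3 * c * ‖v‖ := by
  classical
  set E := d^3 * (2*ρ)^3 * c * ‖v‖ with hE
  set M : (Fin d → ℝ) → ℝ := fun z => pr v φ + (∑ i, z i * pr v (pd i φ)) + (∑ i, ∑ j, z i * z j * pr v (pd i (pd j φ))) / 2 with hM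
  have T : ∀ z : Fin d → ℝ, (∀ a, |z a| ≤ 2 * ρ) → |pr v (shf z φ) - M z| ≤ E := by
    intro z hz
    have := pr_taylor v h z hc hz
    refine le_trans (le_of_eq ?_) this
    congr 1; simp only [hM]; ring
  have T3 : ∀ i, |pr v (shf (y i) (Pop s φ)) - (M (y i - s) + 2 * M (y i) + M (y i + s))/4| ≤ E := by
    intro i
    have ρ0 : ∀ a, 0 ≤ ρ := fun a => (abs_nonneg _).trans (hs a)
    have t1 := T (y i - s) (fun a => (abs_sub _ _).trans (by linarith [hy i a, hs a]))
    have t2 := T (y i) (fun a => (hy i a).trans (by linarith [ρ0 a]))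
    have t3 := T (y i + s) (fun a => (abs_add_le _ _).trans (by linarith [hy i a, hs a]))
    have e : shf (y i) (Pop s φ) = (1/4:ℝ) • shf (y i - s) φ + (1/2 : ℝ) • shf (y i) φ + (1/4:ℝ) • shf (y i + s) φ := by
      ext x
      simp only [shf_apply, Pop_apply, Pi.add_apply, Pi.smul_apply, smul_eq_mul]
      rw [← add_sub_assoc, ← add_assoc]; ring
    rw [e, pr_add_right v (((h.shf _).smul _).add ((h.shf _).smul _)) ((h.shf _).smul _), pr_add_right v ((h.shf _).smul _) ((h.shf _).smul _),
      pr_smul_right, pr_smul_right, pr_smul_right]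
    rw [abs_le] at *
    constructor <;> linarith [t1.1, t1.2, t2.1, t2.2, t3.1, t3.2]
  have MM : ∀ z, (M (z - s) + 2 * M z + M (z + s))/4 = M z + ∑ a, ∑ b, s a * s b / 4 * pr v (pd a (pd b φ)) := by
    intro z
    simp only [hM, Pi.sub_apply, Pi.add_apply]
    have e1 : ∑ a, ∑ b, (z a - s a) * (z b - s b) * pr v (pd a (pd b φ)) + ∑ a, ∑ b, (z a + s a) * (z b + s b) * pr v (pd a (pd b φ))
      = 2 * ∑ a, ∑ b, z a * z b * pr v (pd a (pd b φ)) + 8 * ∑ a, ∑ b, s a * s b / 4 * pr v (pd a (pd b φ)) := by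
      simp only [Finset.mul_sum, ← Finset.sum_add_distrib]
      refine Finset.sum_congr rfl fun a _ => Finset.sum_congr rfl fun b _ => ?_
      ring
    have e2 : ∑ a, (z a - s a) * pr v (pd a φ) + ∑ a, (z a + s a) * pr v (pd a φ) = 2 * ∑ a, z a * pr v (pd a φ) := by
      simp only [Finset.mul_sum, ← Finset.sum_add_distrib]
      refine Finset.sum_congr rfl fun a _ => ?_
      ring
    linarith
  have SM : ∑ i, w i * M (y i) = pr v φ + ∑ a, ∑ b, S a b * pr v (pd a (pd b φ)) := by
    simp only [hM, mul_add, Finset.sum_add_distrib]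
    rw [← Finset.sum_mul, hw1, one_mul]
    have e1 : ∑ i, w i * ∑ a, y i a * pr v (pd a φ) = 0 := by
      simp only [Finset.mul_sum]
      rw [Finset.sum_comm]
      refine Finset.sum_eq_zero fun a _ => ?_
      have := hm1 a
      calc ∑ i, w i * (y i a * pr v (pd a φ)) = (∑ i, w i * y i a) * pr v (pd a φ) := by
            rw [Finset.sum_mul]; exact Finset.sum_congr rfl fun i _ => by ring
        _ = 0 := by rw [this, zero_mul]
    have e2 : ∑ i, w i * ((∑ a, ∑ b, y i a * y i b * pr v (pd a (pd b φ))) / 2) = ∑ a, ∑ b, S a b * pr v (pd a (pd b φ)) := by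
      calc ∑ i, w i * ((∑ a, ∑ b, y i a * y i b * pr v (pd a (pd b φ))) / 2) 
          = ∑ i, ∑ a, ∑ b, w i * (y i a * y i b) * (pr v (pd a (pd b φ)) / 2) := by
            refine Finset.sum_congr rfl fun i _ => ?_
            rw [Finset.sum_div, Finset.mul_sum]
            refine Finset.sum_congr rfl fun a _ => ?_
            rw [Finset.sum_div, Finset.mul_sum]
            refine Finset.sum_congr rfl fun b _ => by ring
        _ = ∑ a, ∑ b, ∑ i, w i * (y i a * y i b) * (pr v (pd a (pd b φ)) / 2) := by
            rw [Finset.sum_comm]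
            exact Finset.sum_congr rfl fun a _ => Finset.sum_comm
        _ = _ := by
            refine Finset.sum_congr rfl fun a _ => Finset.sum_congr rfl fun b _ => ?_
            rw [← Finset.sum_mul, hm2]; ring
    rw [e1, e2, add_zero]
  have hP' := h.conv (isConvShf_Pop s)
  rw [LinearMap.sum_apply]
  simp only [LinearMap.smul_apply]
  rw [pr_sum_right _ v (fun i _ => (hP'.shf _).smul _)]
  simp only [pr_smul_right]
  have fin : ∑ i, w i * pr v (shf (y i) (Pop s φ)) - pr v φ - ∑ a, ∑ b, (S a b + s a * s b / 4) * pr v (pd a (pd b φ))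
     = ∑ i, w i * (pr v (shf (y i) (Pop s φ)) - (M (y i - s) + 2 * M (y i) + M (y i + s))/4) := by
    simp only [mul_sub, Finset.sum_sub_distrib, MM, mul_add, Finset.sum_add_distrib, SM, add_mul]
    rw [← Finset.sum_mul, hw1]; ring
  rw [fin]
  refine (Finset.abs_sum_le_sum_abs _ _).trans ?_
  calc ∑ i, |w i * (pr v (shf (y i) (Pop s φ)) - (M (y i - s) + 2 * M (y i) + M (y i + s))/4)| ≤ ∑ i, w i * E := by
        refine Finset.sum_le_sum fun i _ => ?_
        rw [abs_mul, abs_of_nonneg (hw i)]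
        exact mul_le_mul_of_nonneg_left (T3 i) (hw i)
    _ = E := by rw [← Finset.sum_mul, hw1, one_mul]

/-- the difference operator -/
lemma Dop_taylor (s : Fin d → ℝ) {ρ c : ℝ} (hs : ∀ a, |s a| ≤ ρ)
    (v : Lp ℝ P (volume : Measure (Fin d → ℝ))) {φ : (Fin d → ℝ) → ℝ} (h : Tst φ) 
    (hc : ∀ i j k, Bd P (pd i (pd j (pd k φ))) c) :
    |pr v (Dop s φ) + ∑ a, ∑ b, s a * s b / 4 * pr v (pd a (pd b φ))| ≤ d^3 * (2*ρ)^3 * c * ‖v‖ := by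
  have := step_taylor (ι := Unit) (fun _ => 1) (fun _ => 0) (fun _ _ => 0) (by simp) (by simp) (by simp) (by simp) s
    (ρ := ρ) (c := c) (fun _ a => by simpa using (abs_nonneg _).trans (hs a)) hs v h hc
  have e0 : (shf 0 : ((Fin d → ℝ) → ℝ) →ₗ[ℝ] ((Fin d → ℝ) → ℝ)) = LinearMap.id := by ext f x; simp
  simp only [Finset.univ_unique, Finset.sum_singleton, one_smul, e0, LinearMap.id_apply, zero_add] at this
  rw [← abs_neg]
  refine le_trans (le_of_eq ?_) this
  congr 1
  have : Dop s φ = φ - Pop s φ := rfl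
  rw [this, pr_sub_right v h (h.conv (isConvShf_Pop s))]; ring

end moments2

/-! Part 9 -/

section cells
variable {d : ℕ} {P : ℝ≥0∞} [hP : Fact (1 ≤ P)]

structure Hyp (P : ℝ≥0∞) [Fact (1 ≤ P)] (T κ : ℝ) (a : ℝ → Fin d → Fin d → ℝ)
    (f u : ℝ → Lp ℝ P (volume : Measure (Fin d → ℝ))) : Prop where
  hd : 0 < d
  hT : 0 < T
  hκ : 0 < κ
  am : ∀ i j, Measurable fun t => a t i j
  asym : ∀ t ∈ Ioc (0:ℝ) T, ∀ i j, a t i j = a t j i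
  aell : ∀ t ∈ Ioc (0:ℝ) T, ∀ ξ : Fin d → ℝ, κ * (∑ k, ξ k ^ 2) ≤ ∑ i, ∑ j, a t i j * ξ i * ξ j
  aint : IntegrableOn (aMax a) (Ioc (0:ℝ) T)
  fm : AEStronglyMeasurable f (volume.restrict (Ioc (0:ℝ) T))
  fint : IntegrableOn (fun t => ‖f t‖) (Ioc (0:ℝ) T)
  weak : IsWeakSolution P T a 0 f u
  ucont : ContinuousOn u (Icc (0:ℝ) T)
  bd : ∀ φ : (Fin d → ℝ) → ℝ, Tst φ → ∃ c, 0 ≤ c ∧ Bd P φ c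

lemma abs_le_aMax (a : ℝ → Fin d → Fin d → ℝ) (t : ℝ) (i j : Fin d) : |a t i j| ≤ aMax a t := by
  have h1 : |a t i j| ≤ ⨆ j, |a t i j| := le_ciSup (f := fun j => |a t i j|) (Set.finite_range _).bddAbove j
  exact h1.trans (le_ciSup (f := fun i => ⨆ j, |a t i j|) (Set.finite_range _).bddAbove i)

def prL {φ : (Fin d → ℝ) → ℝ} (h : Tst φ) {c : ℝ} (hb : Bd P φ c) : Lp ℝ P (volume : Measure (Fin d → ℝ)) →L[ℝ] ℝ :=
  LinearMap.mkContinuous { toFun := fun v => pr v φ, map_add' := fun v w => pr_add_left v w h, map_smul' := fun c v => pr_smul_left c v φ } c hb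

lemma prL_apply {φ : (Fin d → ℝ) → ℝ} (h : Tst φ) {c : ℝ} (hb : Bd P φ c) (v : Lp ℝ P (volume : Measure (Fin d → ℝ))) : prL h hb v = pr v φ := rfl

variable {T κ : ℝ} {a : ℝ → Fin d → Fin d → ℝ} {f u : ℝ → Lp ℝ P (volume : Measure (Fin d → ℝ))}

namespace Hyp

lemma ai (H : Hyp P T κ a f u) (i j : Fin d) : IntervalIntegrable (fun t => a t i j) volume 0 T := by
  rw [intervalIntegrable_iff_integrableOn_Ioc_of_le H.hT.le]
  refine Integrable.mono H.aint (H.am i j).aestronglyMeasurable (Filter.Eventually.of_forall fun t => ?_)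
  rw [Real.norm_eq_abs]
  exact (abs_le_aMax a t i j).trans (le_abs_self _)

lemma aMi (H : Hyp P T κ a f u) : IntervalIntegrable (aMax a) volume 0 T := by
  rw [intervalIntegrable_iff_integrableOn_Ioc_of_le H.hT.le]; exact H.aint

lemma pru_cont (H : Hyp P T κ a f u) {φ : (Fin d → ℝ) → ℝ} (h : Tst φ) : ContinuousOn (fun r => pr (u r) φ) (Icc 0 T) := by
  obtain ⟨c, _, hb⟩ := H.bd φ h
  exact (prL h hb).continuous.comp_continuousOn H.ucont

lemma api (H : Hyp P T κ a f u) (i j : Fin d) {φ : (Fin d → ℝ) → ℝ} (h : Tst φ) :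
    IntervalIntegrable (fun r => a r i j * pr (u r) φ) volume 0 T := by
  refine (H.ai i j).mul_continuousOn ?_
  rw [uIcc_of_le H.hT.le]; exact H.pru_cont h

lemma fpi (H : Hyp P T κ a f u) {φ : (Fin d → ℝ) → ℝ} (h : Tst φ) :
    IntervalIntegrable (fun r => pr (f r) φ) volume 0 T := by
  obtain ⟨c, hc, hb⟩ := H.bd φ h
  rw [intervalIntegrable_iff_integrableOn_Ioc_of_le H.hT.le]
  refine Integrable.mono (Integrable.const_mul H.fint c) ((prL h hb).continuous.comp_aestronglyMeasurable H.fm) (Filter.Eventually.of_forall fun t => ?_)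
  rw [Real.norm_eq_abs, norm_mul, norm_norm, Real.norm_of_nonneg hc]; exact hb _

lemma sub {F : ℝ → ℝ} (h : IntervalIntegrable F volume 0 T) {s t : ℝ} (hs : 0 ≤ s) (hst : s ≤ t) (ht : t ≤ T) :
    IntervalIntegrable F volume s t :=
  h.mono_set (by rw [uIcc_of_le hst, uIcc_of_le (by linarith)]; exact Icc_subset_Icc hs ht)

lemma incr (H : Hyp P T κ a f u) {φ : (Fin d → ℝ) → ℝ} (h : Tst φ) {s t : ℝ} (hs : 0 ≤ s) (hst : s ≤ t) (ht : t ≤ T) :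
    pr (u t) φ - pr (u s) φ = (∑ i, ∑ j, ∫ r in s..t, a r i j * pr (u r) (pd i (pd j φ))) + ∫ r in s..t, pr (f r) φ := by
  set F : ℝ → ℝ := fun r => (∑ i, ∑ j, a r i j * pr (u r) (pd i (pd j φ))) + pr (f r) φ with hF
  have hsum : IntervalIntegrable (fun r => ∑ i, ∑ j, a r i j * pr (u r) (pd i (pd j φ))) volume 0 T := by
    have := IntervalIntegrable.sum (μ := volume) (a := 0) (b := T) Finset.univ (f := fun i r => ∑ j, a r i j * pr (u r) (pd i (pd j φ))) (fun i _ => by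
      have := IntervalIntegrable.sum (μ := volume) (a := 0) (b := T) Finset.univ (f := fun j r => a r i j * pr (u r) (pd i (pd j φ))) (fun j _ => H.api i j ((h.pd j).pd i))
      refine this.congr ?_
      exact fun r _ => by simp only [Finset.sum_apply])
    refine this.congr ?_
    exact fun r _ => by simp only [Finset.sum_apply]
  have hFi : IntervalIntegrable F volume 0 T := hsum.add (H.fpi h)
  have e : ∀ t ∈ Icc (0:ℝ) T, pr (u t) φ = ∫ r in (0:ℝ)..t, F r := by
    intro t ht
    have := H.weak φ h.1 h.2 t ht
    rw [intervalIntegral.integral_of_le ht.1]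
    have z : ∫ x, (0 : Lp ℝ P (volume : Measure (Fin d → ℝ))) x * φ x = 0 := by
      rw [← integral_zero (Fin d → ℝ) ℝ (μ := volume)]
      refine integral_congr_ae ?_
      filter_upwards [Lp.coeFn_zero ℝ P (volume : Measure (Fin d → ℝ))] with x hx
      rw [hx]; simp
    rw [z, zero_add] at this
    exact this
  rw [e t ⟨by linarith, ht⟩, e s ⟨hs, by linarith⟩,
    intervalIntegral.integral_interval_sub_left (sub hFi le_rfl (by linarith) ht) (sub hFi le_rfl hs (by linarith)), hF,
    intervalIntegral.integral_add (sub hsum hs hst ht) (sub (H.fpi h) hs hst ht)]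
  congr 1
  have e2 : ∀ i, IntervalIntegrable (fun r => ∑ j, a r i j * pr (u r) (pd i (pd j φ))) volume s t := by
    intro i
    have := IntervalIntegrable.sum (μ := volume) (a := s) (b := t) Finset.univ (f := fun j r => a r i j * pr (u r) (pd i (pd j φ))) (fun j _ => sub (H.api i j ((h.pd j).pd i)) hs hst ht)
    refine this.congr ?_
    exact fun r _ => by simp only [Finset.sum_apply]
  rw [intervalIntegral.integral_finsetSum (fun i _ => e2 i)]
  refine Finset.sum_congr rfl fun i _ => ?_
  rw [intervalIntegral.integral_finsetSum (fun j _ => sub (H.api i j ((h.pd j).pd i)) hs hst ht)]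

lemma u0 (H : Hyp P T κ a f u) {φ : (Fin d → ℝ) → ℝ} (h : Tst φ) : pr (u 0) φ = 0 := by
  have := H.weak φ h.1 h.2 0 ⟨le_rfl, H.hT.le⟩
  have z : ∫ x, (0 : Lp ℝ P (volume : Measure (Fin d → ℝ))) x * φ x = 0 := by
    rw [← integral_zero (Fin d → ℝ) ℝ (μ := volume)]
    refine integral_congr_ae ?_
    filter_upwards [Lp.coeFn_zero ℝ P (volume : Measure (Fin d → ℝ))] with x hx
    rw [hx]; simp
  rw [z] at this
  unfold pr
  simpa using this

/-- cell mass -/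
def mass (a : ℝ → Fin d → Fin d → ℝ) (s t : ℝ) : ℝ := (∫ r in s..t, aMax a r) + (t - s)

lemma aM_nonneg (H : Hyp P T κ a f u) (t : ℝ) : 0 ≤ aMax a t :=
  (abs_nonneg _).trans (abs_le_aMax a t ⟨0, H.hd⟩ ⟨0, H.hd⟩)

lemma cell (H : Hyp P T κ a f u) {s t : ℝ} (hs : 0 ≤ s) (hst : s ≤ t) (ht : t ≤ T) (e : Fin d → ℝ) (he : ∑ k, e k ^ 2 ≤ 4) :
    ∃ R : ((Fin d → ℝ) → ℝ) →ₗ[ℝ] ((Fin d → ℝ) → ℝ), IsConvShf R ∧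
      ∀ (Ψ : (Fin d → ℝ) → ℝ) (c ε : ℝ), Tst Ψ → (∀ i j k, Bd P (pd i (pd j (pd k Ψ))) c) → (∀ i j, Bd P (pd i (pd j Ψ)) c) →
        0 ≤ c → (∀ r ∈ Icc s t, ‖u r - u s‖ ≤ ε) →
        |pr (u t) Ψ - pr (u s) (R (Pop (Real.sqrt (κ * (t - s)) • e) Ψ)) - ∫ r in s..t, pr (f r) Ψ| ≤
          d^3 * (2 * Real.sqrt ((2 * d + 4 * κ) * mass a s t))^3 * c * ‖u s‖ + d^2 * c * ε * mass a s t := by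
  have hκ := H.hκ
  set h : ℝ := Real.sqrt (κ * (t - s)) with hh
  have hh2 : h * h = κ * (t - s) := Real.mul_self_sqrt (mul_nonneg hκ.le (by linarith))
  set S : Fin d → Fin d → ℝ := fun i j => (∫ r in s..t, a r i j) - κ/4 * (t - s) * (e i * e j) with hS
  have hmem : ∀ r ∈ Ioc s t, r ∈ Ioc (0:ℝ) T := fun r hr => ⟨by linarith [hr.1], by linarith [hr.2]⟩
  have hai : ∀ i j, IntervalIntegrable (fun r => a r i j) volume s t := fun i j => sub (H.ai i j) hs hst ht
  have hM0 : 0 ≤ ∫ r in s..t, aMax a r := intervalIntegral.integral_nonneg hst fun r _ => H.aM_nonneg r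
  have hm0 : 0 ≤ mass a s t := by unfold mass; linarith
  have hS_sym : ∀ i j, S i j = S j i := by
    intro i j
    simp only [hS]
    rw [mul_comm (e i) (e j)]
    congr 1
    refine intervalIntegral.integral_congr_ae (Filter.Eventually.of_forall fun r hr => ?_)
    rw [uIoc_of_le hst] at hr
    exact H.asym r (hmem r hr) i j
  have hS_pos : ∀ ξ : Fin d → ℝ, 0 ≤ ∑ i, ∑ j, S i j * ξ i * ξ j := by
    intro ξ
    have e1 : ∑ i, ∑ j, S i j * ξ i * ξ j = (∫ r in s..t, ∑ i, ∑ j, a r i j * ξ i * ξ j) - κ/4 * (t - s) * (∑ i, e i * ξ i)^2 := by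
      rw [intervalIntegral.integral_finsetSum (fun i _ => ?_)]
      · rw [pow_two, Finset.sum_mul_sum, Finset.mul_sum, ← Finset.sum_sub_distrib]
        refine Finset.sum_congr rfl fun i _ => ?_
        rw [intervalIntegral.integral_finsetSum (fun j _ => ((hai i j).mul_const _).mul_const _), Finset.mul_sum, ← Finset.sum_sub_distrib]
        refine Finset.sum_congr rfl fun j _ => ?_
        rw [intervalIntegral.integral_mul_const, intervalIntegral.integral_mul_const]
        simp only [hS]; ring
      · have := IntervalIntegrable.sum (μ := volume) (a := s) (b := t) Finset.univ (f := fun j r => a r i j * ξ i * ξ j) (fun j _ => ((hai i j).mul_const _).mul_const _)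
        refine this.congr ?_
        exact fun r _ => by simp only [Finset.sum_apply]
    have e2 : κ * (∑ k, ξ k^2) * (t - s) ≤ ∫ r in s..t, ∑ i, ∑ j, a r i j * ξ i * ξ j := by
      have hi : IntervalIntegrable (fun r => ∑ i, ∑ j, a r i j * ξ i * ξ j) volume s t := by
        have := IntervalIntegrable.sum (μ := volume) (a := s) (b := t) Finset.univ (f := fun i r => ∑ j, a r i j * ξ i * ξ j) (fun i _ => by
          have := IntervalIntegrable.sum (μ := volume) (a := s) (b := t) Finset.univ (f := fun j r => a r i j * ξ i * ξ j) (fun j _ => ((hai i j).mul_const _).mul_const _)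
          refine this.congr ?_
          exact fun r _ => by simp only [Finset.sum_apply])
        refine this.congr ?_
        exact fun r _ => by simp only [Finset.sum_apply]
      have := intervalIntegral.integral_mono_on_of_le_Ioo (μ := volume) hst (f := fun _ => κ * (∑ k, ξ k^2)) (intervalIntegrable_const) hi
        (fun r hr => H.aell r (hmem r ⟨hr.1, hr.2.le⟩) ξ)
      rw [intervalIntegral.integral_const, smul_eq_mul] at this
      linarith
    have e3 : (∑ i, e i * ξ i)^2 ≤ 4 * ∑ k, ξ k^2 := by
      refine (Finset.sum_mul_sq_le_sq_mul_sq Finset.univ e ξ).trans ?_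
      exact mul_le_mul_of_nonneg_right he (Finset.sum_nonneg fun k _ => sq_nonneg _)
    rw [e1]
    have : κ/4 * (t-s) * (∑ i, e i * ξ i)^2 ≤ κ/4 * (t-s) * (4 * ∑ k, ξ k^2) :=
      mul_le_mul_of_nonneg_left e3 (mul_nonneg (by linarith) (by linarith))
    linarith
  obtain ⟨w, y, hw, hw1, hm1, hm2, hy⟩ := psd_walk H.hd S hS_sym hS_pos
  refine ⟨∑ i, w i • shf (y i), isConvShf_of_fintype w y hw hw1, ?_⟩
  intro Ψ c ε hΨ hc3 hc2 hc0 hosc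
  have hd0 : (0:ℝ) ≤ d := Nat.cast_nonneg _
  have aij_le : ∀ i j, ∫ r in s..t, |a r i j| ≤ ∫ r in s..t, aMax a r := fun i j =>
    intervalIntegral.integral_mono_on hst (hai i j).norm (sub H.aMi hs hst ht) (fun r _ => abs_le_aMax a r i j)
  have Saa : ∀ b, S b b ≤ mass a s t := by
    intro b
    have h1 : ∫ r in s..t, a r b b ≤ ∫ r in s..t, aMax a r :=
      intervalIntegral.integral_mono_on hst (hai b b) (sub H.aMi hs hst ht) (fun r _ => (le_abs_self _).trans (abs_le_aMax a r b b))
    have h2 : 0 ≤ κ/4 * (t - s) * (e b * e b) := mul_nonneg (mul_nonneg (by linarith) (by linarith)) (mul_self_nonneg _)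
    simp only [hS, mass]; linarith
  have hyb : ∀ i b, |y i b| ≤ Real.sqrt ((2 * d + 4 * κ) * mass a s t) := by
    intro i b
    refine Real.abs_le_sqrt ((hy i b).trans ?_)
    have : 2 * d * S b b ≤ 2 * d * mass a s t := mul_le_mul_of_nonneg_left (Saa b) (by positivity)
    nlinarith [mul_nonneg hκ.le hm0]
  have hsb : ∀ b, |(h • e) b| ≤ Real.sqrt ((2 * d + 4 * κ) * mass a s t) := by
    intro b
    refine Real.abs_le_sqrt ?_
    have h1 : e b ^ 2 ≤ 4 := (Finset.single_le_sum (f := fun k => e k ^2) (fun k _ => sq_nonneg _) (Finset.mem_univ b)).trans he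
    have h2 : ((h • e) b)^2 = κ * (t - s) * e b ^2 := by rw [← hh2]; simp; ring
    rw [h2]
    have h3 : κ * (t-s) * e b^2 ≤ κ * (t-s) * 4 := mul_le_mul_of_nonneg_left h1 (mul_nonneg hκ.le (by linarith))
    have h4 : κ * (t - s) ≤ κ * mass a s t := mul_le_mul_of_nonneg_left (by unfold mass; linarith) hκ.le
    nlinarith [mul_nonneg hd0 hm0]
  have tay := step_taylor w y S hw hw1 hm1 hm2 (h • e) hyb hsb (u s) hΨ hc3
  have eS : ∀ i j, S i j + (h • e) i * (h • e) j / 4 = ∫ r in s..t, a r i j := by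
    intro i j
    have : (h • e) i * (h • e) j = (h * h) * (e i * e j) := by simp; ring
    rw [this, hh2]; simp only [hS]; ring
  simp only [eS] at tay
  have inc := H.incr hΨ hs hst ht
  have osc : |(∑ i, ∑ j, ∫ r in s..t, a r i j * pr (u r) (pd i (pd j Ψ))) - ∑ i, ∑ j, (∫ r in s..t, a r i j) * pr (u s) (pd i (pd j Ψ))| ≤ d^2 * c * ε * mass a s t := by
    have hε : 0 ≤ ε := (norm_nonneg _).trans (hosc s ⟨le_rfl, hst⟩)
    simp only [← Finset.sum_sub_distrib]
    have each : ∀ i j, |(∫ r in s..t, a r i j * pr (u r) (pd i (pd j Ψ))) - (∫ r in s..t, a r i j) * pr (u s) (pd i (pd j Ψ))| ≤ c * ε * mass a s t := by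
      intro i j
      rw [← intervalIntegral.integral_mul_const, ← intervalIntegral.integral_sub (sub (H.api i j ((hΨ.pd j).pd i)) hs hst ht) ((hai i j).mul_const _), ← Real.norm_eq_abs]
      have := intervalIntegral.norm_integral_le_of_norm_le (μ := volume) hst (f := fun r => a r i j * pr (u r) (pd i (pd j Ψ)) - a r i j * pr (u s) (pd i (pd j Ψ))) (g := fun r => |a r i j| * (c * ε))
        (Filter.Eventually.of_forall fun r hr => by
          have e1 : pr (u r) (pd i (pd j Ψ)) - pr (u s) (pd i (pd j Ψ)) = pr (u r - u s) (pd i (pd j Ψ)) := by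
            have := (prL ((hΨ.pd j).pd i) (hc2 i j)).map_sub (u r) (u s)
            simpa only [prL_apply] using this.symm
          rw [← mul_sub, norm_mul, e1, Real.norm_eq_abs, Real.norm_eq_abs]
          refine mul_le_mul_of_nonneg_left ((hc2 i j _).trans ?_) (abs_nonneg _)
          exact mul_le_mul_of_nonneg_left (hosc r ⟨hr.1.le, hr.2⟩) hc0)
        ((hai i j).norm.mul_const _)
      refine this.trans ?_
      rw [intervalIntegral.integral_mul_const, mul_comm]
      refine mul_le_mul_of_nonneg_left ((aij_le i j).trans ?_) (mul_nonneg hc0 hε)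
      unfold mass; linarith
    refine (Finset.abs_sum_le_sum_abs _ _).trans ((Finset.sum_le_sum fun i _ => (Finset.abs_sum_le_sum_abs _ _).trans (Finset.sum_le_sum fun j _ => each i j)).trans (le_of_eq ?_))
    simp; ring
  rw [abs_le] at *
  constructor <;> linarith [tay.1, tay.2, osc.1, osc.2]

end Hyp
end cells

/-! Part 10 -/

section analysis

lemma mesh_pt {T : ℝ} (hT : 0 < T) {N n : ℕ} (hn : n ≤ N) (hN : 0 < N) : (n:ℝ) * (T/N) ∈ Icc (0:ℝ) T := by
  have hN' : (0:ℝ) < N := by exact_mod_cast hN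
  have hn' : (n:ℝ) ≤ N := by exact_mod_cast hn
  refine ⟨by positivity, ?_⟩
  calc (n:ℝ) * (T/N) ≤ N * (T/N) := by gcongr
    _ = T := by field_simp

lemma mesh {Z : Type*} [PseudoMetricSpace Z] {T : ℝ} (hT : 0 < T) {F : ℝ → Z} (hF : ContinuousOn F (Icc 0 T)) {ε : ℝ} (hε : 0 < ε) :
    ∀ᶠ N : ℕ in Filter.atTop, 0 < N ∧ ∀ n < N, ∀ r ∈ Icc ((n:ℝ) * (T/N)) (((n+1 : ℕ):ℝ) * (T/N)), dist (F r) (F ((n:ℝ) * (T/N))) ≤ ε := by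
  have uc := isCompact_Icc.uniformContinuousOn_of_continuous hF
  rw [Metric.uniformContinuousOn_iff] at uc
  obtain ⟨δ, hδ, h⟩ := uc ε hε
  obtain ⟨N0, hN0⟩ := exists_nat_gt (T/δ)
  filter_upwards [Filter.eventually_gt_atTop N0] with N hN
  have hN1 : 0 < N := by lia
  have hN' : (0:ℝ) < N := by exact_mod_cast hN1
  refine ⟨hN1, fun n hn r hr => ?_⟩
  have hsmall : T/N < δ := by
    rw [div_lt_iff₀ hN']
    have : (N0:ℝ) < N := by exact_mod_cast hN
    rw [div_lt_iff₀ hδ] at hN0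
    nlinarith
  have p1 := mesh_pt hT hn.le hN1
  have p2 := mesh_pt hT (show n+1 ≤ N from hn) hN1
  refine (h r ⟨p1.1.trans hr.1, hr.2.trans p2.2⟩ _ p1 ?_).le
  rw [Real.dist_eq, abs_of_nonneg (by linarith [hr.1])]
  have := hr.2
  push_cast at this
  linarith

lemma cells_sum {T : ℝ} (hT : 0 < T) {N : ℕ} (hN : 0 < N) {F : ℝ → ℝ} (hF : IntervalIntegrable F volume 0 T) :
    ∑ n ∈ Finset.range N, ∫ r in ((n:ℝ) * (T/N))..(((n+1 : ℕ):ℝ) * (T/N)), F r = ∫ r in (0:ℝ)..T, F r := by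
  have hN' : (0:ℝ) < N := by exact_mod_cast hN
  have := intervalIntegral.sum_integral_adjacent_intervals (μ := volume) (f := F) (a := fun n : ℕ => (n:ℝ) * (T/N)) (n := N)
    (fun k hk => by
      refine Hyp.sub hF (mesh_pt hT hk.le hN).1 ?_ (mesh_pt hT hk hN).2
      push_cast
      have : 0 ≤ T/N := by positivity
      linarith)
  rw [this]
  congr 1
  · simp
  · field_simp

lemma riemann {T : ℝ} (hT : 0 < T) {F : ℝ → ℝ} (hF : ContinuousOn F (Icc 0 T)) :
    Filter.Tendsto (fun N : ℕ => (T/N) * ∑ n ∈ Finset.range N, F ((n:ℝ) * (T/N))) Filter.atTop (nhds (∫ r in (0:ℝ)..T, F r)) := by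
  have hFi : IntervalIntegrable F volume 0 T := by
    apply ContinuousOn.intervalIntegrable; rwa [uIcc_of_le hT.le]
  rw [Metric.tendsto_atTop']
  intro ε hε
  obtain ⟨N0, hN0⟩ := Filter.eventually_atTop.mp (mesh hT hF (ε := ε/(2*T)) (by positivity))
  refine ⟨N0, fun N hN => ?_⟩
  obtain ⟨hN1, h⟩ := hN0 N hN.le
  have hN' : (0:ℝ) < N := by exact_mod_cast hN1
  rw [← cells_sum hT hN1 hFi, Finset.mul_sum, Real.dist_eq, ← Finset.sum_sub_distrib]
  refine lt_of_le_of_lt (Finset.abs_sum_le_sum_abs _ _) ?_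
  have each : ∀ n ∈ Finset.range N, |T/N * F ((n:ℝ) * (T/N)) - ∫ r in ((n:ℝ) * (T/N))..(((n+1 : ℕ):ℝ) * (T/N)), F r| ≤ ε/(2*T) * (T/N) := by
    intro n hn
    have hn := Finset.mem_range.mp hn
    have hle : (n:ℝ) * (T/N) ≤ ((n+1 : ℕ):ℝ) * (T/N) := by
      push_cast
      have : 0 ≤ T/N := by positivity
      linarith
    have hlen : ((n+1 : ℕ):ℝ) * (T/N) - (n:ℝ) * (T/N) = T/N := by push_cast; ring
    have hi := Hyp.sub hFi (mesh_pt hT hn.le hN1).1 hle (mesh_pt hT hn hN1).2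
    have e : T/N * F ((n:ℝ) * (T/N)) = ∫ r in ((n:ℝ) * (T/N))..(((n+1 : ℕ):ℝ) * (T/N)), F ((n:ℝ) * (T/N)) := by
      rw [intervalIntegral.integral_const, hlen, smul_eq_mul]
    rw [e, abs_sub_comm, ← intervalIntegral.integral_sub hi intervalIntegrable_const, ← Real.norm_eq_abs]
    refine (intervalIntegral.norm_integral_le_of_norm_le_const (C := ε/(2*T)) ?_).trans ?_
    · intro r hr
      rw [uIoc_of_le hle] at hr
      have := h n hn r ⟨hr.1.le, hr.2⟩
      rwa [dist_eq_norm] at this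
    · rw [hlen, abs_of_nonneg (by positivity)]
  refine lt_of_le_of_lt (Finset.sum_le_sum each) ?_
  rw [Finset.sum_const, Finset.card_range, nsmul_eq_mul]
  have : (N:ℝ) * (ε/(2*T) * (T/N)) = ε/2 := by field_simp
  rw [this]; linarith

end analysis

section TFs
variable {d : ℕ}

/-- `q`-energy -/
def AA (q : ℝ) (φ : (Fin d → ℝ) → ℝ) : ℝ := (∫⁻ x, ‖φ x‖ₑ^q).toReal

lemma Tst.fin {φ : (Fin d → ℝ) → ℝ} (h : Tst φ) {q : ℝ} (hq : 0 < q) : ∫⁻ x, ‖φ x‖ₑ^q < ⊤ := by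
  have := (h.cont.memLp_of_hasCompactSupport (p := ENNReal.ofReal q) (μ := volume) h.2).2
  have h2 := lintegral_rpow_enorm_lt_top_of_eLpNorm_lt_top (by simpa using hq) ENNReal.ofReal_ne_top this
  rwa [ENNReal.toReal_ofReal hq.le] at h2

lemma AA_nonneg (q : ℝ) (φ : (Fin d → ℝ) → ℝ) : 0 ≤ AA q φ := ENNReal.toReal_nonneg

lemma pr_holder {p q : ℝ} (hpq : p.HolderConjugate q) [Fact (1 ≤ ENNReal.ofReal p)]
    (v : Lp ℝ (ENNReal.ofReal p) (volume : Measure (Fin d → ℝ))) {φ : (Fin d → ℝ) → ℝ} (h : Tst φ) :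
    |pr v φ| ≤ (AA q φ)^(1/q) * ‖v‖ := by
  have hp := hpq.pos
  have hq := hpq.symm.pos
  have h1 : ‖pr v φ‖ₑ ≤ ‖v‖ₑ * (∫⁻ x, ‖φ x‖ₑ^q)^(1/q) := by
    refine (enorm_integral_le_lintegral_enorm _).trans ?_
    simp only [enorm_mul]
    refine (ENNReal.lintegral_mul_le_Lp_mul_Lq volume hpq (f := fun x => ‖v x‖ₑ) (g := fun x => ‖φ x‖ₑ) (Lp.aestronglyMeasurable v).enorm h.cont.aestronglyMeasurable.enorm).trans ?_
    rw [Lp.enorm_def, eLpNorm_eq_lintegral_rpow_enorm_toReal (by simpa using hp) ENNReal.ofReal_ne_top, ENNReal.toReal_ofReal hp.le]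
  have h2 : ‖v‖ₑ * (∫⁻ x, ‖φ x‖ₑ^q)^(1/q) = ENNReal.ofReal ((AA q φ)^(1/q) * ‖v‖) := by
    rw [mul_comm, ENNReal.ofReal_mul (Real.rpow_nonneg (AA_nonneg _ _) _), ← ENNReal.ofReal_rpow_of_nonneg (AA_nonneg _ _) (by positivity), AA,
      ENNReal.ofReal_toReal (h.fin hq).ne, ofReal_norm]
  rw [h2, ← ofReal_norm, Real.norm_eq_abs] at h1
  exact (ENNReal.ofReal_le_ofReal_iff (mul_nonneg (Real.rpow_nonneg (AA_nonneg _ _) _) (norm_nonneg _))).mp h1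

lemma Tst.bd {p q : ℝ} (hpq : p.HolderConjugate q) [Fact (1 ≤ ENNReal.ofReal p)] {φ : (Fin d → ℝ) → ℝ} (h : Tst φ) :
    ∃ c, 0 ≤ c ∧ Bd (ENNReal.ofReal p) φ c :=
  ⟨(AA q φ)^(1/q), Real.rpow_nonneg (AA_nonneg _ _) _, fun v => pr_holder hpq v h⟩

def TF (G : ℝ → (Fin d → ℝ) → ℝ) : Prop := ∃ (K : ℕ) (η : Fin K → ℝ → ℝ) (φ : Fin K → (Fin d → ℝ) → ℝ),
  (∀ k, Continuous (η k)) ∧ (∀ k, Tst (φ k)) ∧ ∀ t, G t = ∑ k, η k t • φ k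

lemma TF.tst {G : ℝ → (Fin d → ℝ) → ℝ} (h : TF G) (t : ℝ) : Tst (G t) := by
  obtain ⟨K, η, φ, _, h2, h3⟩ := h
  rw [h3]; exact Tst.sum _ fun k _ => (h2 k).smul _

lemma TF.pd {G : ℝ → (Fin d → ℝ) → ℝ} (h : TF G) (i : Fin d) : TF (fun t => _root_.pd i (G t)) := by
  obtain ⟨K, η, φ, h1, h2, h3⟩ := h
  refine ⟨K, η, fun k => _root_.pd i (φ k), h1, fun k => (h2 k).pd i, fun t => ?_⟩
  show _root_.pd i (G t) = ∑ k, η k t • _root_.pd i (φ k)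
  rw [h3, pd_sum _ _ fun k _ => (h2 k).smul _]
  exact Finset.sum_congr rfl fun k _ => pd_smul _ _ (h2 k)

lemma TF.AA_cont {G : ℝ → (Fin d → ℝ) → ℝ} (h : TF G) {q : ℝ} (hq : 0 < q) : Continuous (fun t => AA q (G t)) := by
  have hT := h.tst
  obtain ⟨K, η, φ, h1, h2, h3⟩ := h
  set s : Set (Fin d → ℝ) := ⋃ k, tsupport (φ k) with hs
  have hsc : IsCompact s := isCompact_iUnion fun k => (h2 k).2
  have e : ∀ t, AA q (G t) = ∫ x in s, |G t x|^q := by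
    intro t
    have e1 : ∫ x in s, |G t x|^q = ∫ x, |G t x|^q := by
      refine setIntegral_eq_integral_of_forall_compl_eq_zero fun x hx => ?_
      have : G t x = 0 := by
        rw [h3, Finset.sum_apply]
        refine Finset.sum_eq_zero fun k _ => ?_
        have : x ∉ tsupport (φ k) := fun hk => hx (mem_iUnion.mpr ⟨k, hk⟩)
        rw [Pi.smul_apply, image_eq_zero_of_notMem_tsupport this, smul_zero]
      rw [this, abs_zero, Real.zero_rpow hq.ne']
    rw [e1, AA, integral_eq_lintegral_of_nonneg_ae (Filter.Eventually.of_forall fun x => by positivity)]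
    · congr 1
      refine lintegral_congr fun x => ?_
      rw [← ENNReal.ofReal_rpow_of_nonneg (abs_nonneg _) hq.le, ← Real.norm_eq_abs, ofReal_norm]
    · exact ((hT t).cont.abs.rpow_const (fun _ => Or.inr hq.le)).aestronglyMeasurable
  simp only [e]
  refine continuous_parametric_integral_of_continuous ?_ hsc
  have : Function.uncurry (fun t x => |G t x|^q) = fun z : ℝ × (Fin d → ℝ) => |∑ k, η k z.1 * φ k z.2|^q := by
    ext z; simp [Function.uncurry, h3, Finset.sum_apply]
  rw [this]
  refine Continuous.rpow_const (Continuous.abs (continuous_finsetSum _ fun k _ => ?_)) (fun _ => Or.inr hq.le)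
  exact ((h1 k).comp continuous_fst).mul ((h2 k).cont.comp continuous_snd)

variable {P : ℝ≥0∞} [hP : Fact (1 ≤ P)]

lemma TF.bd {G : ℝ → (Fin d → ℝ) → ℝ} (h : TF G) (T : ℝ) (hb : ∀ φ : (Fin d → ℝ) → ℝ, Tst φ → ∃ c, 0 ≤ c ∧ Bd P φ c) :
    ∃ c, 0 ≤ c ∧ ∀ t ∈ Icc 0 T, Bd P (G t) c := by
  obtain ⟨K, η, φ, h1, h2, h3⟩ := h
  choose c hc0 hc using fun k => hb (φ k) (h2 k)
  have : ∀ k, ∃ M, ∀ t ∈ Icc 0 T, |η k t| ≤ M := fun k => isCompact_Icc.exists_bound_of_continuousOn (h1 k).continuousOn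
  choose M hM using this
  refine ⟨∑ k, |M k| * c k, Finset.sum_nonneg fun k _ => mul_nonneg (abs_nonneg _) (hc0 k), fun t ht => ?_⟩
  rw [h3]
  refine Bd.sum _ (fun k _ => ((hc k).smul (η k t)).mono ?_) (fun k _ => (h2 k).smul _)
  exact mul_le_mul_of_nonneg_right ((hM k t ht).trans (le_abs_self _)) (hc0 k)

lemma unif {ι : Type*} [Fintype ι] (Q : ι → ℝ → Prop) (hm : ∀ i c c', c ≤ c' → Q i c → Q i c') (h : ∀ i, ∃ c, 0 ≤ c ∧ Q i c) :
    ∃ c, 0 ≤ c ∧ ∀ i, Q i c := by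
  choose c h0 hc using h
  exact ⟨∑ i, c i, Finset.sum_nonneg fun i _ => h0 i, fun i => hm i _ _ (Finset.single_le_sum (fun j _ => h0 j) (Finset.mem_univ i)) (hc i)⟩

lemma TF.Dbd {G : ℝ → (Fin d → ℝ) → ℝ} (h : TF G) (T : ℝ) (hb : ∀ φ : (Fin d → ℝ) → ℝ, Tst φ → ∃ c, 0 ≤ c ∧ Bd P φ c) :
    ∃ c, 0 ≤ c ∧ ∀ t ∈ Icc 0 T, ∀ (s : Fin d → ℝ) (ρ : ℝ), (∀ a, |s a| ≤ ρ) → 0 ≤ ρ → ρ ≤ 1 → Bd P (Dop s (G t)) (c * ρ^2) := by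
  obtain ⟨c2, h20, h2⟩ : ∃ c, 0 ≤ c ∧ ∀ ij : Fin d × Fin d, ∀ t ∈ Icc 0 T, Bd P (_root_.pd ij.1 (_root_.pd ij.2 (G t))) c :=
    unif _ (fun i c c' hc h t ht => (h t ht).mono hc) (fun ij => ((h.pd ij.2).pd ij.1).bd T hb)
  obtain ⟨c3, h30, h3⟩ : ∃ c, 0 ≤ c ∧ ∀ ij : Fin d × Fin d × Fin d, ∀ t ∈ Icc 0 T, Bd P (_root_.pd ij.1 (_root_.pd ij.2.1 (_root_.pd ij.2.2 (G t)))) c :=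
    unif _ (fun i c c' hc h t ht => (h t ht).mono hc) (fun ij => (((h.pd ij.2.2).pd ij.2.1).pd ij.1).bd T hb)
  refine ⟨d^2 * c2 + 8 * d^3 * c3, by positivity, fun t ht s ρ hs hρ hρ1 v => ?_⟩
  have t3 := Dop_taylor s hs v (h.tst t) (fun i j k => h3 (i, j, k) t ht)
  have t2 : |∑ a, ∑ b, s a * s b / 4 * pr v (_root_.pd a (_root_.pd b (G t)))| ≤ d^2 * (ρ^2 * (c2 * ‖v‖)) := by
    have each : ∀ a b, |s a * s b / 4 * pr v (_root_.pd a (_root_.pd b (G t)))| ≤ ρ^2 * (c2 * ‖v‖) := by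
      intro a b
      rw [abs_mul]
      refine mul_le_mul ?_ (h2 (a, b) t ht v) (abs_nonneg _) (by positivity)
      rw [abs_div, abs_mul]
      have : |s a| * |s b| ≤ ρ * ρ := mul_le_mul (hs a) (hs b) (abs_nonneg _) hρ
      rw [abs_of_pos (by norm_num : (0:ℝ) < 4)]
      nlinarith [mul_nonneg hρ hρ]
    refine (Finset.abs_sum_le_sum_abs _ _).trans ((Finset.sum_le_sum fun i _ => (Finset.abs_sum_le_sum_abs _ _).trans (Finset.sum_le_sum fun j _ => each i j)).trans (le_of_eq ?_))
    simp; ring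
  have e3 : d^3 * (2*ρ)^3 * c3 * ‖v‖ ≤ 8 * d^3 * c3 * ρ^2 * ‖v‖ := by
    have : ρ^3 ≤ ρ^2 := by nlinarith [sq_nonneg ρ]
    calc d^3 * (2*ρ)^3 * c3 * ‖v‖ = 8 * d^3 * c3 * ρ^3 * ‖v‖ := by ring
      _ ≤ _ := by gcongr
  have := abs_le.mp t3
  have := abs_le.mp t2
  rw [abs_le]
  constructor <;> nlinarith

lemma TF.sch {G : ℝ → (Fin d → ℝ) → ℝ} (h : TF G) (T : ℝ) (hb : ∀ φ : (Fin d → ℝ) → ℝ, Tst φ → ∃ c, 0 ≤ c ∧ Bd P φ c) :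
    ∃ c, 0 ≤ c ∧ ∀ (R : ℕ → ((Fin d → ℝ) → ℝ) →ₗ[ℝ] ((Fin d → ℝ) → ℝ)) (s : Fin d → ℝ) (ρ : ℝ) (τ : ℕ → ℝ) (n : ℕ),
      (∀ n, IsConvShf (R n)) → (∀ n, τ n ∈ Icc 0 T) → (∀ a, |s a| ≤ ρ) → 0 ≤ ρ → ρ ≤ 1 →
        Bd P (_root_.sch R s (fun m => G (τ m)) n) (n * (c * ρ^2)) := by
  obtain ⟨c, h0, hc⟩ := h.Dbd T hb
  exact ⟨c, h0, fun R s ρ τ n hR hτ hs h1 h2 => Bd.sch hR (fun m => h.tst _) (fun m => hc _ (hτ m) s ρ hs h1 h2) n⟩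

lemma TF.sch23 {G : ℝ → (Fin d → ℝ) → ℝ} (h : TF G) (T : ℝ) (hb : ∀ φ : (Fin d → ℝ) → ℝ, Tst φ → ∃ c, 0 ≤ c ∧ Bd P φ c) :
    ∃ c, 0 ≤ c ∧ ∀ (R : ℕ → ((Fin d → ℝ) → ℝ) →ₗ[ℝ] ((Fin d → ℝ) → ℝ)) (s : Fin d → ℝ) (ρ : ℝ) (τ : ℕ → ℝ) (n : ℕ),
      (∀ n, IsConvShf (R n)) → (∀ n, τ n ∈ Icc 0 T) → (∀ a, |s a| ≤ ρ) → 0 ≤ ρ → ρ ≤ 1 →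
        (∀ i j k, Bd P (_root_.pd i (_root_.pd j (_root_.pd k (_root_.sch R s (fun m => G (τ m)) n)))) (n * (c * ρ^2))) ∧
        (∀ i j, Bd P (_root_.pd i (_root_.pd j (_root_.sch R s (fun m => G (τ m)) n))) (n * (c * ρ^2))) := by
  have mono : ∀ (n : ℕ) (ρ c c' : ℝ), c ≤ c' → (n:ℝ) * (c * ρ^2) ≤ n * (c' * ρ^2) := fun n ρ c c' hc => by gcongr
  obtain ⟨c2, h20, h2⟩ := unif _ (fun i c c' hc h R s ρ τ n a1 a2 a3 a4 a5 => (h R s ρ τ n a1 a2 a3 a4 a5).mono (mono n ρ c c' hc))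
    (fun ij : Fin d × Fin d => ((h.pd ij.2).pd ij.1).sch T hb)
  obtain ⟨c3, h30, h3⟩ := unif _ (fun i c c' hc h R s ρ τ n a1 a2 a3 a4 a5 => (h R s ρ τ n a1 a2 a3 a4 a5).mono (mono n ρ c c' hc))
    (fun ij : Fin d × Fin d × Fin d => (((h.pd ij.2.2).pd ij.2.1).pd ij.1).sch T hb)
  refine ⟨c2 + c3, by positivity, fun R s ρ τ n a1 a2 a3 a4 a5 => ⟨fun i j k => ?_, fun i j => ?_⟩⟩
  · rw [pd_sch a1 s (fun m => h.tst _), pd_sch a1 s (fun m => (h.pd k).tst _), pd_sch a1 s (fun m => ((h.pd k).pd j).tst _)]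
    exact (h3 (i, j, k) R s ρ τ n a1 a2 a3 a4 a5).mono (mono n ρ _ _ (by linarith))
  · rw [pd_sch a1 s (fun m => h.tst _), pd_sch a1 s (fun m => (h.pd j).tst _)]
    exact (h2 (i, j) R s ρ τ n a1 a2 a3 a4 a5).mono (mono n ρ _ _ (by linarith))

lemma TF.pru_cont {T κ : ℝ} {a : ℝ → Fin d → Fin d → ℝ} {f u : ℝ → Lp ℝ P (volume : Measure (Fin d → ℝ))}
    (H : Hyp P T κ a f u) {G : ℝ → (Fin d → ℝ) → ℝ} (h : TF G) : ContinuousOn (fun t => pr (u t) (G t)) (Icc 0 T) := by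
  obtain ⟨K, η, φ, h1, h2, h3⟩ := h
  have : (fun t => pr (u t) (G t)) = fun t => ∑ k, η k t * pr (u t) (φ k) := by
    ext t
    rw [h3, pr_sum_right _ _ fun k _ => (h2 k).smul _]
    simp only [pr_smul_right]
  rw [this]
  exact continuousOn_finsetSum _ fun k _ => (h1 k).continuousOn.mul (H.pru_cont (h2 k))

end TFs

/-! Part 11 -/

section core
variable {d : ℕ} {P : ℝ≥0∞} [hP : Fact (1 ≤ P)]
variable {T κ : ℝ} {a : ℝ → Fin d → Fin d → ℝ} {f u : ℝ → Lp ℝ P (volume : Measure (Fin d → ℝ))}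

lemma tau_le {T : ℝ} (hT : 0 < T) (N n : ℕ) : (n:ℝ) * (T/N) ≤ ((n+1 : ℕ):ℝ) * (T/N) := by
  have : 0 ≤ T/N := by positivity
  push_cast; linarith

lemma tau_sub (T : ℝ) (N n : ℕ) : ((n+1 : ℕ):ℝ) * (T/N) - (n:ℝ) * (T/N) = T/N := by push_cast; ring

lemma Hyp.cells (H : Hyp P T κ a f u) {N : ℕ} (hN : 0 < N) (e : Fin d → ℝ) (he : ∑ k, e k ^ 2 ≤ 4) :
    ∃ R : ℕ → ((Fin d → ℝ) → ℝ) →ₗ[ℝ] ((Fin d → ℝ) → ℝ), (∀ n, IsConvShf (R n)) ∧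
      ∀ n < N, ∀ (Ψ : (Fin d → ℝ) → ℝ) (c ε : ℝ), Tst Ψ → (∀ i j k, Bd P (pd i (pd j (pd k Ψ))) c) → (∀ i j, Bd P (pd i (pd j Ψ)) c) →
        0 ≤ c → (∀ r ∈ Icc ((n:ℝ) * (T/N)) (((n+1 : ℕ):ℝ) * (T/N)), ‖u r - u ((n:ℝ) * (T/N))‖ ≤ ε) →
        |pr (u (((n+1 : ℕ):ℝ) * (T/N))) Ψ - pr (u ((n:ℝ) * (T/N))) (R n (Pop (Real.sqrt (κ * (T/N)) • e) Ψ))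
            - ∫ r in ((n:ℝ) * (T/N))..(((n+1 : ℕ):ℝ) * (T/N)), pr (f r) Ψ| ≤
          d^3 * (2 * Real.sqrt ((2 * d + 4 * κ) * mass a ((n:ℝ) * (T/N)) (((n+1 : ℕ):ℝ) * (T/N))))^3 * c * ‖u ((n:ℝ) * (T/N))‖
            + d^2 * c * ε * mass a ((n:ℝ) * (T/N)) (((n+1 : ℕ):ℝ) * (T/N)) := by
  have : ∀ n : ℕ, ∃ R : ((Fin d → ℝ) → ℝ) →ₗ[ℝ] ((Fin d → ℝ) → ℝ), IsConvShf R ∧ (n < N → 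
      ∀ (Ψ : (Fin d → ℝ) → ℝ) (c ε : ℝ), Tst Ψ → (∀ i j k, Bd P (pd i (pd j (pd k Ψ))) c) → (∀ i j, Bd P (pd i (pd j Ψ)) c) →
        0 ≤ c → (∀ r ∈ Icc ((n:ℝ) * (T/N)) (((n+1 : ℕ):ℝ) * (T/N)), ‖u r - u ((n:ℝ) * (T/N))‖ ≤ ε) →
        |pr (u (((n+1 : ℕ):ℝ) * (T/N))) Ψ - pr (u ((n:ℝ) * (T/N))) (R (Pop (Real.sqrt (κ * (T/N)) • e) Ψ))
            - ∫ r in ((n:ℝ) * (T/N))..(((n+1 : ℕ):ℝ) * (T/N)), pr (f r) Ψ| ≤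
          d^3 * (2 * Real.sqrt ((2 * d + 4 * κ) * mass a ((n:ℝ) * (T/N)) (((n+1 : ℕ):ℝ) * (T/N))))^3 * c * ‖u ((n:ℝ) * (T/N))‖
            + d^2 * c * ε * mass a ((n:ℝ) * (T/N)) (((n+1 : ℕ):ℝ) * (T/N))) := by
    intro n
    by_cases hn : n < N
    · obtain ⟨R, h1, h2⟩ := H.cell (mesh_pt H.hT hn.le hN).1 (tau_le H.hT N n) (mesh_pt H.hT hn hN).2 e he
      rw [tau_sub] at h2
      exact ⟨R, h1, fun _ => h2⟩
    · exact ⟨shf 0, isConvShf_shf 0, fun h => absurd h hn⟩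
  choose R h1 h2 using this
  exact ⟨R, h1, h2⟩

/-- backward scheme -/
def bsch (R : ℕ → ((Fin d → ℝ) → ℝ) →ₗ[ℝ] ((Fin d → ℝ) → ℝ)) (s : Fin d → ℝ) (G : ℕ → (Fin d → ℝ) → ℝ) (N n : ℕ) : (Fin d → ℝ) → ℝ :=
  sch (fun m => R (N-1-m)) s (fun m => G (N-1-m)) (N-n)

lemma bsch_top (R : ℕ → ((Fin d → ℝ) → ℝ) →ₗ[ℝ] ((Fin d → ℝ) → ℝ)) (s : Fin d → ℝ) (G : ℕ → (Fin d → ℝ) → ℝ) (N : ℕ) : bsch R s G N N = 0 := by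
  simp [bsch, sch]

lemma bsch_step (R : ℕ → ((Fin d → ℝ) → ℝ) →ₗ[ℝ] ((Fin d → ℝ) → ℝ)) (s : Fin d → ℝ) (G : ℕ → (Fin d → ℝ) → ℝ) {N n : ℕ} (hn : n < N) :
    bsch R s G N n = R n (Pop s (bsch R s G N (n+1))) + Dop s (G n) := by
  obtain ⟨k, rfl⟩ : ∃ k, N = n + 1 + k := ⟨N - (n+1), by lia⟩
  have e1 : n + 1 + k - n = k + 1 := by lia
  have e2 : n + 1 + k - (n+1) = k := by lia
  have e3 : n + 1 + k - 1 - k = n := by lia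
  unfold bsch
  rw [e1, e2, sch, e3]

lemma tele (H : Hyp P T κ a f u) {N : ℕ} {R : ℕ → ((Fin d → ℝ) → ℝ) →ₗ[ℝ] ((Fin d → ℝ) → ℝ)} (hR : ∀ n, IsConvShf (R n))
    (s : Fin d → ℝ) {G : ℕ → (Fin d → ℝ) → ℝ} (hG : ∀ n, Tst (G n)) (τ : ℕ → ℝ) (hτ : τ 0 = 0) (err : ℕ → ℝ)
    (hc : ∀ n < N, |pr (u (τ (n+1))) (bsch R s G N (n+1)) - pr (u (τ n)) (R n (Pop s (bsch R s G N (n+1)))) - ∫ r in (τ n)..(τ (n+1)), pr (f r) (bsch R s G N (n+1))| ≤ err n) :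
    |∑ n ∈ Finset.range N, pr (u (τ n)) (Dop s (G n)) - ∑ n ∈ Finset.range N, ∫ r in (τ n)..(τ (n+1)), pr (f r) (bsch R s G N (n+1))| ≤ ∑ n ∈ Finset.range N, err n := by
  have hT : ∀ n, Tst (bsch R s G N n) := fun n => Tst.sch (fun m => hR _) s (fun m => hG _) _
  have tel := Finset.sum_range_sub (fun n => pr (u (τ n)) (bsch R s G N n)) N
  rw [bsch_top, pr_zero_right, hτ, H.u0 (hT 0), sub_zero] at tel
  have e : ∑ n ∈ Finset.range N, pr (u (τ n)) (Dop s (G n)) - ∑ n ∈ Finset.range N, ∫ r in (τ n)..(τ (n+1)), pr (f r) (bsch R s G N (n+1))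
      = ∑ n ∈ Finset.range N, (pr (u (τ (n+1))) (bsch R s G N (n+1)) - pr (u (τ n)) (R n (Pop s (bsch R s G N (n+1)))) - ∫ r in (τ n)..(τ (n+1)), pr (f r) (bsch R s G N (n+1))) := by
    rw [← Finset.sum_sub_distrib, ← add_zero (Finset.sum _ _), ← tel, ← Finset.sum_add_distrib]
    refine Finset.sum_congr rfl fun n hn => ?_
    have st := bsch_step R s G (Finset.mem_range.mp hn)
    have : pr (u (τ n)) (bsch R s G N n) = pr (u (τ n)) (R n (Pop s (bsch R s G N (n+1)))) + pr (u (τ n)) (Dop s (G n)) := by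
      rw [st, pr_add_right _ (Tst.conv (hR n) (Tst.conv (isConvShf_Pop s) (hT _))) ((hG n).Dop s)]
    rw [this]; ring
  rw [e]
  exact (Finset.abs_sum_le_sum_abs _ _).trans (Finset.sum_le_sum fun n hn => hc n (Finset.mem_range.mp hn))

lemma AA_bsch {q C : ℝ} (hq : 0 < q) (hC0 : 0 ≤ C) {R : ℕ → ((Fin d → ℝ) → ℝ) →ₗ[ℝ] ((Fin d → ℝ) → ℝ)} (hR : ∀ n, IsConvShf (R n))
    (s : Fin d → ℝ) {G : ℕ → (Fin d → ℝ) → ℝ} (hG : ∀ n, Tst (G n)) (N : ℕ) 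
    (hC : SchBd q C (fun m => R (N-1-m)) s (fun m => G (N-1-m)) N) :
    ∑ n ∈ Finset.range N, AA q (bsch R s G N (n+1)) ≤ C * ∑ n ∈ Finset.range N, AA q (G n) := by
  have e1 : ∑ n ∈ Finset.range N, AA q (bsch R s G N (n+1)) = ∑ n ∈ Finset.range N, AA q (sch (fun m => R (N-1-m)) s (fun m => G (N-1-m)) n) := by
    rw [← Finset.sum_range_reflect _ N]
    refine Finset.sum_congr rfl fun n hn => ?_
    have := Finset.mem_range.mp hn
    unfold bsch
    congr 2
    lia
  have e2 : ∑ n ∈ Finset.range N, AA q (G n) = ∑ n ∈ Finset.range N, AA q (G (N-1-n)) := (Finset.sum_range_reflect (fun n => AA q (G n)) N).symm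
  rw [e1, e2]
  unfold AA
  have f1 : ∀ n, ∫⁻ x, ‖sch (fun m => R (N-1-m)) s (fun m => G (N-1-m)) n x‖ₑ^q ≠ ⊤ := fun n => ((Tst.sch (fun m => hR _) s (fun m => hG _) n).fin hq).ne
  have f2 : ∀ n, ∫⁻ x, ‖G (N-1-n) x‖ₑ^q ≠ ⊤ := fun n => ((hG _).fin hq).ne
  rw [← ENNReal.toReal_sum (fun n _ => f1 n), ← ENNReal.toReal_sum (fun n _ => f2 n), ← ENNReal.toReal_ofReal hC0, ← ENNReal.toReal_mul]
  refine ENNReal.toReal_mono (ENNReal.mul_ne_top ENNReal.ofReal_ne_top (ENNReal.sum_ne_top.mpr fun n _ => f2 n)) ?_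
  refine le_trans ?_ hC
  exact Finset.sum_le_sum_of_subset (Finset.range_mono (by lia))

end core

section core2
variable {d : ℕ} {p q : ℝ} [hP : Fact (1 ≤ ENNReal.ofReal p)]
variable {T κ : ℝ} {a : ℝ → Fin d → Fin d → ℝ} {f u : ℝ → Lp ℝ (ENNReal.ofReal p) (volume : Measure (Fin d → ℝ))}

lemma f_cell (H : Hyp (ENNReal.ofReal p) T κ a f u) (hpq : p.HolderConjugate q) (hf : IntegrableOn (fun t => ‖f t‖ ^ p) (Ioc (0:ℝ) T))
    {s t : ℝ} (hs : 0 ≤ s) (hst : s ≤ t) (ht : t ≤ T) {Ψ : (Fin d → ℝ) → ℝ} (hΨ : Tst Ψ) :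
    |∫ r in s..t, pr (f r) Ψ| ≤ ((AA q Ψ) * (t - s))^(1/q) * (∫ r in s..t, ‖f r‖^p)^(1/p) := by
  have hp := hpq.pos
  have hq := hpq.symm.pos
  have hsub : Ioc s t ⊆ Ioc 0 T := Ioc_subset_Ioc hs ht
  have hfi : IntervalIntegrable (fun r => ‖f r‖) volume s t := by
    rw [intervalIntegrable_iff_integrableOn_Ioc_of_le hst]; exact H.fint.mono_set hsub
  have hm : MemLp (fun r => ‖f r‖) (ENNReal.ofReal p) (volume.restrict (Ioc s t)) := by
    have fm := (H.fm.mono_measure (Measure.restrict_mono hsub le_rfl))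
    rw [← integrable_norm_rpow_iff fm.norm (by simpa using hp) ENNReal.ofReal_ne_top, ENNReal.toReal_ofReal hp.le]
    simp only [norm_norm]
    exact hf.mono_set hsub
  have h1 : |∫ r in s..t, pr (f r) Ψ| ≤ ∫ r in s..t, (AA q Ψ)^(1/q) * ‖f r‖ := by
    rw [← Real.norm_eq_abs]
    exact intervalIntegral.norm_integral_le_of_norm_le hst (Filter.Eventually.of_forall fun r _ => pr_holder hpq (f r) hΨ) (hfi.const_mul _)
  refine h1.trans ?_
  rw [intervalIntegral.integral_const_mul]
  have h2 : ∫ r in s..t, ‖f r‖ ≤ (∫ r in s..t, ‖f r‖^p)^(1/p) * (t-s)^(1/q) := by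
    rw [intervalIntegral.integral_of_le hst, intervalIntegral.integral_of_le hst]
    have := integral_mul_le_Lp_mul_Lq_of_nonneg hpq (μ := volume.restrict (Ioc s t)) (f := fun r => ‖f r‖) (g := fun _ => 1)
      (Filter.Eventually.of_forall fun r => norm_nonneg _) (Filter.Eventually.of_forall fun r => zero_le_one) hm (memLp_const 1)
    simpa [hst] using this
  calc _ ≤ (AA q Ψ)^(1/q) * ((∫ r in s..t, ‖f r‖^p)^(1/p) * (t-s)^(1/q)) := by
        gcongr
        exact Real.rpow_nonneg (AA_nonneg _ _) _
    _ = _ := by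
        rw [Real.mul_rpow (AA_nonneg _ _) (by linarith)]; ring

lemma f_part (H : Hyp (ENNReal.ofReal p) T κ a f u) (hpq : p.HolderConjugate q) (hf : IntegrableOn (fun t => ‖f t‖ ^ p) (Ioc (0:ℝ) T))
    {N : ℕ} (hN : 0 < N) {Ψ : ℕ → (Fin d → ℝ) → ℝ} (hΨ : ∀ n, Tst (Ψ n)) :
    |∑ n ∈ Finset.range N, ∫ r in ((n:ℝ) * (T/N))..(((n+1 : ℕ):ℝ) * (T/N)), pr (f r) (Ψ n)| ≤
      (T/N * ∑ n ∈ Finset.range N, AA q (Ψ n))^(1/q) * (∫ r in Ioc (0:ℝ) T, ‖f r‖^p)^(1/p) := by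
  have hp := hpq.pos
  have hq := hpq.symm.pos
  have hT := H.hT
  have hδ : 0 ≤ T/N := by positivity
  have F0 : ∀ n : ℕ, 0 ≤ ∫ r in ((n:ℝ) * (T/N))..(((n+1 : ℕ):ℝ) * (T/N)), ‖f r‖^p := fun n =>
    intervalIntegral.integral_nonneg (tau_le hT N n) fun r _ => by positivity
  have hfi : IntervalIntegrable (fun r => ‖f r‖^p) volume 0 T := by
    rw [intervalIntegrable_iff_integrableOn_Ioc_of_le hT.le]; exact hf
  have each : ∀ n ∈ Finset.range N, |∫ r in ((n:ℝ) * (T/N))..(((n+1 : ℕ):ℝ) * (T/N)), pr (f r) (Ψ n)| ≤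
      ((T/N) * (AA q (Ψ n)))^(1/q) * (∫ r in ((n:ℝ) * (T/N))..(((n+1 : ℕ):ℝ) * (T/N)), ‖f r‖^p)^(1/p) := by
    intro n hn
    have hn := Finset.mem_range.mp hn
    have := f_cell H hpq hf (mesh_pt hT hn.le hN).1 (tau_le hT N n) (mesh_pt hT hn hN).2 (hΨ n)
    rwa [tau_sub, mul_comm (AA _ _)] at this
  refine (Finset.abs_sum_le_sum_abs _ _).trans ((Finset.sum_le_sum each).trans ?_)
  refine (Real.inner_le_Lp_mul_Lq_of_nonneg _ hpq.symm (fun n _ => Real.rpow_nonneg (mul_nonneg hδ (AA_nonneg _ _)) _) (fun n _ => Real.rpow_nonneg (F0 n) _)).trans (le_of_eq ?_)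
  congr 2
  · rw [Finset.mul_sum]
    refine Finset.sum_congr rfl fun n _ => ?_
    rw [← Real.rpow_mul (mul_nonneg hδ (AA_nonneg _ _)), one_div_mul_cancel hq.ne', Real.rpow_one]
  · rw [← intervalIntegral.integral_of_le hT.le, ← cells_sum hT hN hfi]
    refine Finset.sum_congr rfl fun n _ => ?_
    rw [← Real.rpow_mul (F0 n), one_div_mul_cancel hp.ne', Real.rpow_one]

end core2

/-! Part 12 -/

section core3
variable {d : ℕ} {p q : ℝ} [hP : Fact (1 ≤ ENNReal.ofReal p)]
variable {T κ : ℝ} {a : ℝ → Fin d → Fin d → ℝ} {f u : ℝ → Lp ℝ (ENNReal.ofReal p) (volume : Measure (Fin d → ℝ))}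

/-- the second-order pairing -/
def HH (u : ℝ → Lp ℝ (ENNReal.ofReal p) (volume : Measure (Fin d → ℝ))) (e : Fin d → ℝ) (G : ℝ → (Fin d → ℝ) → ℝ) (t : ℝ) : ℝ :=
  ∑ i, ∑ j, e i * e j * pr (u t) (pd i (pd j (G t)))

lemma mass_mesh (H : Hyp (ENNReal.ofReal p) T κ a f u) {ε : ℝ} (hε : 0 < ε) :
    ∀ᶠ N : ℕ in Filter.atTop, 0 < N ∧ ∀ n < N, Hyp.mass a ((n:ℝ) * (T/N)) (((n+1 : ℕ):ℝ) * (T/N)) ≤ ε := by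
  have hi : ∀ x ∈ Icc 0 T, IntervalIntegrable (aMax a) volume 0 x := fun x hx => Hyp.sub H.aMi le_rfl hx.1 hx.2
  have hc : ContinuousOn (fun x => (∫ r in (0:ℝ)..x, aMax a r) + x) (Icc 0 T) := by
    refine ContinuousOn.add ?_ continuousOn_id
    have := intervalIntegral.continuousOn_primitive_interval (μ := volume) (f := aMax a) (a := 0) (b := T)
      (by rw [uIcc_of_le H.hT.le, integrableOn_Icc_iff_integrableOn_Ioc]; exact H.aint)
    rwa [uIcc_of_le H.hT.le] at this
  filter_upwards [mesh H.hT hc hε] with N hN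
  refine ⟨hN.1, fun n hn => ?_⟩
  have h := hN.2 n hn _ (right_mem_Icc.mpr (tau_le H.hT N n))
  have e : Hyp.mass a ((n:ℝ) * (T/N)) (((n+1 : ℕ):ℝ) * (T/N)) = ((∫ r in (0:ℝ)..(((n+1 : ℕ):ℝ) * (T/N)), aMax a r) + ((n+1 : ℕ):ℝ) * (T/N)) - ((∫ r in (0:ℝ)..((n:ℝ) * (T/N)), aMax a r) + (n:ℝ) * (T/N)) := by
    unfold Hyp.mass
    rw [← intervalIntegral.integral_interval_sub_left (hi _ (mesh_pt H.hT hn hN.1)) (hi _ (mesh_pt H.hT hn.le hN.1))]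
    ring
  rw [e]
  rw [Real.dist_eq] at h
  exact (le_abs_self _).trans h

lemma mass_nonneg (H : Hyp (ENNReal.ofReal p) T κ a f u) {s t : ℝ} (hst : s ≤ t) : 0 ≤ Hyp.mass a s t := by
  have hM0 : 0 ≤ ∫ r in s..t, aMax a r := intervalIntegral.integral_nonneg hst fun r _ => H.aM_nonneg r
  unfold Hyp.mass; linarith

lemma mass_sum (H : Hyp (ENNReal.ofReal p) T κ a f u) {N : ℕ} (hN : 0 < N) :
    ∑ n ∈ Finset.range N, Hyp.mass a ((n:ℝ) * (T/N)) (((n+1 : ℕ):ℝ) * (T/N)) = Hyp.mass a 0 T := by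
  unfold Hyp.mass
  have hN' : (0:ℝ) < N := by exact_mod_cast hN
  rw [Finset.sum_add_distrib, cells_sum H.hT hN H.aMi]
  simp only [tau_sub]
  rw [Finset.sum_const, Finset.card_range, nsmul_eq_mul, sub_zero]
  field_simp

lemma err_bound {D L m ε c M U : ℝ} (hD : 0 ≤ D) (hL : 0 ≤ L) (hm : 0 ≤ m) (hmε : m ≤ ε^2) (hε : 0 ≤ ε) (hc : 0 ≤ c) (hU : 0 ≤ U) (hUM : U ≤ M) :
    D^3 * (2 * Real.sqrt (L * m))^3 * c * U + D^2 * c * ε * m ≤ (D^3 * 8 * (L * Real.sqrt L) * c * M + D^2 * c) * ε * m := by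
  have h1 : Real.sqrt (L*m) = Real.sqrt L * Real.sqrt m := Real.sqrt_mul hL m
  have hs : Real.sqrt m ≤ ε := Real.sqrt_le_left hε |>.mpr hmε |> fun h => h
  have h2 : (2 * Real.sqrt (L * m))^3 = 8 * (L * Real.sqrt L) * (m * Real.sqrt m) := by
    rw [h1]
    calc (2 * (Real.sqrt L * Real.sqrt m))^3 = 8 * (Real.sqrt L ^2 * Real.sqrt L) * (Real.sqrt m^2 * Real.sqrt m) := by ring
      _ = _ := by rw [Real.sq_sqrt hL, Real.sq_sqrt hm]
  rw [h2]
  calc D^3 * (8 * (L * Real.sqrt L) * (m * Real.sqrt m)) * c * U + D^2 * c * ε * m 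
      ≤ D^3 * (8 * (L * Real.sqrt L) * (m * ε)) * c * M + D^2 * c * ε * m := by gcongr
    _ = _ := by ring

lemma core_N (H : Hyp (ENNReal.ofReal p) T κ a f u) (hpq : p.HolderConjugate q) (hf : IntegrableOn (fun t => ‖f t‖ ^ p) (Ioc (0:ℝ) T))
    {C : ℝ} (hC0 : 0 ≤ C) (hC : ∀ (v : Fin d → ℝ) (g : ℕ → (Fin d → ℝ) → ℝ), (∀ n, Measurable (g n)) → ∀ (N : ℕ)
      (R : ℕ → ((Fin d → ℝ) → ℝ) →ₗ[ℝ] ((Fin d → ℝ) → ℝ)), (∀ n, IsConvShf (R n)) → SchBd q C R v g N)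
    (e : Fin d → ℝ) (he : ∑ k, e k ^ 2 ≤ 4) {G : ℝ → (Fin d → ℝ) → ℝ} (hG : TF G) :
    ∃ K, 0 ≤ K ∧ ∀ ε, 0 < ε → ε ≤ 1 → ∀ᶠ N : ℕ in Filter.atTop,
      κ/4 * |T/N * ∑ n ∈ Finset.range N, HH u e G ((n:ℝ) * (T/N))| ≤
        (C * (T/N * ∑ n ∈ Finset.range N, AA q (G ((n:ℝ) * (T/N)))))^(1/q) * (∫ r in Ioc (0:ℝ) T, ‖f r‖^p)^(1/p) + K * ε := by
  have hT := H.hT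
  have hκ := H.hκ
  have hq := hpq.symm.pos
  obtain ⟨c, hc0, hc⟩ := hG.sch23 T H.bd
  obtain ⟨c3, h30, h3⟩ : ∃ c, 0 ≤ c ∧ ∀ ij : Fin d × Fin d × Fin d, ∀ t ∈ Icc 0 T, Bd (ENNReal.ofReal p) (pd ij.1 (pd ij.2.1 (pd ij.2.2 (G t)))) c :=
    unif _ (fun i c c' hc h t ht => (h t ht).mono hc) (fun ij => (((hG.pd ij.2.2).pd ij.2.1).pd ij.1).bd T H.bd)
  obtain ⟨M, hM⟩ := isCompact_Icc.exists_bound_of_continuousOn H.ucont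
  have hM0 : 0 ≤ M := (norm_nonneg _).trans (hM 0 ⟨le_rfl, hT.le⟩)
  set c' : ℝ := 4 * κ * T * c with hc'
  have hc'0 : 0 ≤ c' := by positivity
  set L : ℝ := 2 * d + 4 * κ with hL
  set K1 : ℝ := (d:ℝ)^3 * 8 * (L * Real.sqrt L) * c' * M + (d:ℝ)^2 * c' with hK1
  set K2 : ℝ := (d:ℝ)^3 * 8 * (4 * κ * T) * c3 * M with hK2
  have hm0T : 0 ≤ Hyp.mass a 0 T := mass_nonneg H hT.le
  refine ⟨K1 * Hyp.mass a 0 T + K2, by positivity, fun ε hε hε1 => ?_⟩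
  have evρ : ∀ᶠ N : ℕ in Filter.atTop, 2 * Real.sqrt (κ * (T/N)) ≤ ε := by
    have : Filter.Tendsto (fun N : ℕ => 2 * Real.sqrt (κ * (T/N))) Filter.atTop (nhds (2 * Real.sqrt (κ * 0))) := by
      refine ((Real.continuous_sqrt.tendsto _).comp ((tendsto_const_div_atTop_nhds_zero_nat T).const_mul κ)).const_mul 2
    simp only [mul_zero, Real.sqrt_zero] at this
    exact (this.eventually (gt_mem_nhds hε)).mono fun N h => h.le
  filter_upwards [evρ, mass_mesh H (ε := ε^2) (by positivity), mesh hT H.ucont hε] with N hρε hmass hmu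
  obtain ⟨hN, hmass⟩ := hmass
  have hmu := hmu.2
  have hN' : (0:ℝ) < N := by exact_mod_cast hN
  have hδ : 0 < T/N := by positivity
  set ρ : ℝ := 2 * Real.sqrt (κ * (T/N)) with hρ
  have hρ0 : 0 ≤ ρ := by positivity
  have hρ2 : ρ^2 = 4 * κ * (T/N) := by
    rw [hρ, mul_pow, Real.sq_sqrt (by positivity)]; ring
  set s : Fin d → ℝ := Real.sqrt (κ * (T/N)) • e with hs
  have hea : ∀ k, |e k| ≤ 2 := by
    intro k
    have : e k ^2 ≤ 4 := (Finset.single_le_sum (f := fun k => e k^2) (fun i _ => sq_nonneg _) (Finset.mem_univ k)).trans he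
    exact abs_le_of_sq_le_sq (by linarith) (by norm_num)
  have hsρ : ∀ k, |s k| ≤ ρ := by
    intro k
    rw [hs, Pi.smul_apply, smul_eq_mul, abs_mul, abs_of_nonneg (Real.sqrt_nonneg _), hρ, mul_comm 2]
    exact mul_le_mul_of_nonneg_left (hea k) (Real.sqrt_nonneg _)
  obtain ⟨R, hR, hcell⟩ := H.cells hN e he
  have hcell : ∀ n < N, _ := hcell
  set τ : ℕ → ℝ := fun n => (n:ℝ) * (T/N) with hτ
  have hτm : ∀ n ≤ N, τ n ∈ Icc 0 T := fun n hn => mesh_pt hT hn hN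
  set g : ℕ → (Fin d → ℝ) → ℝ := fun n => G (τ n) with hg
  have hgT : ∀ n, Tst (g n) := fun n => hG.tst _
  have hΨT : ∀ n, Tst (bsch R s g N n) := fun n => Tst.sch (fun m => hR _) s (fun m => hgT _) _
  have hΨ := fun n => hc (fun m => R (N-1-m)) s ρ (fun m => τ (N-1-m)) (N-n) (fun m => hR _) (fun m => hτm _ (by lia)) hsρ hρ0 (hρε.trans hε1)
  have hcc : ∀ n : ℕ, ((N-n:ℕ):ℝ) * (c * ρ^2) ≤ c' := by
    intro n
    have : ((N-n:ℕ):ℝ) ≤ N := by exact_mod_cast Nat.sub_le N n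
    calc ((N-n:ℕ):ℝ) * (c * ρ^2) ≤ N * (c * ρ^2) := by gcongr
      _ = c' := by rw [hρ2, hc']; field_simp
  -- telescoping
  have t1 := tele H hR s hgT τ (by simp [hτ]) (fun n => K1 * ε * Hyp.mass a (τ n) (τ (n+1))) (N := N) (fun n hn => by
    have h := hcell n hn (bsch R s g N (n+1)) c' ε (hΨT _) (fun i j k => ((hΨ (n+1)).1 i j k).mono (hcc _)) (fun i j => ((hΨ (n+1)).2 i j).mono (hcc _)) hc'0
      (fun r hr => by rw [← dist_eq_norm]; exact hmu n hn r hr)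
    refine h.trans ?_
    exact err_bound (Nat.cast_nonneg d) (by positivity) (mass_nonneg H (tau_le hT N n)) (hmass n hn) hε.le hc'0 (norm_nonneg _) (hM _ (hτm n hn.le)))
  have t2 : ∑ n ∈ Finset.range N, K1 * ε * Hyp.mass a (τ n) (τ (n+1)) = K1 * ε * Hyp.mass a 0 T := by
    rw [← Finset.mul_sum, mass_sum H hN]
  rw [t2] at t1
  -- f part
  have t3 := f_part H hpq hf hN (Ψ := fun n => bsch R s g N (n+1)) (fun n => hΨT _)
  have t4 := AA_bsch hq hC0 hR s hgT N (hC s _ (fun m => (hgT _).cont.measurable) N _ (fun m => hR _))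
  have t5 : (T/N * ∑ n ∈ Finset.range N, AA q (bsch R s g N (n+1)))^(1/q) ≤ (C * (T/N * ∑ n ∈ Finset.range N, AA q (g n)))^(1/q) := by
    refine Real.rpow_le_rpow (mul_nonneg hδ.le (Finset.sum_nonneg fun n _ => AA_nonneg _ _)) ?_ (by positivity)
    calc _ ≤ T/N * (C * ∑ n ∈ Finset.range N, AA q (g n)) := by gcongr
      _ = _ := by ring
  have hF0 : 0 ≤ (∫ r in Ioc (0:ℝ) T, ‖f r‖^p)^(1/p) := Real.rpow_nonneg (integral_nonneg fun r => by positivity) _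
  have t6 := t3.trans (mul_le_mul_of_nonneg_right t5 hF0)
  -- Taylor part
  have t7 : |∑ n ∈ Finset.range N, pr (u (τ n)) (Dop s (g n)) + κ/4 * (T/N * ∑ n ∈ Finset.range N, HH u e G (τ n))| ≤ K2 * ε := by
    rw [Finset.mul_sum, Finset.mul_sum, ← Finset.sum_add_distrib]
    have each : ∀ n ∈ Finset.range N, |pr (u (τ n)) (Dop s (g n)) + κ/4 * (T/N * HH u e G (τ n))| ≤ d^3 * (2*ρ)^3 * c3 * M := by
      intro n hn
      have hn := Finset.mem_range.mp hn
      have h := Dop_taylor s hsρ (u (τ n)) (hgT n) (fun i j k => h3 (i, j, k) (τ n) (hτm n hn.le))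
      have e1 : κ/4 * (T/N * HH u e G (τ n)) = ∑ i, ∑ j, s i * s j / 4 * pr (u (τ n)) (pd i (pd j (g n))) := by
        unfold HH
        rw [Finset.mul_sum, Finset.mul_sum]
        refine Finset.sum_congr rfl fun i _ => ?_
        rw [Finset.mul_sum, Finset.mul_sum]
        refine Finset.sum_congr rfl fun j _ => ?_
        have : s i * s j = κ * (T/N) * (e i * e j) := by
          rw [hs, Pi.smul_apply, Pi.smul_apply, smul_eq_mul, smul_eq_mul]
          calc _ = (Real.sqrt (κ * (T/N)) * Real.sqrt (κ * (T/N))) * (e i * e j) := by ring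
            _ = _ := by rw [Real.mul_self_sqrt (by positivity)]
        rw [this]; ring
      rw [e1]
      refine h.trans ?_
      gcongr
      exact hM _ (hτm n hn.le)
    refine (Finset.abs_sum_le_sum_abs _ _).trans ((Finset.sum_le_sum each).trans ?_)
    rw [Finset.sum_const, Finset.card_range, nsmul_eq_mul]
    calc (N:ℝ) * (d^3 * (2*ρ)^3 * c3 * M) = N * (d^3 * 8 * (ρ^2 * ρ) * c3 * M) := by ring
      _ = K2 * ρ := by rw [hρ2, hK2]; field_simp
      _ ≤ K2 * ε := by gcongr
  have a1 := abs_le.mp t1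
  have a6 := abs_le.mp t6
  have a7 := abs_le.mp t7
  rw [← abs_of_pos (show 0 < κ/4 by positivity), ← abs_mul, abs_le]
  simp only [hg, hτ] at *
  constructor <;> linarith [a1.1, a1.2, a6.1, a6.2, a7.1, a7.2]

lemma core (H : Hyp (ENNReal.ofReal p) T κ a f u) (hpq : p.HolderConjugate q) (hf : IntegrableOn (fun t => ‖f t‖ ^ p) (Ioc (0:ℝ) T))
    {C : ℝ} (hC0 : 0 ≤ C) (hC : ∀ (v : Fin d → ℝ) (g : ℕ → (Fin d → ℝ) → ℝ), (∀ n, Measurable (g n)) → ∀ (N : ℕ)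
      (R : ℕ → ((Fin d → ℝ) → ℝ) →ₗ[ℝ] ((Fin d → ℝ) → ℝ)), (∀ n, IsConvShf (R n)) → SchBd q C R v g N)
    (e : Fin d → ℝ) (he : ∑ k, e k ^ 2 ≤ 4) {G : ℝ → (Fin d → ℝ) → ℝ} (hG : TF G) :
    κ/4 * |∫ t in (0:ℝ)..T, HH u e G t| ≤ (C * ∫ t in (0:ℝ)..T, AA q (G t))^(1/q) * (∫ r in Ioc (0:ℝ) T, ‖f r‖^p)^(1/p) := by
  have hT := H.hT
  have hq := hpq.symm.pos
  obtain ⟨K, hK, h⟩ := core_N H hpq hf hC0 hC e he hG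
  have HHc : ContinuousOn (HH u e G) (Icc 0 T) := by
    unfold HH
    exact continuousOn_finsetSum _ fun i _ => continuousOn_finsetSum _ fun j _ => (continuousOn_const).mul (TF.pru_cont H ((hG.pd j).pd i))
  have l1 := ((riemann hT HHc).abs).const_mul (κ/4)
  have l2 := (((riemann hT (hG.AA_cont hq).continuousOn).const_mul C).rpow_const (p := 1/q) (Or.inr (by positivity))).mul_const ((∫ r in Ioc (0:ℝ) T, ‖f r‖^p)^(1/p))
  refine le_of_forall_pos_le_add fun η hη => ?_
  have hε0 : 0 < min 1 (η/(K+1)) := by positivity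
  have := le_of_tendsto_of_tendsto l1 (l2.add_const (K * min 1 (η/(K+1)))) (h _ hε0 (min_le_left _ _))
  refine this.trans ?_
  gcongr
  calc K * min 1 (η/(K+1)) ≤ K * (η/(K+1)) := by gcongr; exact min_le_right _ _
    _ ≤ η := by rw [mul_div_assoc', div_le_iff₀ (by positivity)]; nlinarith

lemma core_ij (H : Hyp (ENNReal.ofReal p) T κ a f u) (hpq : p.HolderConjugate q) (hf : IntegrableOn (fun t => ‖f t‖ ^ p) (Ioc (0:ℝ) T))
    {C : ℝ} (hC0 : 0 ≤ C) (hC : ∀ (v : Fin d → ℝ) (g : ℕ → (Fin d → ℝ) → ℝ), (∀ n, Measurable (g n)) → ∀ (N : ℕ)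
      (R : ℕ → ((Fin d → ℝ) → ℝ) →ₗ[ℝ] ((Fin d → ℝ) → ℝ)), (∀ n, IsConvShf (R n)) → SchBd q C R v g N)
    (i j : Fin d) {G : ℝ → (Fin d → ℝ) → ℝ} (hG : TF G) :
    |∫ t in (0:ℝ)..T, pr (u t) (pd i (pd j (G t)))| ≤ (2/κ) * ((C * ∫ t in (0:ℝ)..T, AA q (G t))^(1/q) * (∫ r in Ioc (0:ℝ) T, ‖f r‖^p)^(1/p)) := by
  have hκ := H.hκ
  have hT := H.hT
  set e1 : Fin d → ℝ := Pi.single i 1 + Pi.single j 1 with he1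
  set e2 : Fin d → ℝ := Pi.single i 1 - Pi.single j 1 with he2
  have sq : ∀ σ : ℝ, σ^2 = 1 → ∑ k, (Pi.single (M := fun _ => ℝ) i 1 k + σ * Pi.single (M := fun _ => ℝ) j 1 k)^2 ≤ 4 := by
    intro σ hσ
    calc ∑ k, (Pi.single (M := fun _ => ℝ) i 1 k + σ * Pi.single (M := fun _ => ℝ) j 1 k)^2 
        ≤ ∑ k, (2 * Pi.single (M := fun _ => ℝ) i 1 k + 2 * Pi.single (M := fun _ => ℝ) j 1 k) := by
          refine Finset.sum_le_sum fun k _ => ?_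
          have z : ∀ l : Fin d, (Pi.single (M := fun _ => ℝ) l 1 k)^2 = Pi.single (M := fun _ => ℝ) l 1 k := by
            intro l
            by_cases h : k = l
            · subst h; simp
            · simp [Pi.single_eq_of_ne h]
          nlinarith [z i, z j, sq_nonneg (Pi.single (M := fun _ => ℝ) i 1 k - σ * Pi.single (M := fun _ => ℝ) j 1 k)]
      _ = 4 := by rw [Finset.sum_add_distrib, ← Finset.mul_sum, ← Finset.mul_sum]; simp; norm_num
  have b1 := core H hpq hf hC0 hC e1 (by simpa [he1] using sq 1 (by norm_num)) hG
  have b2 := core H hpq hf hC0 hC e2 (by simpa [he2, sub_eq_add_neg] using sq (-1) (by norm_num)) hG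
  have hi : ∀ e : Fin d → ℝ, IntervalIntegrable (HH u e G) volume 0 T := by
    intro e
    apply ContinuousOn.intervalIntegrable
    rw [uIcc_of_le hT.le]
    unfold HH
    exact continuousOn_finsetSum _ fun i _ => continuousOn_finsetSum _ fun j _ => (continuousOn_const).mul (TF.pru_cont H ((hG.pd j).pd i))
  have pol : ∀ t, HH u e1 G t - HH u e2 G t = 4 * pr (u t) (pd i (pd j (G t))) := by
    intro t
    have ex : ∀ e : Fin d → ℝ, ∀ X : Fin d → Fin d → ℝ, ∑ k, ∑ l, e k * e l * X k l = ∑ k, e k * ∑ l, e l * X k l := by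
      intro e X
      refine Finset.sum_congr rfl fun k _ => ?_
      rw [Finset.mul_sum]; exact Finset.sum_congr rfl fun l _ => by ring
    have sg : ∀ (l : Fin d) (X : Fin d → ℝ), ∑ k, Pi.single (M := fun _ => ℝ) l 1 k * X k = X l := by
      intro l X; simp [Pi.single_apply]
    unfold HH
    rw [ex, ex]
    simp only [he1, he2, Pi.add_apply, Pi.sub_apply, add_mul, sub_mul, Finset.sum_add_distrib, Finset.sum_sub_distrib, sg]
    rw [pd_comm j i (hG.tst t)]
    ring
  have e4 : (∫ t in (0:ℝ)..T, HH u e1 G t) - ∫ t in (0:ℝ)..T, HH u e2 G t = 4 * ∫ t in (0:ℝ)..T, pr (u t) (pd i (pd j (G t))) := by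
    rw [← intervalIntegral.integral_sub (hi _) (hi _), ← intervalIntegral.integral_const_mul]
    simp only [pol]
  set B := (C * ∫ t in (0:ℝ)..T, AA q (G t))^(1/q) * (∫ r in Ioc (0:ℝ) T, ‖f r‖^p)^(1/p) with hB
  have tri : |4 * ∫ t in (0:ℝ)..T, pr (u t) (pd i (pd j (G t)))| ≤ |∫ t in (0:ℝ)..T, HH u e1 G t| + |∫ t in (0:ℝ)..T, HH u e2 G t| := by
    rw [← e4]; exact abs_sub _ _
  rw [abs_mul, abs_of_pos (by norm_num : (0:ℝ) < 4)] at tri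
  have : κ * |∫ t in (0:ℝ)..T, pr (u t) (pd i (pd j (G t)))| ≤ 2 * B := by nlinarith
  rw [div_mul_eq_mul_div, le_div_iff₀ hκ]
  linarith

end core3

/-! Part 13 -/

section duality

lemma hahn {V E : Type*} [AddCommGroup V] [Module ℝ V] [NormedAddCommGroup E] [NormedSpace ℝ E] (J : V →ₗ[ℝ] E) (l : V →ₗ[ℝ] ℝ)
    {B : ℝ} (hB : 0 ≤ B) (h : ∀ v, |l v| ≤ B * ‖J v‖) : ∃ Λ : E →L[ℝ] ℝ, ‖Λ‖ ≤ B ∧ ∀ v, Λ (J v) = l v := by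
  obtain ⟨s, hs⟩ := J.rangeRestrict.exists_rightInverse_of_surjective (LinearMap.range_rangeRestrict J)
  have hs' : ∀ y : LinearMap.range J, J (s y) = y := fun y => by
    have := LinearMap.congr_fun hs y
    simpa using congrArg Subtype.val this
  let f : StrongDual ℝ (LinearMap.range J) := LinearMap.mkContinuous (l.comp s) B (fun y => by
    have := h (s y)
    rw [hs'] at this
    simpa using this)
  obtain ⟨Λ, h1, h2⟩ := exists_extension_norm_eq (LinearMap.range J) f
  refine ⟨Λ, ?_, fun v => ?_⟩
  · rw [h2]; exact LinearMap.mkContinuous_norm_le _ hB _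
  · have e := h1 ⟨J v, LinearMap.mem_range_self J v⟩
    have e2 : f ⟨J v, LinearMap.mem_range_self J v⟩ = l (s ⟨J v, LinearMap.mem_range_self J v⟩) := rfl
    rw [e2] at e
    simp only at e
    rw [e]
    have e3 := h (s ⟨J v, LinearMap.mem_range_self J v⟩ - v)
    rw [map_sub J, hs'] at e3
    simp only [sub_self, norm_zero, mul_zero] at e3
    have e4 := abs_nonpos_iff.mp e3
    rw [map_sub] at e4
    linarith

variable {X : Type*} [MeasurableSpace X] {μ : Measure X}

lemma memLp_k {k : X → ℝ} (hk0 : ∀ x, 0 < k x) (hk1 : ∀ x, k x ≤ 1) (hk : Integrable k μ) {r : ℝ≥0∞} (hr : 1 ≤ r) : MemLp k r μ := by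
  by_cases h : r = ⊤
  · subst h
    exact memLp_top_of_bound hk.1 1 (Filter.Eventually.of_forall fun x => by rw [Real.norm_of_nonneg (hk0 x).le]; exact hk1 x)
  · have hr0 : r ≠ 0 := fun h0 => by simp [h0] at hr
    refine ⟨hk.1, ?_⟩
    rw [eLpNorm_lt_top_iff_lintegral_rpow_enorm_lt_top hr0 h]
    refine lt_of_le_of_lt (lintegral_mono fun x => ?_) hk.2
    have h1 : 1 ≤ r.toReal := by
      rw [← ENNReal.toReal_one]; exact ENNReal.toReal_mono h hr
    have : ‖k x‖ₑ ≤ 1 := by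
      rw [Real.enorm_eq_ofReal (hk0 x).le]; exact ENNReal.ofReal_le_one.mpr (hk1 x)
    calc ‖k x‖ₑ ^ r.toReal ≤ ‖k x‖ₑ ^ (1:ℝ) := ENNReal.rpow_le_rpow_of_exponent_ge this h1
      _ = _ := ENNReal.rpow_one _

lemma dual_L2 {q : ℝ} (hq1 : 1 < q) (hq2 : q ≤ 2) [hF : Fact (1 ≤ ENNReal.ofReal q)] {k : X → ℝ} (hk0 : ∀ x, 0 < k x) (hk1 : ∀ x, k x ≤ 1) (hk : Integrable k μ)
    (Λ : Lp ℝ (ENNReal.ofReal q) μ →L[ℝ] ℝ) :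
    ∃ W : X → ℝ, AEStronglyMeasurable W μ ∧ ∀ (g : X → ℝ) (hg : MemLp g (ENNReal.ofReal q) μ), MemLp (fun x => g x / k x) 2 μ → Λ (hg.toLp g) = ∫ x, W x * g x ∂μ := by
  set r : ℝ≥0∞ := ((ENNReal.ofReal q)⁻¹ - 2⁻¹)⁻¹ with hr
  have hle : (2:ℝ≥0∞)⁻¹ ≤ (ENNReal.ofReal q)⁻¹ := by
    rw [ENNReal.inv_le_inv, ← ENNReal.ofReal_ofNat]; exact ENNReal.ofReal_le_ofReal hq2
  haveI h3 : ENNReal.HolderTriple r 2 (ENNReal.ofReal q) := ⟨by rw [hr, inv_inv, tsub_add_cancel_of_le hle]⟩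
  have hr1 : 1 ≤ r := by
    rw [hr, ENNReal.one_le_inv]
    exact tsub_le_self.trans (ENNReal.inv_le_one.mpr hF.out)
  haveI : Fact (1 ≤ r) := ⟨hr1⟩
  have hkr := memLp_k hk0 hk1 hk hr1
  let A : Lp ℝ 2 μ →L[ℝ] Lp ℝ (ENNReal.ofReal q) μ := (ContinuousLinearMap.mul ℝ ℝ).holderL μ r 2 (ENNReal.ofReal q) (hkr.toLp k)
  let h : Lp ℝ 2 μ := (InnerProductSpace.toDual ℝ (Lp ℝ 2 μ)).symm (Λ.comp A)
  refine ⟨fun x => h x / k x, ?_, fun g hg hg2 => ?_⟩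
  · simp only [div_eq_mul_inv]
    exact (Lp.aestronglyMeasurable h).mul (hk.1.aemeasurable.inv.aestronglyMeasurable)
  · have e1 : A (hg2.toLp _) = hg.toLp g := by
      apply Lp.ext
      have c1 := (ContinuousLinearMap.mul ℝ ℝ).coeFn_holder (r := ENNReal.ofReal q) (hkr.toLp k) (hg2.toLp _)
      have c1' : A (hg2.toLp _) =ᵐ[μ] fun x => (hkr.toLp k) x * (hg2.toLp _) x := c1
      filter_upwards [c1', hkr.coeFn_toLp, hg2.coeFn_toLp, hg.coeFn_toLp] with x h1 h2 h3 h4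
      rw [h1, h2, h3, h4]
      have := (hk0 x).ne'
      field_simp
    have e2 : Λ (A (hg2.toLp _)) = inner ℝ h (hg2.toLp _) := by
      have : inner ℝ h (hg2.toLp _) = (Λ.comp A) (hg2.toLp _) := InnerProductSpace.toDual_symm_apply
      rw [this]; rfl
    rw [← e1, e2, L2.inner_def]
    refine integral_congr_ae ?_
    filter_upwards [hg2.coeFn_toLp] with x h1
    rw [h1]
    simp only [RCLike.inner_apply, conj_trivial]
    ring

lemma dual_rep {p q : ℝ} (hpq : p.HolderConjugate q) (hq2 : q ≤ 2) [hF : Fact (1 ≤ ENNReal.ofReal q)] {k : X → ℝ} (hkm : Measurable k) (hk0 : ∀ x, 0 < k x) (hk1 : ∀ x, k x ≤ 1) (hk : Integrable k μ)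
    (Λ : Lp ℝ (ENNReal.ofReal q) μ →L[ℝ] ℝ) :
    ∃ W : X → ℝ, Measurable W ∧ (∫⁻ x, ‖W x‖ₑ^p ∂μ ≤ ENNReal.ofReal (‖Λ‖^p)) ∧ 
      ∀ (g : X → ℝ) (hg : MemLp g (ENNReal.ofReal q) μ), MemLp (fun x => g x / k x) 2 μ → Λ (hg.toLp g) = ∫ x, W x * g x ∂μ := by
  have hp := hpq.pos
  have hp1 := hpq.lt
  have hq := hpq.symm.pos
  obtain ⟨W0, hW0, hrep0⟩ := dual_L2 (μ := μ) hpq.symm.lt hq2 hk0 hk1 hk Λ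
  set W := hW0.mk W0 with hW
  have hWm : Measurable W := hW0.stronglyMeasurable_mk.measurable
  have hrep : ∀ (g : X → ℝ) (hg : MemLp g (ENNReal.ofReal q) μ), MemLp (fun x => g x / k x) 2 μ → Λ (hg.toLp g) = ∫ x, W x * g x ∂μ := by
    intro g hg hg2
    rw [hrep0 g hg hg2]
    refine integral_congr_ae ?_
    filter_upwards [hW0.ae_eq_mk] with x hx
    rw [hx]
  refine ⟨W, hWm, ?_, hrep⟩
  set A : ℕ → Set X := fun n => {x | |W x| ≤ n} ∩ {x | 1 ≤ n * k x} with hA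
  have hAm : ∀ n, MeasurableSet (A n) := fun n => (measurableSet_le hWm.abs measurable_const).inter (measurableSet_le measurable_const (hkm.const_mul _))
  have hAfin : ∀ n, μ (A n) < ⊤ := by
    intro n
    by_cases hn : n = 0
    · have : A n = ∅ := by
        ext x; simp [hA, hn]
      rw [this]; simp
    · have hn' : (0:ℝ) < n := by positivity
      refine lt_of_le_of_lt (measure_mono (fun x hx => ?_)) (hk.measure_ge_lt_top (ε := 1/n) (by positivity))
      have := hx.2
      simp only [mem_ofPred_eq] at this ⊢
      rw [div_le_iff₀ hn']; linarith
  have hAmono : Monotone A := by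
    intro n m hnm x hx
    have hc : (n:ℝ) ≤ m := by exact_mod_cast hnm
    refine ⟨le_trans hx.1 hc, ?_⟩
    have := hx.2
    simp only [mem_ofPred_eq] at this ⊢
    nlinarith [hk0 x]
  have hAU : ⋃ n, A n = univ := by
    rw [eq_univ_iff_forall]
    intro x
    obtain ⟨n, hn⟩ := exists_nat_ge (max |W x| (1 / k x))
    refine mem_iUnion.mpr ⟨n, le_trans (le_max_left _ _) hn, ?_⟩
    have := le_trans (le_max_right _ _) hn
    rw [div_le_iff₀ (hk0 x)] at this
    exact this
  have key : ∀ n, ∫⁻ x in A n, ‖W x‖ₑ^p ∂μ ≤ ENNReal.ofReal (‖Λ‖^p) := by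
    intro n
    set g : X → ℝ := (A n).indicator (fun x => SignType.sign (W x) * |W x|^(p-1)) with hg
    have hgm : Measurable g := by
      refine Measurable.indicator ?_ (hAm n)
      refine Measurable.mul ?_ (hWm.abs.pow_const _)
      have : (fun x => ((SignType.sign (W x) : SignType) : ℝ)) = fun x => if 0 < W x then 1 else if W x < 0 then -1 else 0 := by
        ext x; simp only [sign_apply]; split_ifs <;> simp
      rw [this]
      exact Measurable.ite (measurableSet_lt measurable_const hWm) measurable_const (Measurable.ite (measurableSet_lt hWm measurable_const) measurable_const measurable_const)
    have hgabs : ∀ x, |g x| = (A n).indicator (fun x => |W x|^(p-1)) x := by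
      intro x
      by_cases hx : x ∈ A n
      · rw [hg, indicator_of_mem hx, indicator_of_mem hx, abs_mul, abs_of_nonneg (Real.rpow_nonneg (abs_nonneg _) _)]
        by_cases h0 : W x = 0
        · simp [h0, Real.zero_rpow (by linarith : p - 1 ≠ 0)]
        · rcases lt_or_gt_of_ne h0 with h | h
          · simp [sign_neg h]
          · simp [sign_pos h]
      · rw [hg, indicator_of_notMem hx, indicator_of_notMem hx, abs_zero]
    have hWg : ∀ x, W x * g x = (A n).indicator (fun x => |W x|^p) x := by
      intro x
      by_cases hx : x ∈ A n
      · rw [hg, indicator_of_mem hx, indicator_of_mem hx, ← mul_assoc, self_mul_sign]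
        by_cases h0 : W x = 0
        · simp [h0, Real.zero_rpow hp.ne']
        · rw [← Real.rpow_one_add' (abs_nonneg _) (by linarith)]; congr 1; ring
      · rw [hg, indicator_of_notMem hx, indicator_of_notMem hx, mul_zero]
    have hgq : ∀ x, ‖g x‖ₑ^q = (A n).indicator (fun x => ‖W x‖ₑ^p) x := by
      intro x
      rw [← Real.enorm_abs, hgabs]
      by_cases hx : x ∈ A n
      · rw [indicator_of_mem hx, indicator_of_mem hx, Real.enorm_eq_ofReal (Real.rpow_nonneg (abs_nonneg _) _), ← ENNReal.ofReal_rpow_of_nonneg (abs_nonneg _) (by linarith),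
          ← Real.norm_eq_abs, ofReal_norm, ← ENNReal.rpow_mul, hpq.sub_one_mul_conj]
      · rw [indicator_of_notMem hx, indicator_of_notMem hx, enorm_zero, ENNReal.zero_rpow_of_pos hq]
    have hbnd : ∀ (r : ℝ≥0∞) (F : X → ℝ) (M : ℝ), Measurable F → (∀ x ∈ A n, |F x| ≤ M) → (∀ x ∉ A n, F x = 0) → MemLp F r μ := by
      intro r F M hFm hFb hF0
      refine MemLp.mono' (memLp_indicator_const r (hAm n) M (Or.inr (hAfin n).ne)) hFm.aestronglyMeasurable (Filter.Eventually.of_forall fun x => ?_)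
      by_cases hx : x ∈ A n
      · rw [indicator_of_mem hx]; exact hFb x hx
      · rw [indicator_of_notMem hx, hF0 x hx, norm_zero]
    have hgb : ∀ x ∈ A n, |g x| ≤ (n:ℝ)^(p-1) := by
      intro x hx
      rw [hgabs, indicator_of_mem hx]
      exact Real.rpow_le_rpow (abs_nonneg _) hx.1 (by linarith)
    have hg0 : ∀ x ∉ A n, g x = 0 := fun x hx => indicator_of_notMem hx _
    have m1 : MemLp g (ENNReal.ofReal q) μ := hbnd _ g _ hgm hgb hg0
    have m2 : MemLp (fun x => g x / k x) 2 μ := by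
      refine hbnd 2 _ ((n:ℝ)^(p-1) * n) (hgm.div hkm) (fun x hx => ?_) (fun x hx => by simp [hg0 x hx])
      rw [abs_div, abs_of_pos (hk0 x), div_le_iff₀ (hk0 x), mul_assoc]
      have := hx.2
      simp only [mem_ofPred_eq] at this
      calc |g x| ≤ (n:ℝ)^(p-1) := hgb x hx
        _ = (n:ℝ)^(p-1) * 1 := (mul_one _).symm
        _ ≤ _ := mul_le_mul_of_nonneg_left this (by positivity)
    have r1 := hrep g m1 m2
    set I : ℝ := ∫ x, W x * g x ∂μ with hI
    have hIL : ∫⁻ x in A n, ‖W x‖ₑ^p ∂μ = ENNReal.ofReal I := by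
      have h_intg : Integrable (fun x => W x * g x) μ := by
        rw [← memLp_one_iff_integrable]
        refine hbnd 1 _ ((n:ℝ)^p) (hWm.mul hgm) (fun x hx => ?_) (fun x hx => by simp [hg0 x hx])
        rw [hWg, indicator_of_mem hx, abs_of_nonneg (by positivity)]
        exact Real.rpow_le_rpow (abs_nonneg _) hx.1 hp.le
      rw [hI, ofReal_integral_eq_lintegral_ofReal h_intg (Filter.Eventually.of_forall fun x => by
        show 0 ≤ W x * g x
        rw [hWg]; exact indicator_nonneg (fun x _ => by positivity) x), ← lintegral_indicator (hAm n)]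
      refine lintegral_congr fun x => ?_
      rw [hWg]
      by_cases hx : x ∈ A n
      · rw [indicator_of_mem hx, indicator_of_mem hx, ← ENNReal.ofReal_rpow_of_nonneg (abs_nonneg _) hp.le, ← Real.norm_eq_abs, ofReal_norm]
      · rw [indicator_of_notMem hx, indicator_of_notMem hx, ENNReal.ofReal_zero]
    have hI0 : 0 ≤ I := integral_nonneg fun x => by
      show 0 ≤ W x * g x
      rw [hWg]; exact indicator_nonneg (fun x _ => by positivity) x
    have hnorm : ‖m1.toLp g‖ = I^(1/q) := by
      rw [Lp.norm_toLp, eLpNorm_eq_lintegral_rpow_enorm_toReal (by simpa using hq) ENNReal.ofReal_ne_top, ENNReal.toReal_ofReal hq.le]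
      simp only [hgq]
      rw [lintegral_indicator (hAm n), hIL, ENNReal.ofReal_rpow_of_nonneg hI0 (by positivity), ENNReal.toReal_ofReal (by positivity)]
    have hle : I ≤ ‖Λ‖ * I^(1/q) := by
      rw [← hnorm]
      calc I = Λ (m1.toLp g) := r1.symm
        _ ≤ ‖Λ (m1.toLp g)‖ := Real.le_norm_self _
        _ ≤ _ := Λ.le_opNorm _
    rw [hIL]
    apply ENNReal.ofReal_le_ofReal
    by_cases hz : I = 0
    · rw [hz]; positivity
    · have hIp : 0 < I := lt_of_le_of_ne hI0 (Ne.symm hz)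
      have e : I^(1/p) * I^(1/q) = I := by
        rw [← Real.rpow_add hIp, one_div, one_div, hpq.inv_add_inv_eq_one, Real.rpow_one]
      have : I^(1/p) ≤ ‖Λ‖ := by
        have h0 : 0 < I^(1/q) := by positivity
        have hle' : I^(1/p) * I^(1/q) ≤ ‖Λ‖ * I^(1/q) := by rw [e]; exact hle
        exact le_of_mul_le_mul_right hle' h0
      calc I = (I^(1/p))^p := by rw [← Real.rpow_mul hI0, one_div_mul_cancel hp.ne', Real.rpow_one]
        _ ≤ _ := Real.rpow_le_rpow (by positivity) this hp.le
  rw [← setLIntegral_univ, ← hAU, setLIntegral_iUnion_of_directed _ hAmono.directed_le]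
  exact iSup_le key

end duality

/-! Part 14 -/

section spacetime
variable {d : ℕ}

lemma TF.unc_cont {G : ℝ → (Fin d → ℝ) → ℝ} (h : TF G) : Continuous (fun z : ℝ × (Fin d → ℝ) => G z.1 z.2) := by
  obtain ⟨K, η, φ, h1, h2, h3⟩ := h
  have : (fun z : ℝ × (Fin d → ℝ) => G z.1 z.2) = fun z : ℝ × (Fin d → ℝ) => ∑ k, η k z.1 * φ k z.2 := by
    ext z; simp [h3, Finset.sum_apply]
  rw [this]
  exact continuous_finsetSum _ fun k _ => ((h1 k).comp continuous_fst).mul ((h2 k).cont.comp continuous_snd)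

lemma TF.supp {G : ℝ → (Fin d → ℝ) → ℝ} (h : TF G) : ∃ s : Set (Fin d → ℝ), IsCompact s ∧ ∀ t, ∀ x ∉ s, G t x = 0 := by
  obtain ⟨K, η, φ, h1, h2, h3⟩ := h
  refine ⟨⋃ k, tsupport (φ k), isCompact_iUnion fun k => (h2 k).2, fun t x hx => ?_⟩
  rw [h3, Finset.sum_apply]
  refine Finset.sum_eq_zero fun k _ => ?_
  have : x ∉ tsupport (φ k) := fun hk => hx (mem_iUnion.mpr ⟨k, hk⟩)
  rw [Pi.smul_apply, image_eq_zero_of_notMem_tsupport this, smul_zero]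

lemma TF.single {η : ℝ → ℝ} (hη : Continuous η) {φ : (Fin d → ℝ) → ℝ} (h : Tst φ) : TF (fun t => η t • φ) :=
  ⟨1, fun _ => η, fun _ => φ, fun _ => hη, fun _ => h, fun t => by simp⟩

lemma TF.zero : TF (0 : ℝ → (Fin d → ℝ) → ℝ) :=
  ⟨0, fun _ _ => 0, fun _ => 0, fun _ => continuous_const, fun _ => Tst.zero, fun t => by simp⟩

lemma TF.smul {G : ℝ → (Fin d → ℝ) → ℝ} (c : ℝ) (h : TF G) : TF (c • G) := by
  obtain ⟨K, η, φ, h1, h2, h3⟩ := h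
  refine ⟨K, η, fun k => c • φ k, h1, fun k => (h2 k).smul c, fun t => ?_⟩
  rw [Pi.smul_apply, h3, Finset.smul_sum]
  exact Finset.sum_congr rfl fun k _ => smul_comm _ _ _

lemma TF.add {G G' : ℝ → (Fin d → ℝ) → ℝ} (h : TF G) (h' : TF G') : TF (G + G') := by
  obtain ⟨K, η, φ, h1, h2, h3⟩ := h
  obtain ⟨K', η', φ', h1', h2', h3'⟩ := h'
  refine ⟨K + K', Fin.addCases η η', Fin.addCases φ φ', fun k => ?_, fun k => ?_, fun t => ?_⟩
  · refine Fin.addCases (fun k => ?_) (fun k => ?_) k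
    · simpa using h1 k
    · simpa using h1' k
  · refine Fin.addCases (fun k => ?_) (fun k => ?_) k
    · simpa using h2 k
    · simpa using h2' k
  · rw [Pi.add_apply, h3, h3', Fin.sum_univ_add]
    simp

/-- the space-time measure -/
def sm (d : ℕ) (T : ℝ) : Measure (ℝ × (Fin d → ℝ)) := (volume.restrict (Ioc (0:ℝ) T)).prod volume

/-- weight -/
def wgt (d : ℕ) (z : ℝ × (Fin d → ℝ)) : ℝ := (1 + ‖z.2‖) ^ (-((d:ℝ)+1))

lemma wgt_cont : Continuous (wgt d) := by
  unfold wgt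
  refine Continuous.rpow_const (by fun_prop) (fun z => Or.inl ?_)
  positivity

lemma wgt_pos (z : ℝ × (Fin d → ℝ)) : 0 < wgt d z := by unfold wgt; positivity

lemma wgt_le (z : ℝ × (Fin d → ℝ)) : wgt d z ≤ 1 := by
  unfold wgt
  exact Real.rpow_le_one_of_one_le_of_nonpos (by linarith [norm_nonneg z.2]) (by linarith [(Nat.cast_nonneg d : (0:ℝ) ≤ d)])

lemma wgt_int (T : ℝ) : Integrable (wgt d) (sm d T) := by
  have h : Integrable (fun x : Fin d → ℝ => (1 + ‖x‖) ^ (-((d:ℝ)+1))) volume := integrable_one_add_norm (by simp)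
  have h1 : Integrable (fun _ : ℝ => (1:ℝ)) (volume.restrict (Ioc (0:ℝ) T)) := integrable_const _
  have := h1.mul_prod h
  simp only [one_mul] at this
  exact this

lemma memF {T : ℝ} {F : ℝ × (Fin d → ℝ) → ℝ} (hF : Continuous F) {s : Set (Fin d → ℝ)} (hs : IsCompact s)
    (h0 : ∀ t, ∀ x ∉ s, F (t, x) = 0) (r : ℝ≥0∞) : MemLp F r (sm d T) := by
  obtain ⟨M, hM⟩ := (isCompact_Icc (a := (0:ℝ)) (b := T)).prod hs |>.exists_bound_of_continuousOn hF.continuousOn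
  have hfin : sm d T (univ ×ˢ s) ≠ ⊤ := by
    rw [sm, Measure.prod_prod]
    exact ENNReal.mul_ne_top (by simp) hs.measure_lt_top.ne
  have hms : MeasurableSet (univ ×ˢ s : Set (ℝ × (Fin d → ℝ))) := MeasurableSet.univ.prod hs.measurableSet
  refine MemLp.mono' (memLp_indicator_const r hms M (Or.inr hfin)) hF.aestronglyMeasurable ?_
  have hae : ∀ᵐ z ∂(sm d T), z.1 ∈ Ioc (0:ℝ) T := by
    have : ∀ᵐ t ∂(volume.restrict (Ioc (0:ℝ) T)), t ∈ Ioc (0:ℝ) T := ae_restrict_mem measurableSet_Ioc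
    exact Measure.quasiMeasurePreserving_fst.ae this
  filter_upwards [hae] with z hz
  by_cases hx : z.2 ∈ s
  · rw [indicator_of_mem (show z ∈ univ ×ˢ s from ⟨mem_univ _, hx⟩)]
    exact hM z ⟨⟨hz.1.le, hz.2⟩, hx⟩
  · rw [indicator_of_notMem (fun h => hx h.2), show F z = 0 from h0 z.1 z.2 hx, norm_zero]

lemma TF.memLp {G : ℝ → (Fin d → ℝ) → ℝ} (h : TF G) (T : ℝ) (r : ℝ≥0∞) : MemLp (fun z : ℝ × (Fin d → ℝ) => G z.1 z.2) r (sm d T) := by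
  obtain ⟨s, hs, h0⟩ := h.supp
  exact memF h.unc_cont hs h0 r

lemma TF.memLp_div {G : ℝ → (Fin d → ℝ) → ℝ} (h : TF G) (T : ℝ) (r : ℝ≥0∞) : MemLp (fun z : ℝ × (Fin d → ℝ) => G z.1 z.2 / wgt d z) r (sm d T) := by
  obtain ⟨s, hs, h0⟩ := h.supp
  exact memF (h.unc_cont.div wgt_cont fun z => (wgt_pos z).ne') hs (fun t x hx => by simp [h0 t x hx]) r

lemma TF.lint {G : ℝ → (Fin d → ℝ) → ℝ} (h : TF G) {T q : ℝ} (hT : 0 ≤ T) (hq : 0 < q) :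
    ∫⁻ z, ‖G z.1 z.2‖ₑ^q ∂(sm d T) = ENNReal.ofReal (∫ t in (0:ℝ)..T, AA q (G t)) := by
  have hm : Measurable (fun z : ℝ × (Fin d → ℝ) => ‖G z.1 z.2‖ₑ^q) := h.unc_cont.measurable.enorm.pow_const _
  rw [sm, lintegral_prod _ hm.aemeasurable, intervalIntegral.integral_of_le hT,
    ofReal_integral_eq_lintegral_ofReal ((h.AA_cont hq).integrableOn_Ioc) (Filter.Eventually.of_forall fun t => AA_nonneg _ _)]
  refine lintegral_congr fun t => ?_
  rw [AA, ENNReal.ofReal_toReal ((h.tst t).fin hq).ne]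

lemma TF.norm {G : ℝ → (Fin d → ℝ) → ℝ} (h : TF G) {T q : ℝ} (hT : 0 ≤ T) (hq : 0 < q) :
    ‖(h.memLp T (ENNReal.ofReal q)).toLp _‖ = (∫ t in (0:ℝ)..T, AA q (G t))^(1/q) := by
  have h0 : 0 ≤ ∫ t in (0:ℝ)..T, AA q (G t) := intervalIntegral.integral_nonneg hT fun t _ => AA_nonneg _ _
  rw [Lp.norm_toLp, eLpNorm_eq_lintegral_rpow_enorm_toReal (by simpa using hq) ENNReal.ofReal_ne_top, ENNReal.toReal_ofReal hq.le,
    h.lint hT hq, ENNReal.ofReal_rpow_of_nonneg h0 (by positivity), ENNReal.toReal_ofReal (by positivity)]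

/-- space of test functions on space-time -/
def TFS (d : ℕ) : Submodule ℝ (ℝ → (Fin d → ℝ) → ℝ) where
  carrier := {G | TF G}
  add_mem' h h' := TF.add h h'
  zero_mem' := TF.zero
  smul_mem' c _ h := TF.smul c h

/-- embedding -/
def TFJ (d : ℕ) (T q : ℝ) [Fact (1 ≤ ENNReal.ofReal q)] : TFS d →ₗ[ℝ] Lp ℝ (ENNReal.ofReal q) (sm d T) where
  toFun G := (TF.memLp G.2 T (ENNReal.ofReal q)).toLp _
  map_add' G G' := (MemLp.toLp_add (TF.memLp G.2 T (ENNReal.ofReal q)) (TF.memLp G'.2 T (ENNReal.ofReal q)))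
  map_smul' c G := MemLp.toLp_const_smul c (TF.memLp G.2 T (ENNReal.ofReal q))

variable {P : ℝ≥0∞} [hP : Fact (1 ≤ P)] {T κ : ℝ} {a : ℝ → Fin d → Fin d → ℝ} {f u : ℝ → Lp ℝ P (volume : Measure (Fin d → ℝ))}

lemma TF.pru_ii (H : Hyp P T κ a f u) {G : ℝ → (Fin d → ℝ) → ℝ} (h : TF G) : IntervalIntegrable (fun t => pr (u t) (G t)) volume 0 T := by
  apply ContinuousOn.intervalIntegrable
  rw [uIcc_of_le H.hT.le]
  exact h.pru_cont H

/-- functional -/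
def TFl (H : Hyp P T κ a f u) (i j : Fin d) : TFS d →ₗ[ℝ] ℝ where
  toFun G := ∫ t in (0:ℝ)..T, pr (u t) (pd i (pd j (G.1 t)))
  map_add' G G' := by
    have hG : TF G.1 := G.2
    have hG' : TF G'.1 := G'.2
    rw [← intervalIntegral.integral_add (((hG.pd j).pd i).pru_ii H) (((hG'.pd j).pd i).pru_ii H)]
    congr 1
    ext t
    have e : (G + G').1 t = G.1 t + G'.1 t := rfl
    rw [e, pd_add _ (hG.tst t) (hG'.tst t), pd_add _ ((hG.tst t).pd j) ((hG'.tst t).pd j), pr_add_right _ (((hG.tst t).pd j).pd i) (((hG'.tst t).pd j).pd i)]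
  map_smul' c G := by
    have hG : TF G.1 := G.2
    rw [RingHom.id_apply, smul_eq_mul, ← intervalIntegral.integral_const_mul]
    congr 1
    ext t
    have e : (c • G).1 t = c • G.1 t := rfl
    rw [e, pd_smul _ _ (hG.tst t), pd_smul _ _ ((hG.tst t).pd j), pr_smul_right]

lemma exists_W {p q κ C : ℝ} [Fact (1 ≤ ENNReal.ofReal p)] [Fact (1 ≤ ENNReal.ofReal q)] {f u : ℝ → Lp ℝ (ENNReal.ofReal p) (volume : Measure (Fin d → ℝ))}
    (H : Hyp (ENNReal.ofReal p) T κ a f u) (hpq : p.HolderConjugate q) (hq2 : q ≤ 2)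
    (hf : IntegrableOn (fun t => ‖f t‖^p) (Ioc (0:ℝ) T)) (hC0 : 0 ≤ C)
    (hC : ∀ (v : Fin d → ℝ) (g : ℕ → (Fin d → ℝ) → ℝ), (∀ n, Measurable (g n)) → ∀ (N : ℕ) (R : ℕ → ((Fin d → ℝ) → ℝ) →ₗ[ℝ] ((Fin d → ℝ) → ℝ)),
      (∀ n, IsConvShf (R n)) → SchBd q C R v g N) (i j : Fin d) :
    ∃ W : ℝ × (Fin d → ℝ) → ℝ, Measurable W ∧
      ∫⁻ z, ‖W z‖ₑ^p ∂(sm d T) ≤ ENNReal.ofReal (((2/κ) * C^(1/q) * (∫ r in Ioc (0:ℝ) T, ‖f r‖^p)^(1/p))^p) ∧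
      ∀ G, TF G → ∫ t in (0:ℝ)..T, pr (u t) (pd i (pd j (G t))) = ∫ z, W z * G z.1 z.2 ∂(sm d T) := by
  have hκ := H.hκ
  have hq := hpq.symm.pos
  have hF0 : 0 ≤ ∫ r in Ioc (0:ℝ) T, ‖f r‖^p := integral_nonneg fun r => by positivity
  set B := (2/κ) * C^(1/q) * (∫ r in Ioc (0:ℝ) T, ‖f r‖^p)^(1/p) with hB
  have hB0 : 0 ≤ B := by positivity
  obtain ⟨Λ, hΛ, hrep⟩ := hahn (TFJ d T q) (TFl H i j) hB0 (fun G => by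
    have hG : TF G.1 := G.2
    have h1 := core_ij H hpq hf hC0 hC i j hG
    have h2 : ‖TFJ d T q G‖ = (∫ t in (0:ℝ)..T, AA q (G.1 t))^(1/q) := hG.norm H.hT.le hq
    have h0 : 0 ≤ ∫ t in (0:ℝ)..T, AA q (G.1 t) := intervalIntegral.integral_nonneg H.hT.le fun t _ => AA_nonneg _ _
    rw [h2]
    rw [Real.mul_rpow hC0 h0] at h1
    refine le_trans h1 (le_of_eq ?_)
    rw [hB]; ring)
  obtain ⟨W, hW, hWn, hWr⟩ := dual_rep hpq hq2 wgt_cont.measurable wgt_pos wgt_le (wgt_int T) Λ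
  refine ⟨W, hW, hWn.trans (ENNReal.ofReal_le_ofReal (Real.rpow_le_rpow (norm_nonneg _) hΛ hpq.nonneg)), fun G hG => ?_⟩
  have := hWr _ (hG.memLp T (ENNReal.ofReal q)) (hG.memLp_div T 2)
  rw [← this]
  exact (hrep ⟨G, hG⟩).symm

end spacetime

/-! Part 15 -/

section slices
variable {d : ℕ}

lemma Tst.memLp {φ : (Fin d → ℝ) → ℝ} (h : Tst φ) (r : ℝ≥0∞) : MemLp φ r volume := h.cont.memLp_of_hasCompactSupport h.2

lemma Tst.norm {φ : (Fin d → ℝ) → ℝ} (h : Tst φ) {q : ℝ} (hq : 0 < q) : ‖(h.memLp (ENNReal.ofReal q)).toLp φ‖ = (AA q φ)^(1/q) := by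
  rw [Lp.norm_toLp, eLpNorm_eq_lintegral_rpow_enorm_toReal (by simpa using hq) ENNReal.ofReal_ne_top, ENNReal.toReal_ofReal hq.le,
    ← ENNReal.toReal_rpow]
  rfl

lemma Tst.dist {φ ψ : (Fin d → ℝ) → ℝ} (h : Tst φ) (h' : Tst ψ) {q : ℝ} (hq : 0 < q) [Fact (1 ≤ ENNReal.ofReal q)] :
    dist ((h.memLp (ENNReal.ofReal q)).toLp φ) ((h'.memLp (ENNReal.ofReal q)).toLp ψ) = (AA q (φ - ψ))^(1/q) := by
  rw [dist_eq_norm, ← (h.sub h').norm hq]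
  rfl

/-- test functions as a bare type -/
def TstT (d : ℕ) : Type := {φ : (Fin d → ℝ) → ℝ // Tst φ}

lemma count_dense {q : ℝ} (hq : 0 < q) [Fact (1 ≤ ENNReal.ofReal q)] (i j : Fin d) :
    ∃ S : Set (TstT d), S.Countable ∧ ∀ φ : (Fin d → ℝ) → ℝ, Tst φ → ∀ ε > 0, ∃ ψ ∈ S,
      (AA q (φ - ψ.1))^(1/q) < ε ∧ (AA q (pd i (pd j (φ - ψ.1))))^(1/q) < ε := by
  have : Fact (ENNReal.ofReal q ≠ ⊤) := ⟨ENNReal.ofReal_ne_top⟩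
  let Φ : (TstT d) → Lp ℝ (ENNReal.ofReal q) (volume : Measure (Fin d → ℝ)) × Lp ℝ (ENNReal.ofReal q) (volume : Measure (Fin d → ℝ)) :=
    fun φ => ((φ.2.memLp (ENNReal.ofReal q)).toLp _, (((φ.2.pd j).pd i).memLp (ENNReal.ofReal q)).toLp _)
  let _ : PseudoMetricSpace (TstT d) := PseudoMetricSpace.induced Φ inferInstance
  have hi : Topology.IsInducing Φ := ⟨rfl⟩
  have : SecondCountableTopology (TstT d) := hi.secondCountableTopology
  obtain ⟨S, hS, hd⟩ := TopologicalSpace.exists_countable_dense (TstT d)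
  refine ⟨S, hS, fun φ hφ ε hε => ?_⟩
  obtain ⟨ψ, hψ, hdist⟩ := hd.exists_dist_lt (show TstT d from ⟨φ, hφ⟩) hε
  have e : Dist.dist (show TstT d from ⟨φ, hφ⟩) ψ = Dist.dist (Φ ⟨φ, hφ⟩) (Φ ψ) := rfl
  rw [e, Prod.dist_eq, max_lt_iff] at hdist
  refine ⟨ψ, hψ, ?_, ?_⟩
  · rw [← hφ.dist ψ.2 hq]; exact hdist.1
  · rw [pd_sub _ hφ ψ.2, pd_sub _ (hφ.pd j) (ψ.2.pd j), ← ((hφ.pd j).pd i).dist ((ψ.2.pd j).pd i) hq]; exact hdist.2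

lemma rep_all {p q : ℝ} (hpq : p.HolderConjugate q) [Fact (1 ≤ ENNReal.ofReal p)] (i j : Fin d) {S : Set (TstT d)}
    (hS : ∀ φ : (Fin d → ℝ) → ℝ, Tst φ → ∀ ε > 0, ∃ ψ ∈ S,
      (AA q (φ - ψ.1))^(1/q) < ε ∧ (AA q (pd i (pd j (φ - ψ.1))))^(1/q) < ε)
    (u w : Lp ℝ (ENNReal.ofReal p) (volume : Measure (Fin d → ℝ))) (h : ∀ ψ ∈ S, pr u (pd i (pd j ψ.1)) = pr w ψ.1)
    {φ : (Fin d → ℝ) → ℝ} (hφ : Tst φ) : pr u (pd i (pd j φ)) = pr w φ := by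
  rw [← sub_eq_zero, ← abs_nonpos_iff]
  refine le_of_forall_pos_le_add fun ε hε => ?_
  obtain ⟨ψ, hψ, h1, h2⟩ := hS φ hφ (ε / (‖u‖ + ‖w‖ + 1)) (by positivity)
  have hs := hφ.sub ψ.2
  have b1 := pr_holder hpq w hs
  have b2 := pr_holder hpq u ((hs.pd j).pd i)
  have e : pr u (pd i (pd j φ)) - pr w φ = pr u (pd i (pd j (φ - ψ.1))) - pr w (φ - ψ.1) := by
    rw [pd_sub _ hφ ψ.2, pd_sub _ (hφ.pd j) (ψ.2.pd j), pr_sub_right _ ((hφ.pd j).pd i) ((ψ.2.pd j).pd i), pr_sub_right _ hφ ψ.2, h ψ hψ]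
    ring
  rw [e, zero_add]
  refine (abs_sub _ _).trans ?_
  have hpos : 0 < ‖u‖ + ‖w‖ + 1 := by positivity
  calc _ ≤ (ε / (‖u‖ + ‖w‖ + 1)) * ‖u‖ + (ε / (‖u‖ + ‖w‖ + 1)) * ‖w‖ := by
        refine add_le_add (b2.trans ?_) (b1.trans ?_)
        · gcongr
        · gcongr
    _ ≤ (ε / (‖u‖ + ‖w‖ + 1)) * (‖u‖ + ‖w‖ + 1) := by
        rw [← mul_add]
        exact mul_le_mul_of_nonneg_left (by linarith) (by positivity)
    _ = ε := by field_simp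

open Classical in
/-- slices of a space-time function -/
def slc (p : ℝ) (W : ℝ × (Fin d → ℝ) → ℝ) (t : ℝ) : Lp ℝ (ENNReal.ofReal p) (volume : Measure (Fin d → ℝ)) :=
  if h : MemLp (fun x => W (t, x)) (ENNReal.ofReal p) volume then h.toLp _ else 0

lemma slc_spec {p : ℝ} (hp : 0 < p) {W : ℝ × (Fin d → ℝ) → ℝ} (hW : Measurable W) {t : ℝ} (ht : ∫⁻ x, ‖W (t, x)‖ₑ^p < ⊤) :
    (slc p W t : (Fin d → ℝ) → ℝ) =ᵐ[volume] (fun x => W (t, x)) ∧ ‖slc p W t‖^p = (∫⁻ x, ‖W (t, x)‖ₑ^p).toReal := by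
  have hm : MemLp (fun x => W (t, x)) (ENNReal.ofReal p) volume := by
    refine ⟨(hW.comp measurable_prodMk_left).aestronglyMeasurable, ?_⟩
    rw [eLpNorm_lt_top_iff_lintegral_rpow_enorm_lt_top (by simpa using hp) ENNReal.ofReal_ne_top, ENNReal.toReal_ofReal hp.le]
    exact ht
  have e : slc p W t = hm.toLp _ := by rw [slc, dif_pos hm]
  rw [e]
  refine ⟨hm.coeFn_toLp, ?_⟩
  rw [Lp.norm_toLp, eLpNorm_eq_lintegral_rpow_enorm_toReal (by simpa using hp) ENNReal.ofReal_ne_top, ENNReal.toReal_ofReal hp.le,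
    ← ENNReal.toReal_rpow, ← Real.rpow_mul ENNReal.toReal_nonneg, one_div_mul_cancel hp.ne', Real.rpow_one]

lemma slc_int {p : ℝ} (hp : 0 < p) {T B : ℝ} (hB : 0 ≤ B) {W : ℝ × (Fin d → ℝ) → ℝ} (hW : Measurable W) (h : ∫⁻ z, ‖W z‖ₑ^p ∂(sm d T) ≤ ENNReal.ofReal B) :
    (∀ᵐ t ∂(volume.restrict (Ioc (0:ℝ) T)), ∫⁻ x, ‖W (t, x)‖ₑ^p < ⊤) ∧
    IntegrableOn (fun t => ‖slc p W t‖^p) (Ioc (0:ℝ) T) ∧ ∫ t in Ioc (0:ℝ) T, ‖slc p W t‖^p ≤ B := by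
  have hm : Measurable (fun z => ‖W z‖ₑ^p) := hW.enorm.pow_const _
  have hm2 : Measurable (fun t => ∫⁻ x, ‖W (t, x)‖ₑ^p) := hm.lintegral_prod_right'
  rw [sm, lintegral_prod _ hm.aemeasurable] at h
  have hfin := (lt_of_le_of_lt h ENNReal.ofReal_lt_top)
  have hae := ae_lt_top hm2 hfin.ne
  have hc : (fun t => ‖slc p W t‖^p) =ᵐ[volume.restrict (Ioc (0:ℝ) T)] fun t => (∫⁻ x, ‖W (t, x)‖ₑ^p).toReal := by
    filter_upwards [hae] with t ht
    exact (slc_spec hp hW ht).2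
  refine ⟨hae, (integrable_toReal_of_lintegral_ne_top hm2.aemeasurable hfin.ne).congr hc.symm, ?_⟩
  rw [integral_congr_ae hc, integral_toReal hm2.aemeasurable hae]
  exact ENNReal.toReal_le_of_le_ofReal hB h

lemma exists_w {T p q κ C : ℝ} [Fact (1 ≤ ENNReal.ofReal p)] [Fact (1 ≤ ENNReal.ofReal q)] {a : ℝ → Fin d → Fin d → ℝ} {f u : ℝ → Lp ℝ (ENNReal.ofReal p) (volume : Measure (Fin d → ℝ))}
    (H : Hyp (ENNReal.ofReal p) T κ a f u) (hpq : p.HolderConjugate q) (hq2 : q ≤ 2)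
    (hf : IntegrableOn (fun t => ‖f t‖^p) (Ioc (0:ℝ) T)) (hC0 : 0 ≤ C)
    (hC : ∀ (v : Fin d → ℝ) (g : ℕ → (Fin d → ℝ) → ℝ), (∀ n, Measurable (g n)) → ∀ (N : ℕ) (R : ℕ → ((Fin d → ℝ) → ℝ) →ₗ[ℝ] ((Fin d → ℝ) → ℝ)),
      (∀ n, IsConvShf (R n)) → SchBd q C R v g N) (i j : Fin d) :
    ∃ w : ℝ → Lp ℝ (ENNReal.ofReal p) (volume : Measure (Fin d → ℝ)),
      (∀ᵐ t ∂(volume.restrict (Ioc (0:ℝ) T)), ∀ φ : (Fin d → ℝ) → ℝ, Tst φ → pr (u t) (pd i (pd j φ)) = pr (w t) φ) ∧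
      IntegrableOn (fun t => ‖w t‖^p) (Ioc (0:ℝ) T) ∧
      ∫ t in Ioc (0:ℝ) T, ‖w t‖^p ≤ ((2/κ) * C^(1/q) * (∫ r in Ioc (0:ℝ) T, ‖f r‖^p)^(1/p))^p := by
  obtain ⟨W, hW, hWb, hWr⟩ := exists_W H hpq hq2 hf hC0 hC i j
  have hp := hpq.pos
  have hκ := H.hκ
  have hF0 : 0 ≤ ∫ r in Ioc (0:ℝ) T, ‖f r‖^p := integral_nonneg fun r => by positivity
  obtain ⟨hae, h_intg, hle⟩ := slc_int hp (by positivity) hW hWb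
  refine ⟨slc p W, ?_, h_intg, hle⟩
  have hWp : MemLp W (ENNReal.ofReal p) (sm d T) := by
    refine ⟨hW.aestronglyMeasurable, ?_⟩
    rw [eLpNorm_lt_top_iff_lintegral_rpow_enorm_lt_top (by simpa using hp) ENNReal.ofReal_ne_top, ENNReal.toReal_ofReal hp.le]
    exact lt_of_le_of_lt hWb ENNReal.ofReal_lt_top
  have hHC : ENNReal.HolderConjugate (ENNReal.ofReal p) (ENNReal.ofReal q) := hpq.ennrealOfReal
  have one : ∀ φ : (Fin d → ℝ) → ℝ, Tst φ → ∀ᵐ t ∂(volume.restrict (Ioc (0:ℝ) T)), pr (u t) (pd i (pd j φ)) = pr (slc p W t) φ := by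
    intro φ hφ
    have hi : ∀ η : ℝ → ℝ, Continuous η → Integrable (fun z : ℝ × (Fin d → ℝ) => W z * (η z.1 * φ z.2)) (sm d T) := fun η hη =>
      hWp.integrable_mul ((TF.single hη hφ).memLp T (ENNReal.ofReal q))
    have hsl : ∀ᵐ t ∂(volume.restrict (Ioc (0:ℝ) T)), pr (slc p W t) φ = ∫ x, W (t, x) * φ x := by
      filter_upwards [hae] with t ht
      refine integral_congr_ae ?_
      filter_upwards [(slc_spec hp hW ht).1] with x hx
      rw [hx]
    have hg2 : Integrable (fun t => ∫ x, W (t, x) * φ x) (volume.restrict (Ioc (0:ℝ) T)) := by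
      have := (hi (fun _ => 1) continuous_const).integral_prod_left
      simpa using this
    have hg1 : Integrable (fun t => pr (u t) (pd i (pd j φ))) (volume.restrict (Ioc (0:ℝ) T)) := by
      have := H.pru_cont ((hφ.pd j).pd i)
      exact (this.integrableOn_Icc (μ := volume)).mono_set Ioc_subset_Icc_self
    have := ae_eq_of_integral_contDiff_smul_eq hg1.locallyIntegrable hg2.locallyIntegrable (fun η hη _ => by
      have hT := TF.single hη.continuous hφ
      have e := hWr _ hT
      have e1 : ∫ t in (0:ℝ)..T, pr (u t) (pd i (pd j (η t • φ))) = ∫ t in Ioc (0:ℝ) T, η t • pr (u t) (pd i (pd j φ)) := by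
        rw [intervalIntegral.integral_of_le H.hT.le]
        congr 1
        ext t
        rw [pd_smul _ _ hφ, pd_smul _ _ (hφ.pd j), pr_smul_right, smul_eq_mul]
      rw [← e1, e]
      have e2 := integral_prod _ (hi η hη.continuous)
      have e3 : ∫ z, W z * (η z.1 • φ) z.2 ∂(sm d T) = ∫ z, W z * (η z.1 * φ z.2) ∂(sm d T) := rfl
      rw [e3, sm, e2]
      congr 1
      ext t
      rw [smul_eq_mul, ← integral_const_mul]
      congr 1
      ext x
      ring)
    filter_upwards [this, hsl] with t h1 h2
    rw [h1, h2]
  obtain ⟨S, hS, hd⟩ := count_dense (d := d) hpq.symm.pos i j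
  have hall : ∀ᵐ t ∂(volume.restrict (Ioc (0:ℝ) T)), ∀ ψ ∈ S, pr (u t) (pd i (pd j ψ.1)) = pr (slc p W t) ψ.1 :=
    (ae_ball_iff hS).mpr fun ψ _ => one ψ.1 ψ.2
  filter_upwards [hall] with t ht φ hφ
  exact rep_all hpq i j hd _ _ ht hφ

end slices

/-! Part 16 -/

/-- Under uniform ellipticity `Σ a^{ij}(t) ξ^i ξ^j ≥ κ|ξ|²` (with no upper bound on the
coefficients), a continuous weak solution with zero initial data has second derivatives in
`L_p` for a.e. `t`, and `‖u_{xx}‖_{L_p((0,T);L_p)} ≤ N κ⁻¹ ‖f‖_{L_p((0,T);L_p)}` with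
`N = N(d,p)`, independent of `κ`, `T` and the coefficients. -/
theorem second_derivative_estimate_elliptic (d : ℕ) (hd : 0 < d)
    (p : ℝ) (hp : 2 ≤ p) [Fact (1 ≤ ENNReal.ofReal p)] :
    ∃ N : ℝ, 0 < N ∧
      ∀ (T κ : ℝ), 0 < T → 0 < κ →
      ∀ (a : ℝ → Fin d → Fin d → ℝ),
        (∀ i j, Measurable fun t => a t i j) →
        (∀ t ∈ Ioc (0:ℝ) T, ∀ i j, a t i j = a t j i) →
        (∀ t ∈ Ioc (0:ℝ) T, ∀ ξ : Fin d → ℝ,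
          κ * (∑ k, ξ k ^ 2) ≤ ∑ i, ∑ j, a t i j * ξ i * ξ j) →
        IntegrableOn (aMax a) (Ioc (0:ℝ) T) →
      ∀ (f u : ℝ → Lp ℝ (ENNReal.ofReal p) (volume : Measure (Fin d → ℝ))),
        AEStronglyMeasurable f (volume.restrict (Ioc (0:ℝ) T)) →
        IntegrableOn (fun t => ‖f t‖ ^ p) (Ioc (0:ℝ) T) →
        IsWeakSolution (ENNReal.ofReal p) T a 0 f u →
        ContinuousOn u (Icc (0:ℝ) T) →
        ∃ w : ℝ → Fin d → Fin d → Lp ℝ (ENNReal.ofReal p) (volume : Measure (Fin d → ℝ)),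
          (∀ᵐ t ∂(volume.restrict (Ioc (0:ℝ) T)), ∀ i j : Fin d,
            ∀ φ : (Fin d → ℝ) → ℝ, ContDiff ℝ (⊤ : ℕ∞) φ → HasCompactSupport φ →
              (∫ x, u t x * pd i (pd j φ) x) = ∫ x, w t i j x * φ x) ∧
          (∫ t in Ioc (0:ℝ) T, ∑ i, ∑ j, ‖w t i j‖ ^ p) ^ (1/p) ≤
            N * κ⁻¹ * (∫ t in Ioc (0:ℝ) T, ‖f t‖ ^ p) ^ (1/p) := by
  have hp1 : 1 < p := by linarith
  have hp0 : 0 < p := by linarith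
  set q := p.conjExponent with hq
  have hpq : p.HolderConjugate q := Real.HolderConjugate.conjExponent hp1
  have hq1 : 1 < q := hpq.symm.lt
  have hq2 : q ≤ 2 := by
    rw [hq, Real.conjExponent, div_le_iff₀ (by linarith)]; linarith
  have : Fact (1 ≤ ENNReal.ofReal q) := ⟨ENNReal.one_le_ofReal.mpr hq1.le⟩
  obtain ⟨C, hC1, hC⟩ := sch_bound q hq1 hq2
  have hC0 : 0 < C := by linarith
  have hd' : (0:ℝ) < d := by exact_mod_cast hd
  refine ⟨((d:ℝ)*d)^(1/p) * (2 * C^(1/q)), by positivity, fun T κ hT hκ a am asym aell aint f u fm fi weak ucont => ?_⟩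
  have fint : IntegrableOn (fun t => ‖f t‖) (Ioc (0:ℝ) T) := by
    have h1 : Integrable (fun t => 1 + ‖f t‖ ^ p) (volume.restrict (Ioc (0:ℝ) T)) := (integrable_const _).add fi
    refine h1.mono' fm.norm (Filter.Eventually.of_forall fun t => ?_)
    rw [norm_norm]
    rcases le_total ‖f t‖ 1 with h | h
    · have : 0 ≤ ‖f t‖ ^ p := by positivity
      linarith
    · have := Real.self_le_rpow_of_one_le h hp1.le
      linarith
  have H : Hyp (ENNReal.ofReal p) T κ a f u := ⟨hd, hT, hκ, am, asym, aell, aint, fm, fint, weak, ucont, fun φ h => h.bd hpq⟩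
  choose w hw hwi hwb using fun i j => exists_w H hpq hq2 fi hC0.le (hC d) i j
  have hF0 : 0 ≤ ∫ r in Ioc (0:ℝ) T, ‖f r‖^p := integral_nonneg fun r => by positivity
  set F := ∫ r in Ioc (0:ℝ) T, ‖f r‖^p with hF
  refine ⟨fun t i j => w i j t, ?_, ?_⟩
  · have : ∀ᵐ t ∂(volume.restrict (Ioc (0:ℝ) T)), ∀ i j, ∀ φ : (Fin d → ℝ) → ℝ, Tst φ → pr (u t) (pd i (pd j φ)) = pr (w i j t) φ := by
      simp only [ae_all_iff]
      exact hw
    filter_upwards [this] with t ht i j φ h1 h2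
    exact ht i j φ ⟨h1, h2⟩
  · have e : ∫ t in Ioc (0:ℝ) T, ∑ i, ∑ j, ‖w i j t‖ ^ p = ∑ i, ∑ j, ∫ t in Ioc (0:ℝ) T, ‖w i j t‖ ^ p := by
      rw [integral_finsetSum _ fun i _ => integrable_finsetSum _ fun j _ => hwi i j]
      exact Finset.sum_congr rfl fun i _ => integral_finsetSum _ fun j _ => hwi i j
    have hle : ∫ t in Ioc (0:ℝ) T, ∑ i, ∑ j, ‖w i j t‖ ^ p ≤ (d * d) * ((2/κ) * C^(1/q) * F^(1/p))^p := by
      rw [e]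
      refine (Finset.sum_le_sum fun i _ => Finset.sum_le_sum fun j _ => hwb i j).trans (le_of_eq ?_)
      simp; ring
    have h0 : 0 ≤ ∫ t in Ioc (0:ℝ) T, ∑ i, ∑ j, ‖w i j t‖ ^ p := integral_nonneg fun t => Finset.sum_nonneg fun i _ => Finset.sum_nonneg fun j _ => by positivity
    refine (Real.rpow_le_rpow h0 hle (by positivity)).trans (le_of_eq ?_)
    rw [Real.mul_rpow (by positivity) (by positivity), ← Real.rpow_mul (by positivity), mul_one_div_cancel hp0.ne', Real.rpow_one]
    rw [div_eq_mul_inv]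
    ring

end
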